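/- Let ψ: ℕ → [0,1/2] be a function satisfying ∑_{n=1}^∞ ψ(n)φ(n)/n = ∞. Write S(N,α) for the number of pairs of integers (a,n) with 1 ≤ n ≤ N, gcd(a,n) = 1 and |α − a/n| ≤ ψ(n)/n, and let Ψ(N) := ∑_{n=1}^N 2φ(n)ψ(n)/n. Then for all A > 0 and Lebesgue-almost all α ∈ [0,1], S(N,α) = Ψ(N)(1 + O_{α,A}(1/(log Ψ(N))^A)) as N → ∞. -/

import Mathlib

open MeasureTheory Filter

/-- The number of coprime integer solutions `(a, n)` of `|α - a/n| ≤ ψ(n)/n`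
with `1 ≤ n ≤ N`. -/
noncomputable def S (ψ : ℕ → ℝ) (N : ℕ) (α : ℝ) : ℕ :=
  Set.ncard {p : ℤ × ℕ | 1 ≤ p.2 ∧ p.2 ≤ N ∧ Int.gcd p.1 (p.2 : ℤ) = 1 ∧
    |α - (p.1 : ℝ) / (p.2 : ℝ)| ≤ ψ p.2 / p.2}

/-- `Ψ(N) = ∑_{n=1}^N 2 φ(n) ψ(n) / n`. -/
noncomputable def Psi (ψ : ℕ → ℝ) (N : ℕ) : ℝ :=
  ∑ n ∈ Finset.Icc 1 N, 2 * (Nat.totient n : ℝ) * ψ n / n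

namespace QDS

def dd (i j : ℕ) : ℕ := (i - j) + (j - i)

lemma dd_comm (i j : ℕ) : dd i j = dd j i := by unfold dd; omega

lemma geo_Ico (r : ℝ) (h0 : 0 < r) (h1 : r < 1) (s M : ℕ) :
    ∑ d ∈ Finset.Ico s M, r ^ d ≤ r ^ s / (1 - r) := by
  have h := geom_sum_Ico_le_of_lt_one (m := s) (n := M) h0.le h1
  exact h

lemma geo (r : ℝ) (h0 : 0 < r) (h1 : r < 1) (s n i : ℕ) (hs : 1 ≤ s) :
    ∑ j ∈ (Finset.range n).filter (fun j => s ≤ dd i j), r ^ (dd i j) ≤ 2 * r ^ s / (1 - r) := by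
  have hsub : (Finset.range n).filter (fun j => s ≤ dd i j) ⊆
      (Finset.range n).filter (fun j => j + s ≤ i) ∪ (Finset.range n).filter (fun j => i + s ≤ j) := by
    intro j; simp only [Finset.mem_filter, Finset.mem_union, Finset.mem_range]
    unfold dd; rintro ⟨h1, h2⟩; omega
  have hA : ∑ j ∈ (Finset.range n).filter (fun j => j + s ≤ i), r ^ (dd i j) ≤ r ^ s / (1 - r) := by
    refine le_trans ?_ (geo_Ico r h0 h1 s (i + 1))
    rw [← Finset.sum_image (f := fun d => r ^ d) (g := fun j => dd i j)]
    · apply Finset.sum_le_sum_of_subset_of_nonneg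
      · intro d; simp only [Finset.mem_image, Finset.mem_filter, Finset.mem_range, Finset.mem_Ico, dd]
        rintro ⟨j, hj, rfl⟩; omega
      · intros; positivity
    · intro a ha b hb hab
      simp only [Finset.coe_filter, Set.mem_ofPred_eq, Finset.mem_range, dd] at ha hb hab; omega
  have hB : ∑ j ∈ (Finset.range n).filter (fun j => i + s ≤ j), r ^ (dd i j) ≤ r ^ s / (1 - r) := by
    refine le_trans ?_ (geo_Ico r h0 h1 s (n + 1))
    rw [← Finset.sum_image (f := fun d => r ^ d) (g := fun j => dd i j)]
    · apply Finset.sum_le_sum_of_subset_of_nonneg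
      · intro d; simp only [Finset.mem_image, Finset.mem_filter, Finset.mem_range, Finset.mem_Ico, dd]
        rintro ⟨j, hj, rfl⟩; omega
      · intros; positivity
    · intro a ha b hb hab
      simp only [Finset.coe_filter, Set.mem_ofPred_eq, Finset.mem_range, dd] at ha hb hab; omega
  calc _ ≤ ∑ j ∈ (Finset.range n).filter (fun j => j + s ≤ i) ∪
        (Finset.range n).filter (fun j => i + s ≤ j), r ^ (dd i j) :=
        Finset.sum_le_sum_of_subset_of_nonneg hsub (by intros; positivity)
    _ ≤ _ := by
        rw [Finset.sum_union]
        · have : 2 * r ^ s / (1 - r) = r ^ s / (1 - r) + r ^ s / (1 - r) := by ring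
          linarith
        · rw [Finset.disjoint_filter]; intros; omega

lemma le_of_sq_le_sq_aux {a b : ℝ} (h : a ^ 2 ≤ b ^ 2) (hb : 0 ≤ b) : a ≤ b :=
  _root_.le_of_sq_le_sq h hb

lemma schur (I J : Finset ℕ) (k : ℕ → ℕ → ℝ) (x y : ℕ → ℝ) (K X Y : ℝ)
    (hk : ∀ i j, 0 ≤ k i j) (hK : 0 ≤ K) (hX : 0 ≤ X) (hY : 0 ≤ Y)
    (hrow : ∀ i ∈ I, ∑ j ∈ J, k i j ≤ K) (hcol : ∀ j ∈ J, ∑ i ∈ I, k i j ≤ K)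
    (hx : ∑ i ∈ I, x i ^ 2 ≤ X ^ 2) (hy : ∑ j ∈ J, y j ^ 2 ≤ Y ^ 2) :
    ∑ i ∈ I, ∑ j ∈ J, k i j * (x i * y j) ≤ K * (X * Y) := by
  refine le_of_sq_le_sq_aux ?_ (by positivity)
  rw [← Finset.sum_product']
  have h1 := Finset.sum_sq_le_sum_mul_sum_of_sq_le_mul (I ×ˢ J)
    (r := fun p => k p.1 p.2 * (x p.1 * y p.2)) (f := fun p => k p.1 p.2 * x p.1 ^ 2)
    (g := fun p => k p.1 p.2 * y p.2 ^ 2) (by intro p _; have := hk p.1 p.2; positivity)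
    (by intro p _; have := hk p.1 p.2; positivity) (by intro p _; apply le_of_eq; ring)
  refine h1.trans ?_
  have h2 : ∑ p ∈ I ×ˢ J, k p.1 p.2 * x p.1 ^ 2 ≤ K * X ^ 2 := by
    rw [Finset.sum_product]
    calc _ = ∑ i ∈ I, (∑ j ∈ J, k i j) * x i ^ 2 := by simp only [Finset.sum_mul]
      _ ≤ ∑ i ∈ I, K * x i ^ 2 := Finset.sum_le_sum fun i hi =>
          mul_le_mul_of_nonneg_right (hrow i hi) (sq_nonneg _)
      _ ≤ _ := by rw [← Finset.mul_sum]; gcongr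
  have h3 : ∑ p ∈ I ×ˢ J, k p.1 p.2 * y p.2 ^ 2 ≤ K * Y ^ 2 := by
    rw [Finset.sum_product_right]
    calc _ = ∑ j ∈ J, (∑ i ∈ I, k i j) * y j ^ 2 := by simp only [Finset.sum_mul]
      _ ≤ ∑ j ∈ J, K * y j ^ 2 := Finset.sum_le_sum fun i hi =>
          mul_le_mul_of_nonneg_right (hcol i hi) (sq_nonneg _)
      _ ≤ _ := by rw [← Finset.mul_sum]; gcongr
  calc _ ≤ (K * X ^ 2) * (K * Y ^ 2) := by
        apply mul_le_mul h2 h3 _ (by positivity)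
        apply Finset.sum_nonneg; intro p _; have := hk p.1 p.2; positivity
    _ = _ := by ring

/-- the kernel -/
noncomputable def ker (r : ℝ) (d : ℕ) : ℝ := if d = 0 then 1 else 3 * r ^ d

lemma ker_nonneg (r : ℝ) (h : 0 < r) (d : ℕ) : 0 ≤ ker r d := by
  unfold ker; split_ifs <;> positivity

lemma ker_far (r : ℝ) (h0 : 0 < r) (h1 : r < 1) (s n i : ℕ) (hs : 1 ≤ s) :
    ∑ j ∈ (Finset.range n).filter (fun j => s ≤ dd i j), ker r (dd i j) ≤ 6 * r ^ s / (1 - r) := by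
  have := geo r h0 h1 s n i hs
  calc _ = ∑ j ∈ (Finset.range n).filter (fun j => s ≤ dd i j), 3 * r ^ (dd i j) := by
        apply Finset.sum_congr rfl; intro j hj
        rw [Finset.mem_filter] at hj
        unfold ker; rw [if_neg (by omega)]
    _ = 3 * ∑ j ∈ (Finset.range n).filter (fun j => s ≤ dd i j), r ^ (dd i j) := by
        rw [Finset.mul_sum]
    _ ≤ 3 * (2 * r ^ s / (1 - r)) := by gcongr
    _ = _ := by ring

lemma ker_row (r : ℝ) (h0 : 0 < r) (h1 : r < 1) (n i : ℕ) (I : Finset ℕ) (hI : I ⊆ Finset.range n) :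
    ∑ j ∈ I, ker r (dd i j) ≤ 1 + 6 * r / (1 - r) := by
  have h := ker_far r h0 h1 1 n i le_rfl
  have h2 : ∑ j ∈ I, ker r (dd i j) ≤ ∑ j ∈ {i} ∪ (Finset.range n).filter (fun j => 1 ≤ dd i j),
      ker r (dd i j) := by
    apply Finset.sum_le_sum_of_subset_of_nonneg
    · intro j hj; have := hI hj
      simp only [Finset.mem_union, Finset.mem_singleton, Finset.mem_filter]
      by_cases hji : j = i
      · left; exact hji
      · right; refine ⟨this, ?_⟩; unfold dd; omega
    · intros; exact ker_nonneg r h0 _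
  rw [Finset.sum_union (by rw [Finset.disjoint_singleton_left]; rw [Finset.mem_filter]; unfold dd; omega)] at h2
  simp only [Finset.sum_singleton] at h2
  have : ker r (dd i i) = 1 := by simp [ker, dd]
  rw [pow_one] at h
  linarith

end QDS

namespace QDS

lemma sum_split (n k : ℕ) (hk : k < n) (F : ℕ → ℕ → ℝ) :
    ∑ i ∈ Finset.range n, ∑ j ∈ Finset.range n, F i j =
      F k k + ∑ j ∈ (Finset.range n).erase k, F k j + ∑ i ∈ (Finset.range n).erase k, F i k
      + ∑ i ∈ (Finset.range n).erase k, ∑ j ∈ (Finset.range n).erase k, F i j := by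
  have hk' : k ∈ Finset.range n := Finset.mem_range.2 hk
  have h : ∀ i, ∑ j ∈ Finset.range n, F i j = F i k + ∑ j ∈ (Finset.range n).erase k, F i j :=
    fun i => (Finset.add_sum_erase _ _ hk').symm
  rw [← Finset.add_sum_erase _ _ hk']
  simp only [h]
  rw [Finset.sum_add_distrib]; ring

def Good (k i j : ℕ) : Prop := dd i k ≤ 1 ∧ dd j k ≤ 1 ∧ (i = k ∨ j = k)

instance (k i j : ℕ) : Decidable (Good k i j) := by unfold Good; infer_instance

set_option maxHeartbeats 1000000 in
lemma conc (r : ℝ) (h0 : 0 < r) (h1 : r ≤ 1 / 2000) (n : ℕ) (u v : ℕ → ℝ)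
    (hu : ∀ i, 0 ≤ u i) (hv : ∀ i, 0 ≤ v i) (b : ℕ → ℕ → ℝ) (hb : ∀ i j, 0 ≤ b i j)
    (hu1 : ∑ i ∈ Finset.range n, u i ^ 4 = 1) (hv1 : ∑ i ∈ Finset.range n, v i ^ 4 = 1)
    (hbk : ∀ i ∈ Finset.range n, ∀ j ∈ Finset.range n, b i j ≤ ker r (dd i j) * (u i ^ 3 * v j ^ 3))
    (hbig : 1 < ∑ i ∈ Finset.range n, ∑ j ∈ Finset.range n, b i j) :
    ∃ k, (∑ i ∈ Finset.range n, ∑ j ∈ Finset.range n, (if i ≠ j then b i j else 0) ≤ 10 ^ 6 * r ^ 4)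
      ∧ (∑ i ∈ Finset.range n, ∑ j ∈ Finset.range n, (if Good k i j then 0 else b i j)
        ≤ 10 ^ 6 * r ^ 5) := by
  have hr1 : r < 1 := by linarith
  set R := Finset.range n with hR
  set K : ℝ := 7 * r with hK
  have hK0 : 0 ≤ K := by positivity
  have hKs : ∀ s : ℕ, 6 * r ^ s / (1 - r) ≤ 7 * r ^ s := by
    intro s
    rw [div_le_iff₀ (by linarith)]
    have : 0 < r ^ s := by positivity
    nlinarith
  have hone : ∀ i, ∑ j ∈ R.filter (fun j => 1 ≤ dd i j), ker r (dd i j) ≤ K := by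
    intro i
    have := ker_far r h0 hr1 1 n i le_rfl
    have h2 := hKs 1
    simp only [pow_one] at this h2
    exact this.trans h2
  have htwo : ∀ i, ∑ j ∈ R.filter (fun j => 2 ≤ dd i j), ker r (dd i j) ≤ 7 * r ^ 2 := by
    intro i
    exact (ker_far r h0 hr1 2 n i (by norm_num)).trans (hKs 2)
  have hrow : ∀ I ⊆ R, ∀ i, ∑ j ∈ I, ker r (dd i j) ≤ 1 + K := by
    intro I hI i
    have h2 := hKs 1
    simp only [pow_one] at h2
    have := ker_row r h0 hr1 n i I hI
    linarith
  have hle1 : ∀ w : ℕ → ℝ, (∀ i, 0 ≤ w i) → ∑ i ∈ R, w i ^ 4 = 1 → ∀ i ∈ R, w i ≤ 1 := by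
    intro w hw hw1 i hi
    have : w i ^ 4 ≤ 1 := by
      rw [← hw1]; exact Finset.single_le_sum (f := fun i => w i ^ 4) (fun j _ => by positivity) hi
    exact (pow_le_one_iff_of_nonneg (hw i) (by norm_num)).1 this
  have hu_le := hle1 u hu hu1
  have hv_le := hle1 v hv hv1
  have hne : R.Nonempty := by
    by_contra h
    rw [Finset.not_nonempty_iff_eq_empty] at h
    rw [h] at hu1; simp at hu1
  obtain ⟨k, hkR, hkmax⟩ := Finset.exists_max_image R (fun i => u i * v i) hne
  have hkn : k < n := Finset.mem_range.1 hkR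
  -- the sixth moments
  have six : ∀ (w : ℕ → ℝ) (I : Finset ℕ) (g : ℝ), (∀ i, 0 ≤ w i) → 0 ≤ g →
      ∑ i ∈ I, w i ^ 4 ≤ g ^ 4 → ∑ i ∈ I, (w i ^ 3) ^ 2 ≤ (g ^ 3) ^ 2 := by
    intro w I g hw hg h
    have hwi : ∀ i ∈ I, w i ≤ g := by
      intro i hi
      have : w i ^ 4 ≤ g ^ 4 := le_trans
        (Finset.single_le_sum (f := fun i => w i ^ 4) (fun j _ => by positivity) hi) h
      exact (pow_le_pow_iff_left₀ (hw i) hg (by norm_num)).1 this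
    calc ∑ i ∈ I, (w i ^ 3) ^ 2 ≤ ∑ i ∈ I, g ^ 2 * w i ^ 4 := by
          apply Finset.sum_le_sum; intro i hi
          have h1 : w i ^ 2 ≤ g ^ 2 := pow_le_pow_left₀ (hw i) (hwi i hi) 2
          have h2 : 0 ≤ w i ^ 4 := by positivity
          nlinarith
      _ = g ^ 2 * ∑ i ∈ I, w i ^ 4 := by rw [Finset.mul_sum]
      _ ≤ g ^ 2 * g ^ 4 := by gcongr
      _ = _ := by ring
  -- first localisation
  have hstep1 : 1 - K ≤ u k * v k := by
    have hoff : ∑ i ∈ R, ∑ j ∈ R, (if 1 ≤ dd i j then ker r (dd i j) else 0) * (u i ^ 3 * v j ^ 3)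
        ≤ K * (1 * 1) := by
      apply schur
      · intro i j; split_ifs
        · exact ker_nonneg r h0 _
        · exact le_rfl
      · exact hK0
      · norm_num
      · norm_num
      · intro i _; rw [← Finset.sum_filter]; exact hone i
      · intro j _
        simp only [dd_comm _ j]
        rw [← Finset.sum_filter]; exact hone j
      · have := six u R 1 hu zero_le_one (by rw [hu1]; norm_num); simpa using this
      · have := six v R 1 hv zero_le_one (by rw [hv1]; norm_num); simpa using this
    have hdiag : ∑ i ∈ R, u i ^ 3 * v i ^ 3 ≤ u k * v k := by
      have hcs : ∑ i ∈ R, u i ^ 2 * v i ^ 2 ≤ 1 := by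
        have := Finset.sum_mul_sq_le_sq_mul_sq R (fun i => u i ^ 2) (fun i => v i ^ 2)
        have e1 : ∑ i ∈ R, (u i ^ 2) ^ 2 = 1 := by
          rw [← hu1]; apply Finset.sum_congr rfl; intros; ring
        have e2 : ∑ i ∈ R, (v i ^ 2) ^ 2 = 1 := by
          rw [← hv1]; apply Finset.sum_congr rfl; intros; ring
        rw [e1, e2] at this
        exact le_of_sq_le_sq_aux (by linarith) zero_le_one
      calc ∑ i ∈ R, u i ^ 3 * v i ^ 3 ≤ ∑ i ∈ R, (u k * v k) * (u i ^ 2 * v i ^ 2) := by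
            apply Finset.sum_le_sum; intro i hi
            have h1 := hkmax i hi
            have h2 : 0 ≤ u i ^ 2 * v i ^ 2 := by positivity
            nlinarith
        _ = (u k * v k) * ∑ i ∈ R, (u i ^ 2 * v i ^ 2) := by rw [Finset.mul_sum]
        _ ≤ (u k * v k) * 1 := by
            have := mul_nonneg (hu k) (hv k)
            gcongr
        _ = _ := by ring
    have htot : ∑ i ∈ R, ∑ j ∈ R, b i j ≤ ∑ i ∈ R, u i ^ 3 * v i ^ 3 +
        ∑ i ∈ R, ∑ j ∈ R, (if 1 ≤ dd i j then ker r (dd i j) else 0) * (u i ^ 3 * v j ^ 3) := by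
      rw [← Finset.sum_add_distrib]
      apply Finset.sum_le_sum; intro i hi
      rw [show u i ^ 3 * v i ^ 3 = ∑ j ∈ R, if i = j then u i ^ 3 * v j ^ 3 else 0 by
        rw [Finset.sum_ite_eq, if_pos hi], ← Finset.sum_add_distrib]
      apply Finset.sum_le_sum; intro j hj
      refine (hbk i hi j hj).trans ?_
      by_cases hij : i = j
      · subst hij; simp [ker, dd]
      · rw [if_neg hij, if_pos (by unfold dd; omega)]; linarith
    linarith
  have huk := hu_le k hkR
  have hvk := hv_le k hkR
  have huk' : 1 - K ≤ u k := by nlinarith [hu k, hv k]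
  have hvk' : 1 - K ≤ v k := by nlinarith [hu k, hv k]
  -- the parameter g
  obtain ⟨g, hg0, hgu, hgv, hg⟩ : ∃ g : ℝ, 0 ≤ g ∧ 1 - u k ^ 4 ≤ g ^ 4 ∧ 1 - v k ^ 4 ≤ g ^ 4 ∧
      (g ^ 4 = 1 - u k ^ 4 ∨ g ^ 4 = 1 - v k ^ 4) := by
    have h1 : 0 ≤ 1 - u k ^ 4 := by have := pow_le_one₀ (n := 4) (hu k) huk; linarith
    refine ⟨Real.sqrt (Real.sqrt (max (1 - u k ^ 4) (1 - v k ^ 4))), by positivity, ?_⟩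
    have : Real.sqrt (Real.sqrt (max (1 - u k ^ 4) (1 - v k ^ 4))) ^ 4
        = max (1 - u k ^ 4) (1 - v k ^ 4) := by
      rw [show (4 : ℕ) = 2 * 2 by norm_num, pow_mul, Real.sq_sqrt (by positivity),
        Real.sq_sqrt (le_max_of_le_left h1)]
    rw [this]
    refine ⟨le_max_left _ _, le_max_right _ _, ?_⟩
    rcases max_choice (1 - u k ^ 4) (1 - v k ^ 4) with h | h
    · left; exact h
    · right; exact h
  have hEu : ∑ i ∈ R.erase k, u i ^ 4 ≤ g ^ 4 := by
    have := Finset.add_sum_erase R (fun i => u i ^ 4) hkR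
    linarith
  have hEv : ∑ i ∈ R.erase k, v i ^ 4 ≤ g ^ 4 := by
    have := Finset.add_sum_erase R (fun i => v i ^ 4) hkR
    linarith
  have hwg : ∀ (w : ℕ → ℝ), (∀ i, 0 ≤ w i) → ∑ i ∈ R.erase k, w i ^ 4 ≤ g ^ 4 →
      ∀ i ∈ R.erase k, w i ^ 3 ≤ g ^ 3 := by
    intro w hw h i hi
    have : w i ^ 4 ≤ g ^ 4 := le_trans
        (Finset.single_le_sum (f := fun i => w i ^ 4) (fun j _ => by positivity) hi) h
    exact pow_le_pow_left₀ (hw i) ((pow_le_pow_iff_left₀ (hw i) hg0 (by norm_num)).1 this) 3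
  have hug := hwg u hu hEu
  have hvg := hwg v hv hEv
  have hkE : ∀ j ∈ R.erase k, 1 ≤ dd k j := by
    intro j hj; have := (Finset.mem_erase.1 hj).1; unfold dd; omega
  -- pieces
  have hboth : ∑ i ∈ R.erase k, ∑ j ∈ R.erase k, b i j ≤ (1 + K) * (g ^ 3 * g ^ 3) := by
    calc _ ≤ ∑ i ∈ R.erase k, ∑ j ∈ R.erase k, ker r (dd i j) * (u i ^ 3 * v j ^ 3) :=
          Finset.sum_le_sum fun i hi => Finset.sum_le_sum fun j hj =>
            hbk i (Finset.mem_of_mem_erase hi) j (Finset.mem_of_mem_erase hj)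
      _ ≤ _ := by
          apply schur
          · intro i j; exact ker_nonneg r h0 _
          · positivity
          · positivity
          · positivity
          · intro i _; exact hrow _ (Finset.erase_subset _ _) i
          · intro j _
            simp only [dd_comm _ j]
            exact hrow _ (Finset.erase_subset _ _) j
          · exact six u _ g hu hg0 hEu
          · exact six v _ g hv hg0 hEv
  have rowgen : ∀ (s : ℕ) (Ks : ℝ), (∑ j ∈ R.filter (fun j => s ≤ dd k j), ker r (dd k j) ≤ Ks) →
      ∑ j ∈ (R.erase k).filter (fun j => s ≤ dd k j), b k j ≤ Ks * g ^ 3 := by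
    intro s Ks hs
    calc _ ≤ ∑ j ∈ (R.erase k).filter (fun j => s ≤ dd k j), ker r (dd k j) * g ^ 3 := by
          apply Finset.sum_le_sum; intro j hj
          rw [Finset.mem_filter] at hj
          refine (hbk k hkR j (Finset.mem_of_mem_erase hj.1)).trans ?_
          have h1 := hvg j hj.1
          have h2 : u k ^ 3 ≤ 1 := pow_le_one₀ (hu k) huk
          have h3 := ker_nonneg r h0 (dd k j)
          have h4 : 0 ≤ v j ^ 3 := pow_nonneg (hv j) 3
          have h5 : 0 ≤ u k ^ 3 := pow_nonneg (hu k) 3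
          apply mul_le_mul_of_nonneg_left _ h3
          calc u k ^ 3 * v j ^ 3 ≤ 1 * g ^ 3 := by gcongr
            _ = _ := one_mul _
      _ = (∑ j ∈ (R.erase k).filter (fun j => s ≤ dd k j), ker r (dd k j)) * g ^ 3 := by
          rw [Finset.sum_mul]
      _ ≤ _ := by
          gcongr
          refine le_trans ?_ hs
          apply Finset.sum_le_sum_of_subset_of_nonneg
          · apply Finset.filter_subset_filter; exact Finset.erase_subset _ _
          · intros; exact ker_nonneg r h0 _
  have colgen : ∀ (s : ℕ) (Ks : ℝ), (∑ j ∈ R.filter (fun j => s ≤ dd k j), ker r (dd k j) ≤ Ks) →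
      ∑ j ∈ (R.erase k).filter (fun j => s ≤ dd k j), b j k ≤ Ks * g ^ 3 := by
    intro s Ks hs
    calc _ ≤ ∑ j ∈ (R.erase k).filter (fun j => s ≤ dd k j), ker r (dd k j) * g ^ 3 := by
          apply Finset.sum_le_sum; intro j hj
          rw [Finset.mem_filter] at hj
          refine (hbk j (Finset.mem_of_mem_erase hj.1) k hkR).trans ?_
          rw [dd_comm j k]
          have h1 := hug j hj.1
          have h2 : v k ^ 3 ≤ 1 := pow_le_one₀ (hv k) hvk
          have h3 := ker_nonneg r h0 (dd k j)
          have h4 : 0 ≤ u j ^ 3 := pow_nonneg (hu j) 3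
          have h5 : 0 ≤ v k ^ 3 := pow_nonneg (hv k) 3
          apply mul_le_mul_of_nonneg_left _ h3
          calc u j ^ 3 * v k ^ 3 ≤ g ^ 3 * 1 := by gcongr
            _ = _ := mul_one _
      _ = (∑ j ∈ (R.erase k).filter (fun j => s ≤ dd k j), ker r (dd k j)) * g ^ 3 := by
          rw [Finset.sum_mul]
      _ ≤ _ := by
          gcongr
          refine le_trans ?_ hs
          apply Finset.sum_le_sum_of_subset_of_nonneg
          · apply Finset.filter_subset_filter; exact Finset.erase_subset _ _
          · intros; exact ker_nonneg r h0 _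
  have hrow1 : ∑ j ∈ R.erase k, b k j ≤ K * g ^ 3 := by
    have := rowgen 1 K (hone k)
    rwa [Finset.filter_true_of_mem hkE] at this
  have hcol1 : ∑ j ∈ R.erase k, b j k ≤ K * g ^ 3 := by
    have := colgen 1 K (hone k)
    rwa [Finset.filter_true_of_mem hkE] at this
  have hrow2 := rowgen 2 _ (htwo k)
  have hcol2 := colgen 2 _ (htwo k)
  have hkk : b k k ≤ 1 - 3 / 4 * g ^ 4 := by
    have h1 : b k k ≤ u k ^ 3 * v k ^ 3 := by
      have := hbk k hkR k hkR; simpa [ker, dd] using this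
    have hpoly : ∀ x : ℝ, 0 ≤ x → x ^ 3 ≤ 1 - 3 / 4 * (1 - x ^ 4) := by
      intro x hx
      nlinarith [mul_nonneg (sq_nonneg (x - 1)) (show 0 ≤ 3 * x ^ 2 + 2 * x + 1 by positivity)]
    have hu3 : u k ^ 3 ≤ 1 := pow_le_one₀ (hu k) huk
    have hv3 : v k ^ 3 ≤ 1 := pow_le_one₀ (hv k) hvk
    have hu3' : 0 ≤ u k ^ 3 := pow_nonneg (hu k) 3
    have hv3' : 0 ≤ v k ^ 3 := pow_nonneg (hv k) 3
    rcases hg with h | h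
    · rw [h]; have := hpoly (u k) (hu k); nlinarith
    · rw [h]; have := hpoly (v k) (hv k); nlinarith
  have hg2 : g ^ 2 ≤ 1 / 8 := by
    have h4 : g ^ 4 ≤ 1 / 64 := by
      have hb4 : ∀ x : ℝ, 1 - K ≤ x → 1 - x ^ 4 ≤ 4 * K := by
        intro x hx
        have hK1 : K ≤ 1 := by rw [hK]; linarith
        have : (1 - K) ^ 4 ≤ x ^ 4 := pow_le_pow_left₀ (by linarith) hx 4
        have h2 := one_add_mul_le_pow (a := -K) (by linarith) 4
        have h3 : (1 + -K) ^ 4 = (1 - K) ^ 4 := by ring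
        rw [h3] at h2; push_cast at h2; linarith
      have hKb : 4 * K ≤ 1 / 64 := by rw [hK]; linarith
      rcases hg with h | h
      · rw [h]; linarith [hb4 _ huk']
      · rw [h]; linarith [hb4 _ hvk']
    have : (g ^ 2) ^ 2 ≤ (1 / 8 : ℝ) ^ 2 := by nlinarith
    exact le_of_sq_le_sq_aux this (by norm_num)
  have hsplit := sum_split n k hkn b
  rw [← hR] at hsplit
  have hgK : g ≤ 4 * K := by
    have hK1 : K ≤ 1 := by rw [hK]; linarith
    have hmain : 3 / 4 * g ^ 4 ≤ 2 * g ^ 6 + 2 * K * g ^ 3 := by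
      have : (1 + K) * (g ^ 3 * g ^ 3) ≤ 2 * g ^ 6 := by
        have : 0 ≤ g ^ 6 := by positivity
        nlinarith
      linarith
    by_contra hcon
    push Not at hcon
    have hgpos : 0 < g := by linarith
    have h3 : 0 < g ^ 3 := by positivity
    have h6 : 2 * g ^ 6 ≤ 1 / 4 * g ^ 4 := by
      have : 0 ≤ g ^ 4 := by positivity
      nlinarith
    nlinarith
  have hg28 : g ≤ 28 * r := by rw [hK] at hgK; linarith
  have hg3 : g ^ 3 ≤ (28 * r) ^ 3 := pow_le_pow_left₀ hg0 hg28 3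
  have hg6 : (1 + K) * (g ^ 3 * g ^ 3) ≤ 2 * (28 * r) ^ 6 := by
    have hK1 : K ≤ 1 := by rw [hK]; linarith
    have : g ^ 3 * g ^ 3 ≤ (28 * r) ^ 3 * (28 * r) ^ 3 := by gcongr
    calc (1 + K) * (g ^ 3 * g ^ 3) ≤ 2 * ((28 * r) ^ 3 * (28 * r) ^ 3) := by gcongr; linarith
      _ = _ := by ring
  have hr6 : r ^ 6 ≤ r ^ 5 * (1 / 2000) := by
    calc r ^ 6 = r ^ 5 * r := by ring
      _ ≤ _ := by gcongr
  have hr5 : r ^ 5 ≤ r ^ 4 * (1 / 2000) := by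
    calc r ^ 5 = r ^ 4 * r := by ring
      _ ≤ _ := by gcongr
  have hr5' : 0 < r ^ 5 := by positivity
  have hr4' : 0 < r ^ 4 := by positivity
  refine ⟨k, ?_, ?_⟩
  · rw [hR, sum_split n k hkn, ← hR]
    have e1 : ∑ j ∈ R.erase k, (if k ≠ j then b k j else 0) ≤ K * g ^ 3 := by
      refine le_trans (Finset.sum_le_sum fun j _ => ?_) hrow1
      split_ifs
      · exact le_rfl
      · exact hb _ _
    have e2 : ∑ j ∈ R.erase k, (if j ≠ k then b j k else 0) ≤ K * g ^ 3 := by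
      refine le_trans (Finset.sum_le_sum fun j _ => ?_) hcol1
      split_ifs
      · exact le_rfl
      · exact hb _ _
    have e3 : ∑ i ∈ R.erase k, ∑ j ∈ R.erase k, (if i ≠ j then b i j else 0)
        ≤ (1 + K) * (g ^ 3 * g ^ 3) := by
      refine le_trans (Finset.sum_le_sum fun i _ => Finset.sum_le_sum fun j _ => ?_) hboth
      split_ifs
      · exact le_rfl
      · exact hb _ _
    have e0 : (if k ≠ k then b k k else 0) = 0 := by simp
    rw [e0]
    have e4 : K * g ^ 3 ≤ 7 * r * (28 * r) ^ 3 := by rw [hK]; gcongr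
    have e5 : 7 * r * (28 * r) ^ 3 = 153664 * r ^ 4 := by ring
    have e6 : 2 * (28 * r) ^ 6 = 963780608 * r ^ 6 := by ring
    linarith
  · rw [hR, sum_split n k hkn, ← hR]
    have e1 : ∑ j ∈ R.erase k, (if Good k k j then 0 else b k j) ≤ 7 * r ^ 2 * g ^ 3 := by
      refine le_trans ?_ hrow2
      rw [Finset.sum_filter]
      apply Finset.sum_le_sum; intro j _
      split_ifs with h1 h2 h2
      · exact hb _ _
      · exact le_rfl
      · exact le_rfl
      · exfalso; apply h1; refine ⟨by simp [dd], ?_, Or.inl rfl⟩; rw [dd_comm]; omega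
    have e2 : ∑ j ∈ R.erase k, (if Good k j k then 0 else b j k) ≤ 7 * r ^ 2 * g ^ 3 := by
      refine le_trans ?_ hcol2
      rw [Finset.sum_filter]
      apply Finset.sum_le_sum; intro j _
      split_ifs with h1 h2 h2
      · exact hb _ _
      · exact le_rfl
      · exact le_rfl
      · exfalso; apply h1; refine ⟨?_, by simp [dd], Or.inr rfl⟩; rw [dd_comm]; omega
    have e3 : ∑ i ∈ R.erase k, ∑ j ∈ R.erase k, (if Good k i j then 0 else b i j)
        ≤ (1 + K) * (g ^ 3 * g ^ 3) := by
      refine le_trans (Finset.sum_le_sum fun i _ => Finset.sum_le_sum fun j _ => ?_) hboth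
      split_ifs
      · exact hb _ _
      · exact le_rfl
    have e0 : (if Good k k k then 0 else b k k) = 0 := by
      rw [if_pos]; exact ⟨by simp [dd], by simp [dd], Or.inl rfl⟩
    rw [e0]
    have e4 : 7 * r ^ 2 * g ^ 3 ≤ 7 * r ^ 2 * (28 * r) ^ 3 := by gcongr
    have e5 : 7 * r ^ 2 * (28 * r) ^ 3 = 153664 * r ^ 5 := by ring
    have e6 : 2 * (28 * r) ^ 6 = 963780608 * r ^ 6 := by ring
    linarith

end QDS

namespace QDS

/-- fourth root -/
noncomputable def rt (x : ℝ) : ℝ := Real.sqrt (Real.sqrt x)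

lemma rt_nonneg (x : ℝ) : 0 ≤ rt x := Real.sqrt_nonneg _

lemma rt_pow {x : ℝ} (h : 0 ≤ x) : rt x ^ 4 = x := by
  unfold rt
  rw [show (4 : ℕ) = 2 * 2 by norm_num, pow_mul, Real.sq_sqrt (Real.sqrt_nonneg _), Real.sq_sqrt h]

lemma rt_mul {x : ℝ} (h : 0 ≤ x) (y : ℝ) : rt (x * y) = rt x * rt y := by
  unfold rt; rw [Real.sqrt_mul h, Real.sqrt_mul (Real.sqrt_nonneg _)]

lemma rt_mono {x y : ℝ} (h : x ≤ y) : rt x ≤ rt y := Real.sqrt_le_sqrt (Real.sqrt_le_sqrt h)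

lemma rt_one : rt 1 = 1 := by simp [rt]

lemma rt_npow {x : ℝ} (h : 0 ≤ x) (n : ℕ) : rt (x ^ n) = rt x ^ n := by
  induction n with
  | zero => simp [rt_one]
  | succ n ih => rw [pow_succ, rt_mul (pow_nonneg h n), ih, pow_succ]

lemma rt_pos {x : ℝ} (h : 0 < x) : 0 < rt x := Real.sqrt_pos.2 (Real.sqrt_pos.2 h)

noncomputable def hp (p i : ℕ) : ℝ := if i = 0 then 1 else 1 - 1 / (p : ℝ)

lemma hp_pos {p : ℕ} (hp2 : 2 ≤ p) (i : ℕ) : 0 < hp p i := by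
  have : (2 : ℝ) ≤ p := by exact_mod_cast hp2
  unfold hp; split_ifs
  · norm_num
  · rw [sub_pos, div_lt_one (by linarith)]; linarith

lemma hp_le {p : ℕ} (i : ℕ) : hp p i ≤ 1 := by
  unfold hp; split_ifs
  · exact le_rfl
  · have : (0 : ℝ) ≤ 1 / p := by positivity
    linarith

noncomputable def mu (P : Finset ℕ) (e : ℕ → ℕ → ℕ) (ψ : ℕ → ℝ) (v : ℕ) : ℝ :=
  ψ v * ∏ p ∈ P, hp p (e v p)

def cond (P : Finset ℕ) (e : ℕ → ℕ → ℕ) (ψ θ : ℕ → ℝ) (v w : ℕ) : Prop :=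
  ψ v * ∏ p ∈ P, (p : ℝ) ^ (e w p - e v p) ≤ 1 ∧ θ w * ∏ p ∈ P, (p : ℝ) ^ (e v p - e w p) ≤ 1

noncomputable def wt (P : Finset ℕ) (e : ℕ → ℕ → ℕ) (τ : ℕ → ℝ) (v w : ℕ) : ℝ :=
  ∏ p ∈ P, if e v p = e w p then 1 else τ p

open Classical in
noncomputable def term (P : Finset ℕ) (e : ℕ → ℕ → ℕ) (τ ψ θ : ℕ → ℝ) (v w : ℕ) : ℝ :=
  if cond P e ψ θ v w then mu P e ψ v * mu P e θ w * wt P e τ v w else 0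

noncomputable def BB (P : Finset ℕ) (e : ℕ → ℕ → ℕ) (τ ψ θ : ℕ → ℝ) (V W : Finset ℕ) : ℝ :=
  ∑ v ∈ V, ∑ w ∈ W, term P e τ ψ θ v w

noncomputable def MM (P : Finset ℕ) (e : ℕ → ℕ → ℕ) (ψ : ℕ → ℝ) (V : Finset ℕ) : ℝ :=
  ∑ v ∈ V, mu P e ψ v

def Inj (P : Finset ℕ) (e : ℕ → ℕ → ℕ) (V : Finset ℕ) : Prop :=
  ∀ v ∈ V, ∀ v' ∈ V, (∀ p ∈ P, e v p = e v' p) → v = v'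

def Bound (P : Finset ℕ) (e : ℕ → ℕ → ℕ) (τ : ℕ → ℝ) (C : ℝ) : Prop :=
  ∀ (V W : Finset ℕ) (ψ θ : ℕ → ℝ), (∀ v, 0 ≤ ψ v) → (∀ v, 0 ≤ θ v) → Inj P e V → Inj P e W →
    BB P e τ ψ θ V W ≤ C * (rt (MM P e ψ V) * rt (MM P e θ W)) ^ 3

variable {P : Finset ℕ} {e : ℕ → ℕ → ℕ} {τ ψ θ : ℕ → ℝ} {V W : Finset ℕ}

lemma prodhp_pos (hP : ∀ p ∈ P, 2 ≤ p) (v : ℕ) : 0 < ∏ p ∈ P, hp p (e v p) :=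
  Finset.prod_pos fun p h => hp_pos (hP p h) _

lemma mu_nonneg (hP : ∀ p ∈ P, 2 ≤ p) (hψ : ∀ v, 0 ≤ ψ v) (v : ℕ) : 0 ≤ mu P e ψ v :=
  mul_nonneg (hψ v) (prodhp_pos hP v).le

lemma wt_nonneg (hτ : ∀ p, 1 ≤ τ p) (v w : ℕ) : 0 ≤ wt P e τ v w := by
  apply Finset.prod_nonneg; intro p _; split_ifs
  · norm_num
  · linarith [hτ p]

lemma term_nonneg (hP : ∀ p ∈ P, 2 ≤ p) (hτ : ∀ p, 1 ≤ τ p) (hψ : ∀ v, 0 ≤ ψ v)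
    (hθ : ∀ v, 0 ≤ θ v) (v w : ℕ) : 0 ≤ term P e τ ψ θ v w := by
  unfold term; split_ifs
  · exact mul_nonneg (mul_nonneg (mu_nonneg hP hψ v) (mu_nonneg hP hθ w)) (wt_nonneg hτ v w)
  · exact le_rfl

lemma term_step (p : ℕ) (hpP : p ∈ P) (hp2 : 2 ≤ p) (i j v w : ℕ) (hi : e v p = i) (hj : e w p = j) :
    term P e τ ψ θ v w = hp p i * hp p j * (if i = j then 1 else τ p) * ((1 / (p : ℝ)) ^ (dd i j)) *
      term (P.erase p) e τ (fun x => ψ x * (p : ℝ) ^ (j - i)) (fun x => θ x * (p : ℝ) ^ (i - j)) v w := by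
  have hp0 : (0 : ℝ) < p := by exact_mod_cast (by omega : 0 < p)
  have e1 := Finset.mul_prod_erase P (fun q => (q : ℝ) ^ (e w q - e v q)) hpP
  have e2 := Finset.mul_prod_erase P (fun q => (q : ℝ) ^ (e v q - e w q)) hpP
  have e3 := Finset.mul_prod_erase P (fun q => hp q (e v q)) hpP
  have e4 := Finset.mul_prod_erase P (fun q => hp q (e w q)) hpP
  have e5 := Finset.mul_prod_erase P (fun q => if e v q = e w q then (1 : ℝ) else τ q) hpP
  have hc : cond P e ψ θ v w ↔ cond (P.erase p) e (fun x => ψ x * (p : ℝ) ^ (j - i))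
      (fun x => θ x * (p : ℝ) ^ (i - j)) v w := by
    unfold cond
    rw [← e1, ← e2, hi, hj]
    simp only [mul_assoc]
  unfold term
  by_cases h : cond P e ψ θ v w
  · rw [if_pos h, if_pos (hc.1 h)]
    unfold mu wt
    rw [← e3, ← e4, ← e5, hi, hj]
    have : (1 / (p : ℝ)) ^ (dd i j) * ((p : ℝ) ^ (j - i) * (p : ℝ) ^ (i - j)) = 1 := by
      rw [← pow_add, show (j - i) + (i - j) = dd i j by unfold dd; omega, ← mul_pow,
        one_div_mul_cancel hp0.ne', one_pow]
    linear_combination (-(ψ v * (hp p i * ∏ x ∈ P.erase p, hp x (e v x)) *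
      (θ w * (hp p j * ∏ x ∈ P.erase p, hp x (e w x))) *
      ((if i = j then 1 else τ p) * ∏ x ∈ P.erase p, if e v x = e w x then 1 else τ x))) * this
  · rw [if_neg h, if_neg (fun h' => h (hc.2 h')), mul_zero]

lemma MM_nonneg (hP : ∀ p ∈ P, 2 ≤ p) (hψ : ∀ v, 0 ≤ ψ v) : 0 ≤ MM P e ψ V :=
  Finset.sum_nonneg fun v _ => mu_nonneg hP hψ v

lemma MM_step (p : ℕ) (hpP : p ∈ P) (i : ℕ) (c : ℝ) :
    hp p i * MM (P.erase p) e (fun x => ψ x * c) (V.filter (fun v => e v p = i)) =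
    c * MM P e ψ (V.filter (fun v => e v p = i)) := by
  unfold MM
  rw [Finset.mul_sum, Finset.mul_sum]
  apply Finset.sum_congr rfl
  intro v hv
  rw [Finset.mem_filter] at hv
  unfold mu
  rw [← Finset.mul_prod_erase P (fun q => hp q (e v q)) hpP, hv.2]
  ring

lemma BB_step {C : ℝ} (hC : 0 ≤ C) (hP : ∀ p ∈ P, 2 ≤ p) (hτ : ∀ p, 1 ≤ τ p) (hτ3 : ∀ p, τ p ≤ 3)
    (hψ : ∀ v, 0 ≤ ψ v) (hθ : ∀ v, 0 ≤ θ v)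
    (p : ℕ) (hpP : p ∈ P) (hb : Bound (P.erase p) e τ C) (hV : Inj P e V) (hW : Inj P e W) (i j : ℕ) :
    BB P e τ ψ θ (V.filter (fun v => e v p = i)) (W.filter (fun v => e v p = j)) ≤
      C * (ker (rt (1 / (p : ℝ))) (dd i j) * (rt (MM P e ψ (V.filter (fun v => e v p = i))) ^ 3 *
        rt (MM P e θ (W.filter (fun v => e v p = j))) ^ 3)) := by
  have hp2 := hP p hpP
  have hp0 : (0 : ℝ) < p := by exact_mod_cast (by omega : 0 < p)
  have hInj : ∀ (U : Finset ℕ) (i : ℕ), Inj P e U → Inj (P.erase p) e (U.filter (fun v => e v p = i)) := by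
    intro U i hU v hv v' hv' h
    rw [Finset.mem_filter] at hv hv'
    apply hU v hv.1 v' hv'.1
    intro q hq
    by_cases hqp : q = p
    · rw [hqp, hv.2, hv'.2]
    · exact h q (Finset.mem_erase.2 ⟨hqp, hq⟩)
  have hB := hb (V.filter (fun v => e v p = i)) (W.filter (fun v => e v p = j))
    (fun x => ψ x * (p : ℝ) ^ (j - i)) (fun x => θ x * (p : ℝ) ^ (i - j))
    (fun v => mul_nonneg (hψ v) (by positivity)) (fun v => mul_nonneg (hθ v) (by positivity))
    (hInj V i hV) (hInj W j hW)
  set x := hp p i with hx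
  set y := hp p j with hy
  have hx0 : 0 < x := hp_pos hp2 i
  have hy0 : 0 < y := hp_pos hp2 j
  have hx1 : x ≤ 1 := hp_le i
  have hy1 : y ≤ 1 := hp_le j
  set A := MM P e ψ (V.filter (fun v => e v p = i))
  set B := MM P e θ (W.filter (fun v => e v p = j))
  have hA0 : 0 ≤ A := MM_nonneg hP hψ
  have hB0 : 0 ≤ B := MM_nonneg hP hθ
  have hA := MM_step (P := P) (e := e) (ψ := ψ) (V := V) p hpP i ((p : ℝ) ^ (j - i))
  have hBm := MM_step (P := P) (e := e) (ψ := θ) (V := W) p hpP j ((p : ℝ) ^ (i - j))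
  set A' := MM (P.erase p) e (fun x => ψ x * (p : ℝ) ^ (j - i)) (V.filter (fun v => e v p = i))
  set B' := MM (P.erase p) e (fun x => θ x * (p : ℝ) ^ (i - j)) (W.filter (fun v => e v p = j))
  have hA'0 : 0 ≤ A' := by
    apply MM_nonneg
    · intro q hq; exact hP q (Finset.mem_of_mem_erase hq)
    · intro v; exact mul_nonneg (hψ v) (by positivity)
  have hB'0 : 0 ≤ B' := by
    apply MM_nonneg
    · intro q hq; exact hP q (Finset.mem_of_mem_erase hq)
    · intro v; exact mul_nonneg (hθ v) (by positivity)
  set t : ℝ := if i = j then 1 else τ p with ht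
  have ht0 : 0 ≤ t := by rw [ht]; split_ifs; norm_num; linarith [hτ p]
  set δ : ℝ := (1 / (p : ℝ)) ^ (dd i j) with hδ
  have hδ0 : 0 < δ := by positivity
  have hpd : δ * ((p : ℝ) ^ (j - i) * (p : ℝ) ^ (i - j)) = 1 := by
      rw [← pow_add, show (j - i) + (i - j) = dd i j by unfold dd; omega, hδ, ← mul_pow,
        one_div_mul_cancel hp0.ne', one_pow]
  have hAB : x * y * δ * (A' * B') = A * B := by
    calc x * y * δ * (A' * B') = δ * (x * A') * (y * B') := by ring
      _ = (δ * ((p : ℝ) ^ (j - i) * (p : ℝ) ^ (i - j))) * (A * B) := by rw [hA, hBm]; ring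
      _ = _ := by rw [hpd, one_mul]
  have hroot : rt (x * y * δ) * (rt A' * rt B') = rt A * rt B := by
    rw [← rt_mul hA'0, ← rt_mul (by positivity), hAB, rt_mul hA0]
  have hsum : BB P e τ ψ θ (V.filter (fun v => e v p = i)) (W.filter (fun v => e v p = j)) =
      x * y * t * δ * BB (P.erase p) e τ (fun x => ψ x * (p : ℝ) ^ (j - i))
      (fun x => θ x * (p : ℝ) ^ (i - j)) (V.filter (fun v => e v p = i))
      (W.filter (fun v => e v p = j)) := by
    unfold BB
    rw [Finset.mul_sum]
    apply Finset.sum_congr rfl; intro v hv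
    rw [Finset.mul_sum]
    apply Finset.sum_congr rfl; intro w hw
    rw [Finset.mem_filter] at hv hw
    exact term_step p hpP hp2 i j v w hv.2 hw.2
  rw [hsum]
  have hxyd : 0 ≤ x * y * δ := by positivity
  have hrt := rt_nonneg (x * y * δ)
  have h4 := rt_pow hxyd
  set Q := BB (P.erase p) e τ (fun x => ψ x * (p : ℝ) ^ (j - i))
      (fun x => θ x * (p : ℝ) ^ (i - j)) (V.filter (fun v => e v p = i))
      (W.filter (fun v => e v p = j))
  calc x * y * t * δ * Q ≤ x * y * t * δ * (C * (rt A' * rt B') ^ 3) := by gcongr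
    _ = t * C * (rt (x * y * δ)) ^ 4 * (rt A' * rt B') ^ 3 := by rw [h4]; ring
    _ = t * C * rt (x * y * δ) * (rt (x * y * δ) * (rt A' * rt B')) ^ 3 := by ring
    _ = C * ((t * rt (x * y * δ)) * (rt A ^ 3 * rt B ^ 3)) := by rw [hroot]; ring
    _ ≤ _ := by
      have hn : 0 ≤ rt A ^ 3 * rt B ^ 3 :=
        mul_nonneg (pow_nonneg (rt_nonneg _) _) (pow_nonneg (rt_nonneg _) _)
      apply mul_le_mul_of_nonneg_left _ hC
      apply mul_le_mul_of_nonneg_right _ hn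
      have hle : rt (x * y * δ) ≤ rt (1 / (p : ℝ)) ^ (dd i j) := by
        rw [← rt_npow (by positivity)]
        apply rt_mono
        have : x * y ≤ 1 := by nlinarith
        nlinarith
      unfold ker
      by_cases hij : i = j
      · have hd0 : dd i j = 0 := by unfold dd; omega
        rw [hd0, pow_zero] at hle
        rw [ht, if_pos hij, hd0, if_pos rfl]; linarith
      · have hd0 : dd i j ≠ 0 := by unfold dd; omega
        rw [ht, if_neg hij, if_neg hd0]
        apply mul_le_mul (hτ3 p) hle hrt (by norm_num)

lemma fiber_sum (p n : ℕ) (hVn : ∀ v ∈ V, e v p < n) (hWn : ∀ v ∈ W, e v p < n) (G : ℕ → ℕ → ℝ) :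
    ∑ v ∈ V, ∑ w ∈ W, G v w = ∑ i ∈ Finset.range n, ∑ j ∈ Finset.range n,
      ∑ v ∈ V.filter (fun v => e v p = i), ∑ w ∈ W.filter (fun w => e w p = j), G v w := by
  rw [← Finset.sum_fiberwise_of_maps_to (t := Finset.range n) (g := fun v => e v p)
    (fun v hv => Finset.mem_range.2 (hVn v hv))]
  apply Finset.sum_congr rfl; intro i _
  rw [Finset.sum_comm (s := Finset.range n)]
  apply Finset.sum_congr rfl; intro v _
  rw [Finset.sum_fiberwise_of_maps_to (t := Finset.range n) (g := fun v => e v p)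
    (fun v hv => Finset.mem_range.2 (hWn v hv))]

lemma fiber_MM (p n : ℕ) (hVn : ∀ v ∈ V, e v p < n) :
    ∑ i ∈ Finset.range n, MM P e ψ (V.filter (fun v => e v p = i)) = MM P e ψ V := by
  unfold MM
  rw [Finset.sum_fiberwise_of_maps_to (t := Finset.range n) (g := fun v => e v p)
    (fun v hv => Finset.mem_range.2 (hVn v hv))]

lemma exists_bd (p : ℕ) (V W : Finset ℕ) (e : ℕ → ℕ → ℕ) :
    ∃ n, (∀ v ∈ V, e v p < n) ∧ (∀ v ∈ W, e v p < n) := by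
  refine ⟨(V ∪ W).sup (fun v => e v p) + 1, ?_, ?_⟩
  · intro v hv
    exact Nat.lt_succ_of_le (Finset.le_sup (f := fun v => e v p) (Finset.mem_union_left _ hv))
  · intro v hv
    exact Nat.lt_succ_of_le (Finset.le_sup (f := fun v => e v p) (Finset.mem_union_right _ hv))

end QDS

namespace QDS
variable {P : Finset ℕ} {e : ℕ → ℕ → ℕ} {τ ψ θ : ℕ → ℝ} {V W : Finset ℕ}

lemma MM_pos_of_BB (hP : ∀ p ∈ P, 2 ≤ p) (hψ : ∀ v, 0 ≤ ψ v) (hB : 0 < BB P e τ ψ θ V W) :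
    0 < MM P e ψ V := by
  rcases (MM_nonneg (P := P) (e := e) (V := V) hP hψ).lt_or_eq with h | h
  · exact h
  exfalso
  have h0 := (Finset.sum_eq_zero_iff_of_nonneg (fun v _ => mu_nonneg hP hψ v)).1 h.symm
  have : BB P e τ ψ θ V W = 0 := by
    apply Finset.sum_eq_zero; intro v hv
    apply Finset.sum_eq_zero; intro w hw
    unfold term
    rw [h0 v hv]; simp
  linarith

lemma MM_pos_of_BB' (hP : ∀ p ∈ P, 2 ≤ p) (hθ : ∀ v, 0 ≤ θ v) (hB : 0 < BB P e τ ψ θ V W) :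
    0 < MM P e θ W := by
  rcases (MM_nonneg (P := P) (e := e) (V := W) hP hθ).lt_or_eq with h | h
  · exact h
  exfalso
  have h0 := (Finset.sum_eq_zero_iff_of_nonneg (fun v _ => mu_nonneg hP hθ v)).1 h.symm
  have : BB P e τ ψ θ V W = 0 := by
    apply Finset.sum_eq_zero; intro v hv
    apply Finset.sum_eq_zero; intro w hw
    unfold term
    rw [h0 w hw]; simp
  linarith

lemma conc_p {C : ℝ} (hC : 0 < C) (hP : ∀ p ∈ P, 2 ≤ p) (hτ : ∀ p, 1 ≤ τ p) (hτ3 : ∀ p, τ p ≤ 3)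
    (hψ : ∀ v, 0 ≤ ψ v) (hθ : ∀ v, 0 ≤ θ v)
    (p : ℕ) (hpP : p ∈ P) (hr : rt (1 / (p : ℝ)) ≤ 1 / 2000)
    (hb : Bound (P.erase p) e τ C) (hV : Inj P e V) (hW : Inj P e W)
    (hbig : C * (rt (MM P e ψ V) * rt (MM P e θ W)) ^ 3 < BB P e τ ψ θ V W) :
    ∃ k : ℕ, ∑ v ∈ V, ∑ w ∈ W, (if e v p ≠ e w p then term P e τ ψ θ v w else 0) ≤
        10 ^ 6 * (1 / (p : ℝ)) * BB P e τ ψ θ V W ∧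
      ∑ v ∈ V, ∑ w ∈ W, (if Good k (e v p) (e w p) then 0 else term P e τ ψ θ v w) ≤
        10 ^ 6 * rt (1 / (p : ℝ)) ^ 5 * BB P e τ ψ θ V W := by
  have hp2 := hP p hpP
  have hp0 : (0 : ℝ) < p := by exact_mod_cast (by omega : 0 < p)
  obtain ⟨n, hVn, hWn⟩ := exists_bd p V W e
  set B := BB P e τ ψ θ V W with hB
  have hn1 := rt_nonneg (MM P e ψ V)
  have hn2 := rt_nonneg (MM P e θ W)
  have hB0 : 0 < B := lt_of_le_of_lt (by positivity) hbig
  have hM := MM_pos_of_BB hP hψ hB0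
  have hM' := MM_pos_of_BB' hP hθ hB0
  have hx := rt_pos hM
  have hy := rt_pos hM'
  set D := C * (rt (MM P e ψ V) * rt (MM P e θ W)) ^ 3 with hD
  have hD0 : 0 < D := by positivity
  set bb : ℕ → ℕ → ℝ := fun i j => BB P e τ ψ θ (V.filter (fun v => e v p = i)) (W.filter (fun v => e v p = j)) with hbb
  have hbb0 : ∀ i j, 0 ≤ bb i j := fun i j =>
    Finset.sum_nonneg fun v _ => Finset.sum_nonneg fun w _ => term_nonneg hP hτ hψ hθ v w
  have hsumB : ∑ i ∈ Finset.range n, ∑ j ∈ Finset.range n, bb i j = B := by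
    rw [hB]; unfold BB
    rw [fiber_sum p n hVn hWn]; rfl
  have hr0 : 0 < rt (1 / (p : ℝ)) := rt_pos (by positivity)
  have hu4 : ∑ i ∈ Finset.range n, (rt (MM P e ψ (V.filter (fun v => e v p = i))) / rt (MM P e ψ V)) ^ 4 = 1 := by
    simp_rw [div_pow]
    rw [rt_pow hM.le, ← Finset.sum_div]
    simp_rw [rt_pow (MM_nonneg hP hψ)]
    rw [fiber_MM p n hVn, div_self hM.ne']
  have hv4 : ∑ i ∈ Finset.range n, (rt (MM P e θ (W.filter (fun v => e v p = i))) / rt (MM P e θ W)) ^ 4 = 1 := by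
    simp_rw [div_pow]
    rw [rt_pow hM'.le, ← Finset.sum_div]
    simp_rw [rt_pow (MM_nonneg hP hθ)]
    rw [fiber_MM p n hWn, div_self hM'.ne']
  have key := conc (rt (1 / (p : ℝ))) hr0 hr n
    (fun i => rt (MM P e ψ (V.filter (fun v => e v p = i))) / rt (MM P e ψ V))
    (fun i => rt (MM P e θ (W.filter (fun v => e v p = i))) / rt (MM P e θ W))
    (fun i => div_nonneg (rt_nonneg _) hn1) (fun i => div_nonneg (rt_nonneg _) hn2)
    (fun i j => bb i j / D) (fun i j => div_nonneg (hbb0 i j) hD0.le) hu4 hv4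
    (by
      intro i _ j _
      show bb i j / D ≤ _
      rw [div_le_iff₀ hD0]
      refine (BB_step hC.le hP hτ hτ3 hψ hθ p hpP hb hV hW i j).trans (le_of_eq ?_)
      rw [hD]; field_simp)
    (by
      simp_rw [← Finset.sum_div]
      rw [hsumB, lt_div_iff₀ hD0, one_mul]; exact hbig)
  obtain ⟨k, h1, h2⟩ := key
  have e4 : rt (1 / (p : ℝ)) ^ 4 = 1 / (p : ℝ) := rt_pow (by positivity)
  rw [e4] at h1
  refine ⟨k, ?_, ?_⟩
  · rw [fiber_sum p n hVn hWn]
    have : ∀ i ∈ Finset.range n, ∀ j ∈ Finset.range n, (∑ v ∈ V.filter (fun v => e v p = i), ∑ w ∈ W.filter (fun w => e w p = j),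
        (if e v p ≠ e w p then term P e τ ψ θ v w else 0)) = D * (if i ≠ j then bb i j / D else 0) := by
      intro i _ j _
      trans (∑ v ∈ V.filter (fun v => e v p = i), ∑ w ∈ W.filter (fun w => e w p = j),
        (if i ≠ j then term P e τ ψ θ v w else 0))
      · apply Finset.sum_congr rfl; intro v hv; apply Finset.sum_congr rfl; intro w hw
        rw [Finset.mem_filter] at hv hw
        rw [hv.2, hw.2]
      · split_ifs with hij
        · rw [mul_div_cancel₀ _ hD0.ne']; rfl
        · simp
    rw [Finset.sum_congr rfl (fun i hi => Finset.sum_congr rfl (fun j hj => this i hi j hj))]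
    simp_rw [← Finset.mul_sum]
    calc _ ≤ D * (10 ^ 6 * (1 / (p : ℝ))) := mul_le_mul_of_nonneg_left h1 hD0.le
      _ = 10 ^ 6 * (1 / (p : ℝ)) * D := by ring
      _ ≤ _ := mul_le_mul_of_nonneg_left hbig.le (by positivity)
  · rw [fiber_sum p n hVn hWn]
    have : ∀ i ∈ Finset.range n, ∀ j ∈ Finset.range n, (∑ v ∈ V.filter (fun v => e v p = i), ∑ w ∈ W.filter (fun w => e w p = j),
        (if Good k (e v p) (e w p) then 0 else term P e τ ψ θ v w)) = D * (if Good k i j then 0 else bb i j / D) := by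
      intro i _ j _
      trans (∑ v ∈ V.filter (fun v => e v p = i), ∑ w ∈ W.filter (fun w => e w p = j),
        (if Good k i j then 0 else term P e τ ψ θ v w))
      · apply Finset.sum_congr rfl; intro v hv; apply Finset.sum_congr rfl; intro w hw
        rw [Finset.mem_filter] at hv hw
        rw [hv.2, hw.2]
      · split_ifs with hij
        · simp
        · rw [mul_div_cancel₀ _ hD0.ne']; rfl
    rw [Finset.sum_congr rfl (fun i hi => Finset.sum_congr rfl (fun j hj => this i hi j hj))]
    simp_rw [← Finset.mul_sum]
    calc _ ≤ D * (10 ^ 6 * rt (1 / (p : ℝ)) ^ 5) := mul_le_mul_of_nonneg_left h2 hD0.le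
      _ = 10 ^ 6 * rt (1 / (p : ℝ)) ^ 5 * D := by ring
      _ ≤ _ := mul_le_mul_of_nonneg_left hbig.le (by positivity)

end QDS

namespace QDS
variable {P : Finset ℕ} {e : ℕ → ℕ → ℕ} {τ ψ θ : ℕ → ℝ} {V W : Finset ℕ}

def pl (P : Finset ℕ) (e : ℕ → ℕ → ℕ) (k : ℕ → ℕ) (v : ℕ) : ℕ :=
  ∏ p ∈ P, if e v p = k p + 1 then p else 1

def mi (P : Finset ℕ) (e : ℕ → ℕ → ℕ) (k : ℕ → ℕ) (v : ℕ) : ℕ :=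
  ∏ p ∈ P, if e v p + 1 = k p then p else 1

noncomputable def hh (P : Finset ℕ) (e : ℕ → ℕ → ℕ) (v : ℕ) : ℝ := ∏ p ∈ P, hp p (e v p)

lemma pl_pos (hP : ∀ p ∈ P, p.Prime) (k : ℕ → ℕ) (v : ℕ) : 0 < pl P e k v := by
  apply Finset.prod_pos; intro p h; split_ifs
  · exact (hP p h).pos
  · norm_num

lemma mi_pos (hP : ∀ p ∈ P, p.Prime) (k : ℕ → ℕ) (v : ℕ) : 0 < mi P e k v := by
  apply Finset.prod_pos; intro p h; split_ifs
  · exact (hP p h).pos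
  · norm_num

lemma dvd_pl (hP : ∀ p ∈ P, p.Prime) (k : ℕ → ℕ) (v p : ℕ) (h : p ∈ P) :
    p ∣ pl P e k v ↔ e v p = k p + 1 := by
  constructor
  · intro hd
    unfold pl at hd
    rw [Prime.dvd_finsetProd_iff (hP p h).prime] at hd
    obtain ⟨q, hq, hd⟩ := hd
    split_ifs at hd with h1
    · rw [(Nat.prime_dvd_prime_iff_eq (hP p h) (hP q hq)).1 hd]; exact h1
    · exact absurd (Nat.dvd_one.1 hd) (hP p h).one_lt.ne'
  · intro h1
    have := Finset.dvd_prod_of_mem (fun p => if e v p = k p + 1 then p else 1) h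
    simp only [h1, if_true] at this
    exact this

lemma count (hP : ∀ p ∈ P, p.Prime) (k : ℕ → ℕ) (x : ℕ) (hW : Inj P e W)
    (hk : ∀ w ∈ W, ∀ p ∈ P, dd (e w p) (k p) ≤ 1) (hx : ∀ w ∈ W, pl P e k w ≤ x) :
    ∑ w ∈ W, hh P e w / mi P e k w ≤ x := by
  set Q := P.filter (fun p => 1 ≤ k p) with hQ
  set G : Finset ℕ → ℝ := fun S => (∏ p ∈ S, (1 / (p : ℝ))) * ∏ p ∈ Q \ S, (1 - 1 / (p : ℝ)) with hG
  have hQp : ∀ p ∈ Q, (1 : ℝ) ≤ p := by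
    intro p hp'
    exact_mod_cast (hP p (Finset.mem_of_mem_filter p hp')).one_lt.le
  have hG0 : ∀ S, S ⊆ Q → 0 ≤ G S := by
    intro S hS
    apply mul_nonneg
    · exact Finset.prod_nonneg fun p _ => by positivity
    · apply Finset.prod_nonneg
      intro p hp'
      have := hQp p (Finset.mem_sdiff.1 hp').1
      rw [sub_nonneg, div_le_one (by linarith)]; exact this
  set f : ℕ → Finset ℕ × ℕ := fun w => (Q.filter (fun p => e w p + 1 = k p), pl P e k w) with hf
  have hinj : Set.InjOn f W := by
    intro w hw w' hw' hww
    apply hW w hw w' hw'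
    intro p hp'
    simp only [hf, Prod.mk.injEq] at hww
    have h1 := Finset.ext_iff.1 hww.1 p
    have h2 := dvd_pl (e := e) hP k w p hp'
    have h3 := dvd_pl (e := e) hP k w' p hp'
    rw [hww.2] at h2
    have h4 := hk w hw p hp'
    have h5 := hk w' hw' p hp'
    simp only [hQ, Finset.mem_filter, hp', true_and] at h1
    unfold dd at h4 h5
    have h6 := h2.symm.trans h3
    omega
  have hle : ∀ w ∈ W, hh P e w / mi P e k w ≤ G (f w).1 := by
    intro w hw
    have e1 : hh P e w / mi P e k w = ∏ p ∈ P, (hp p (e w p) * (if e w p + 1 = k p then 1 / (p : ℝ) else 1)) := by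
      unfold hh mi
      rw [Nat.cast_prod, ← Finset.prod_div_distrib]
      apply Finset.prod_congr rfl; intro p _
      split_ifs <;> simp [div_eq_mul_inv]
    have e2 : G (f w).1 = ∏ p ∈ P, (if 1 ≤ k p then (if e w p + 1 = k p then 1 / (p : ℝ) else 1 - 1 / (p : ℝ)) else 1) := by
      rw [← Finset.prod_filter, ← hQ, Finset.prod_ite]
      simp only [hG, hf]
      congr 2
      ext p; simp only [Finset.mem_sdiff, Finset.mem_filter]; tauto
    rw [e1, e2]
    apply Finset.prod_le_prod
    · intro p hp'
      have := (hp_pos (hP p hp').two_le (e w p)).le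
      split_ifs <;> positivity
    · intro p hp'
      have h0 := (hp_pos (hP p hp').two_le (e w p)).le
      have h1 := hp_le (p := p) (e w p)
      have h4 := hk w hw p hp'
      unfold dd at h4
      by_cases ha : 1 ≤ k p
      · by_cases hb : e w p + 1 = k p
        · simp only [ha, hb, if_true]
          have : (0 : ℝ) ≤ 1 / p := by positivity
          nlinarith
        · simp only [ha, hb, if_true, if_false]
          unfold hp
          rw [if_neg (by omega), mul_one]
      · have hb : ¬ (e w p + 1 = k p) := by omega
        simp only [ha, hb, if_false]; linarith
  calc ∑ w ∈ W, hh P e w / mi P e k w ≤ ∑ w ∈ W, G (f w).1 := Finset.sum_le_sum hle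
    _ = ∑ z ∈ W.image f, G z.1 := by rw [Finset.sum_image (fun a ha b hb h => hinj ha hb h)]
    _ ≤ ∑ z ∈ Q.powerset ×ˢ Finset.Icc 1 x, G z.1 := by
      apply Finset.sum_le_sum_of_subset_of_nonneg
      · intro z hz
        rw [Finset.mem_image] at hz
        obtain ⟨w, hw, rfl⟩ := hz
        simp only [hf, Finset.mem_product, Finset.mem_powerset, Finset.mem_Icc]
        exact ⟨Finset.filter_subset _ _, pl_pos hP k w, hx w hw⟩
      · intro z hz _
        rw [Finset.mem_product, Finset.mem_powerset] at hz
        exact hG0 _ hz.1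
    _ = x := by
      rw [Finset.sum_product]
      simp only [Finset.sum_const, Nat.card_Icc, nsmul_eq_mul, Nat.add_sub_cancel]
      rw [← Finset.mul_sum, hG, ← Finset.prod_add]
      simp

lemma half (hP : ∀ p ∈ P, p.Prime) (k : ℕ → ℕ) (hψ : ∀ v, 0 ≤ ψ v) (hW : Inj P e W)
    (E : ℕ → ℕ → Prop) [∀ v w, Decidable (E v w)] (x : ℕ → ℕ)
    (hE : ∀ v ∈ V, ∀ w ∈ W, E v w → (∀ p ∈ P, dd (e w p) (k p) ≤ 1) ∧ pl P e k w ≤ x v) :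
    ∑ v ∈ V, ∑ w ∈ W, (if E v w then mu P e ψ v * (hh P e w / (mi P e k w * x v)) else 0) ≤ MM P e ψ V := by
  have hP2 : ∀ p ∈ P, 2 ≤ p := fun p h => (hP p h).two_le
  apply Finset.sum_le_sum
  intro v hv
  rw [← Finset.sum_filter]
  have h1 := count (W := W.filter (E v)) hP k (x v)
    (fun w hw w' hw' => hW w (Finset.mem_of_mem_filter w hw) w' (Finset.mem_of_mem_filter w' hw'))
    (fun w hw => (hE v hv w (Finset.mem_filter.1 hw).1 (Finset.mem_filter.1 hw).2).1)
    (fun w hw => (hE v hv w (Finset.mem_filter.1 hw).1 (Finset.mem_filter.1 hw).2).2)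
  have h2 : ∀ w ∈ W.filter (E v), mu P e ψ v * (hh P e w / (mi P e k w * x v)) =
      mu P e ψ v / x v * (hh P e w / mi P e k w) := by
    intro w _
    have := mul_div_mul_comm (mu P e ψ v) (hh P e w) (x v : ℝ) (mi P e k w : ℝ)
    rw [← this, mul_comm (x v : ℝ), mul_div_assoc]
  rw [Finset.sum_congr rfl h2, ← Finset.mul_sum]
  have hm := mu_nonneg (e := e) hP2 hψ v
  rcases Nat.eq_zero_or_pos (x v) with h0 | h0
  · rw [h0]; simp [hm]
  · have hx : (0 : ℝ) < x v := by exact_mod_cast h0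
    calc _ ≤ mu P e ψ v / x v * x v := mul_le_mul_of_nonneg_left h1 (by positivity)
      _ = _ := div_mul_cancel₀ _ hx.ne'

lemma prod_good (k : ℕ → ℕ) (v w : ℕ) (h : ∀ p ∈ P, Good (k p) (e v p) (e w p)) :
    ∏ p ∈ P, (p : ℝ) ^ (e w p - e v p) = (pl P e k w : ℝ) * mi P e k v := by
  unfold pl mi
  rw [Nat.cast_prod, Nat.cast_prod, ← Finset.prod_mul_distrib]
  apply Finset.prod_congr rfl; intro p hp'
  obtain ⟨h1, h2, h3⟩ := h p hp'
  unfold dd at h1 h2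
  by_cases ha : e w p = k p + 1
  · rw [if_pos ha, if_neg (by omega), show e w p - e v p = 1 by omega]; simp
  · by_cases hb : e v p + 1 = k p
    · rw [if_neg ha, if_pos hb, show e w p - e v p = 1 by omega]; simp
    · rw [if_neg ha, if_neg hb, show e w p - e v p = 0 by omega]; simp

lemma Good_symm {k i j : ℕ} (h : Good k i j) : Good k j i := ⟨h.2.1, h.1, h.2.2.symm⟩

lemma final (hP : ∀ p ∈ P, p.Prime) (k : ℕ → ℕ) (hψ : ∀ v, 0 ≤ ψ v) (hθ : ∀ v, 0 ≤ θ v)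
    (hV : Inj P e V) (hW : Inj P e W)
    (E : ℕ → ℕ → Prop) [∀ v w, Decidable (E v w)]
    (hE : ∀ v w, E v w → cond P e ψ θ v w ∧ ∀ p ∈ P, Good (k p) (e v p) (e w p)) :
    (∑ v ∈ V, ∑ w ∈ W, (if E v w then mu P e ψ v * mu P e θ w else 0)) ^ 2 ≤ MM P e ψ V * MM P e θ W := by
  have hP2 : ∀ p ∈ P, 2 ≤ p := fun p h => (hP p h).two_le
  set x : ℕ → ℕ := fun v => (W.filter (fun w => E v w)).sup (pl P e k) with hx
  set y : ℕ → ℕ := fun w => (V.filter (fun v => E v w)).sup (pl P e k) with hy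
  have h1 := half (V := V) (W := W) hP k hψ hW E x (by
    intro v hv w hw h
    exact ⟨fun p hp' => ((hE v w h).2 p hp').2.1,
      Finset.le_sup (f := pl P e k) (Finset.mem_filter.2 ⟨hw, h⟩)⟩)
  have h2 := half (V := W) (W := V) hP k hθ hV (fun w v => E v w) y (by
    intro w hw v hv h
    exact ⟨fun p hp' => ((hE v w h).2 p hp').1,
      Finset.le_sup (f := pl P e k) (Finset.mem_filter.2 ⟨hv, h⟩)⟩)
  rw [Finset.sum_comm] at h2
  have hMn := MM_nonneg (V := V) (e := e) hP2 hψ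
  have hMn' := MM_nonneg (V := W) (e := e) hP2 hθ
  rw [← Finset.sum_product'] at h1 h2 ⊢
  refine le_trans (Finset.sum_sq_le_sum_mul_sum_of_sq_le_mul (V ×ˢ W)
    (r := fun q => if E q.1 q.2 then mu P e ψ q.1 * mu P e θ q.2 else 0)
    (f := fun q => if E q.1 q.2 then mu P e ψ q.1 * (hh P e q.2 / (mi P e k q.2 * x q.1)) else 0)
    (g := fun q => if E q.1 q.2 then mu P e θ q.2 * (hh P e q.1 / (mi P e k q.1 * y q.2)) else 0)
    ?_ ?_ ?_) ?_
  · rintro ⟨v, w⟩ _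
    have := mu_nonneg (e := e) hP2 hψ v
    have := (prodhp_pos (e := e) hP2 w).le
    dsimp only; unfold hh; split_ifs <;> positivity
  · rintro ⟨v, w⟩ _
    have := mu_nonneg (e := e) hP2 hθ w
    have := (prodhp_pos (e := e) hP2 v).le
    dsimp only; unfold hh; split_ifs <;> positivity
  · rintro ⟨v, w⟩ hvw
    rw [Finset.mem_product] at hvw
    dsimp only at hvw ⊢
    by_cases h : E v w
    swap
    · simp [h]
    rw [if_pos h, if_pos h, if_pos h]
    -- bounds on ψ and θ
    have hne1 : (W.filter (fun w => E v w)).Nonempty := ⟨w, Finset.mem_filter.2 ⟨hvw.2, h⟩⟩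
    have hne2 : (V.filter (fun v => E v w)).Nonempty := ⟨v, Finset.mem_filter.2 ⟨hvw.1, h⟩⟩
    obtain ⟨w0, hw0, hxw⟩ := Finset.exists_mem_eq_sup _ hne1 (pl P e k)
    obtain ⟨v0, hv0, hyv⟩ := Finset.exists_mem_eq_sup _ hne2 (pl P e k)
    have hw0E := (Finset.mem_filter.1 hw0).2
    have hv0E := (Finset.mem_filter.1 hv0).2
    have b1 : ψ v * ((x v : ℝ) * mi P e k v) ≤ 1 := by
      have := (hE v w0 hw0E).1.1
      rw [prod_good k v w0 (hE v w0 hw0E).2] at this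
      simp only [hx]; rw [hxw]; exact this
    have b2 : θ w * ((y w : ℝ) * mi P e k w) ≤ 1 := by
      have := (hE v0 w hv0E).1.2
      rw [prod_good k w v0 (fun p hp' => Good_symm ((hE v0 w hv0E).2 p hp'))] at this
      simp only [hy]; rw [hyv]; exact this
    have hx0 : (0 : ℝ) < x v := by
      have : 0 < x v := by simp only [hx]; rw [hxw]; exact pl_pos hP k w0
      exact_mod_cast this
    have hy0 : (0 : ℝ) < y w := by
      have : 0 < y w := by simp only [hy]; rw [hyv]; exact pl_pos hP k v0
      exact_mod_cast this
    have hm1 : (0 : ℝ) < mi P e k v := by exact_mod_cast mi_pos hP k v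
    have hm2 : (0 : ℝ) < mi P e k w := by exact_mod_cast mi_pos hP k w
    have hh1 : 0 < hh P e v := prodhp_pos hP2 v
    have hh2 : 0 < hh P e w := prodhp_pos hP2 w
    have m1 : mu P e ψ v = ψ v * hh P e v := rfl
    have m2 : mu P e θ w = θ w * hh P e w := rfl
    have c1 : ψ v ≤ 1 / ((x v : ℝ) * mi P e k v) := by rw [le_div_iff₀ (by positivity)]; exact b1
    have c2 : θ w ≤ 1 / ((y w : ℝ) * mi P e k w) := by rw [le_div_iff₀ (by positivity)]; exact b2
    have hψv := hψ v
    have hθw := hθ w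
    rw [m1, m2]
    calc (ψ v * hh P e v * (θ w * hh P e w)) ^ 2 =
        (ψ v * hh P e v * (θ w * hh P e w) * (hh P e v * hh P e w)) * (ψ v * θ w) := by ring
      _ ≤ (ψ v * hh P e v * (θ w * hh P e w) * (hh P e v * hh P e w)) *
          (1 / ((x v : ℝ) * mi P e k v) * (1 / ((y w : ℝ) * mi P e k w))) := by
          apply mul_le_mul_of_nonneg_left _ (by positivity)
          exact mul_le_mul c1 c2 hθw (by positivity)
      _ = _ := by field_simp
  · exact mul_le_mul h1 h2 (Finset.sum_nonneg (by
      rintro ⟨v, w⟩ _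
      have := mu_nonneg (e := e) hP2 hθ w
      have := (prodhp_pos (e := e) hP2 v).le
      dsimp only; unfold hh; split_ifs <;> positivity)) hMn

end QDS

namespace QDS
variable {P : Finset ℕ} {e : ℕ → ℕ → ℕ} {ψ θ : ℕ → ℝ} {V W : Finset ℕ}

lemma wt_eq (u : ℕ → ℝ) (v w : ℕ) : wt P e (fun p => Real.exp (u p)) v w =
    Real.exp (∑ p ∈ P, if e v p ≠ e w p then u p else 0) := by
  unfold wt
  rw [Real.exp_sum]
  apply Finset.prod_congr rfl; intro p _
  by_cases h : e v p = e w p <;> simp [h]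

theorem thm1 (u : ℕ → ℝ) (hu0 : ∀ p, 0 ≤ u p) (hu1 : ∀ p, u p ≤ 1) (e : ℕ → ℕ → ℕ) (P : Finset ℕ)
    (hP : ∀ p ∈ P, p.Prime) (hr : ∀ p ∈ P, rt (1 / (p : ℝ)) ≤ 1 / 2000)
    (hs : 10 ^ 6 * ∑ p ∈ P, rt (1 / (p : ℝ)) ^ 5 ≤ 1 / 4)
    (hus : ∑ p ∈ P, u p * (1 / (p : ℝ)) ≤ 2) :
    Bound P e (fun p => Real.exp (u p)) (2 * Real.exp (8 * 10 ^ 6)) := by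
  induction P using Finset.strongInduction with
  | H P ih =>
  have hP2 : ∀ p ∈ P, 2 ≤ p := fun p h => (hP p h).two_le
  set τ := fun p => Real.exp (u p) with hτd
  have hτ : ∀ p, 1 ≤ τ p := fun p => Real.one_le_exp (hu0 p)
  have hτ3 : ∀ p, τ p ≤ 3 := fun p => by
    have := Real.exp_le_exp.2 (hu1 p)
    have h2 := Real.exp_one_lt_d9
    simp only [hτd]; linarith
  set K : ℝ := 8 * 10 ^ 6 with hK
  clear_value K
  set C : ℝ := 2 * Real.exp K with hC
  clear_value C
  have hC0 : 0 < C := by rw [hC]; positivity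
  have hK0 : 0 < K := by rw [hK]; norm_num
  have hbd : ∀ p ∈ P, Bound (P.erase p) e τ C := by
    intro p hp'
    apply ih _ (Finset.erase_ssubset hp')
    · intro q hq; exact hP q (Finset.mem_of_mem_erase hq)
    · intro q hq; exact hr q (Finset.mem_of_mem_erase hq)
    · refine le_trans (mul_le_mul_of_nonneg_left ?_ (by norm_num)) hs
      apply Finset.sum_le_sum_of_subset_of_nonneg (Finset.erase_subset _ _)
      intro q _ _; exact pow_nonneg (rt_nonneg _) _
    · refine le_trans ?_ hus
      apply Finset.sum_le_sum_of_subset_of_nonneg (Finset.erase_subset _ _)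
      intro q _ _; exact mul_nonneg (hu0 q) (by positivity)
  intro V W ψ θ hψ hθ hV hW
  by_contra hbig
  rw [not_le] at hbig
  have hk : ∀ p : ℕ, ∃ k : ℕ, p ∈ P → (∑ v ∈ V, ∑ w ∈ W, (if e v p ≠ e w p then term P e τ ψ θ v w else 0) ≤
        10 ^ 6 * (1 / (p : ℝ)) * BB P e τ ψ θ V W ∧
      ∑ v ∈ V, ∑ w ∈ W, (if Good k (e v p) (e w p) then 0 else term P e τ ψ θ v w) ≤
        10 ^ 6 * rt (1 / (p : ℝ)) ^ 5 * BB P e τ ψ θ V W) := by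
    intro p
    by_cases hp' : p ∈ P
    · obtain ⟨k, h⟩ := conc_p hC0 hP2 hτ hτ3 hψ hθ p hp' (hr p hp') (hbd p hp') hV hW hbig
      exact ⟨k, fun _ => h⟩
    · exact ⟨0, fun h => absurd h hp'⟩
  choose k hk using hk
  set B := BB P e τ ψ θ V W with hB
  set U : ℕ → ℕ → ℝ := fun v w => ∑ p ∈ P, if e v p ≠ e w p then u p else 0 with hU
  obtain ⟨E, hE⟩ : ∃ E : ℕ → ℕ → Prop, ∀ v w, E v w ↔ (cond P e ψ θ v w ∧ (∀ p ∈ P, Good (k p) (e v p) (e w p)) ∧ U v w ≤ K) := ⟨_, fun v w => Iff.rfl⟩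
  have : ∀ v w, Decidable (E v w) := fun _ _ => Classical.dec _
  have hU0 : ∀ v w, 0 ≤ U v w := by
    intro v w; apply Finset.sum_nonneg; intro p _; split_ifs
    · exact hu0 p
    · exact le_rfl
  have ht0 := term_nonneg (e := e) hP2 hτ hψ hθ
  have hpt : ∀ v w, term P e τ ψ θ v w ≤
      Real.exp K * (if E v w then mu P e ψ v * mu P e θ w else 0) +
      (∑ p ∈ P, if Good (k p) (e v p) (e w p) then 0 else term P e τ ψ θ v w) +
      (1 / K) * ∑ p ∈ P, u p * (if e v p ≠ e w p then term P e τ ψ θ v w else 0) := by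
    intro v w
    have n1 : 0 ≤ Real.exp K * (if E v w then mu P e ψ v * mu P e θ w else 0) := by
      have := mu_nonneg (e := e) hP2 hψ v
      have := mu_nonneg (e := e) hP2 hθ w
      split_ifs <;> positivity
    have n2' : ∀ p ∈ P, 0 ≤ (if Good (k p) (e v p) (e w p) then 0 else term P e τ ψ θ v w) := by
      intro p _
      split_ifs
      · exact le_rfl
      · exact ht0 v w
    have n2 := Finset.sum_nonneg n2'
    have e3 : ∑ p ∈ P, u p * (if e v p ≠ e w p then term P e τ ψ θ v w else 0) = U v w * term P e τ ψ θ v w := by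
      rw [hU, Finset.sum_mul]
      apply Finset.sum_congr rfl; intro p _; split_ifs <;> simp
    rw [e3]
    have n3 : 0 ≤ 1 / K * (U v w * term P e τ ψ θ v w) :=
      mul_nonneg (by positivity) (mul_nonneg (hU0 v w) (ht0 v w))
    by_cases h : E v w
    · refine le_trans ?_ (by linarith : Real.exp K * (if E v w then mu P e ψ v * mu P e θ w else 0) ≤ _)
      rw [if_pos h]
      unfold term
      rw [if_pos ((hE v w).1 h).1, hτd, wt_eq]
      have := mu_nonneg (e := e) hP2 hψ v
      have := mu_nonneg (e := e) hP2 hθ w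
      rw [mul_comm (Real.exp K)]
      apply mul_le_mul_of_nonneg_left _ (by positivity)
      exact Real.exp_le_exp.2 ((hE v w).1 h).2.2
    · by_cases hc : cond P e ψ θ v w
      · by_cases hg : ∀ p ∈ P, Good (k p) (e v p) (e w p)
        · have hUK : K < U v w := by
            by_contra hn; exact h <| (hE v w).2 ⟨hc, hg, not_lt.1 hn⟩
          refine le_trans ?_ (by linarith : 1 / K * (U v w * term P e τ ψ θ v w) ≤ _)
          have : 1 ≤ U v w / K := by rw [one_le_div (by positivity)]; exact hUK.le
          calc term P e τ ψ θ v w = 1 * term P e τ ψ θ v w := (one_mul _).symm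
            _ ≤ U v w / K * term P e τ ψ θ v w := mul_le_mul_of_nonneg_right this (ht0 v w)
            _ = _ := by ring
        · push Not at hg
          obtain ⟨p, hp', hg⟩ := hg
          have := Finset.single_le_sum n2' hp'
          rw [if_neg hg] at this
          linarith
      · have : term P e τ ψ θ v w = 0 := by unfold term; rw [if_neg hc]
        rw [this] at n3 ⊢
        simp only [this] at n2
        linarith
  set R := ∑ v ∈ V, ∑ w ∈ W, (if E v w then mu P e ψ v * mu P e θ w else 0) with hR
  have hB0 : 0 ≤ B := Finset.sum_nonneg fun v _ => Finset.sum_nonneg fun w _ => ht0 v w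
  have s1 : B ≤ Real.exp K * R + (∑ p ∈ P, ∑ v ∈ V, ∑ w ∈ W, (if Good (k p) (e v p) (e w p) then 0 else term P e τ ψ θ v w))
      + (1 / K) * ∑ p ∈ P, u p * ∑ v ∈ V, ∑ w ∈ W, (if e v p ≠ e w p then term P e τ ψ θ v w else 0) := by
    calc B ≤ ∑ v ∈ V, ∑ w ∈ W, _ := Finset.sum_le_sum fun v _ => Finset.sum_le_sum fun w _ => hpt v w
      _ = _ := by
        simp_rw [Finset.sum_add_distrib, ← Finset.mul_sum]
        congr 1
        · congr 1
          simp_rw [Finset.sum_comm (s := W) (t := P)]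
          rw [Finset.sum_comm]
        · congr 1
          simp_rw [Finset.mul_sum]
          simp_rw [Finset.sum_comm (s := W) (t := P)]
          rw [Finset.sum_comm]
  have s2 : (∑ p ∈ P, ∑ v ∈ V, ∑ w ∈ W, (if Good (k p) (e v p) (e w p) then 0 else term P e τ ψ θ v w)) ≤ 1 / 4 * B := by
    calc _ ≤ ∑ p ∈ P, 10 ^ 6 * rt (1 / (p : ℝ)) ^ 5 * B := Finset.sum_le_sum fun p hp' => (hk p hp').2
      _ = (10 ^ 6 * ∑ p ∈ P, rt (1 / (p : ℝ)) ^ 5) * B := by rw [← Finset.sum_mul, ← Finset.mul_sum]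
      _ ≤ _ := mul_le_mul_of_nonneg_right hs hB0
  have s3 : (1 / K) * ∑ p ∈ P, u p * ∑ v ∈ V, ∑ w ∈ W, (if e v p ≠ e w p then term P e τ ψ θ v w else 0) ≤ 1 / 4 * B := by
    have : ∑ p ∈ P, u p * ∑ v ∈ V, ∑ w ∈ W, (if e v p ≠ e w p then term P e τ ψ θ v w else 0) ≤ 10 ^ 6 * B * 2 := by
      calc _ ≤ ∑ p ∈ P, u p * (10 ^ 6 * (1 / (p : ℝ)) * B) :=
            Finset.sum_le_sum fun p hp' => mul_le_mul_of_nonneg_left (hk p hp').1 (hu0 p)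
        _ = 10 ^ 6 * B * ∑ p ∈ P, u p * (1 / (p : ℝ)) := by
            rw [Finset.mul_sum]; apply Finset.sum_congr rfl; intro p _; ring
        _ ≤ _ := mul_le_mul_of_nonneg_left hus (by positivity)
    rw [hK]; linarith
  have s4 : B ≤ C * R := by rw [hC]; linarith
  have f1 := final (V := V) (W := W) hP k hψ hθ hV hW E (fun v w h => ⟨((hE v w).1 h).1, ((hE v w).1 h).2.1⟩)
  have hMn := MM_nonneg (V := V) (e := e) hP2 hψ
  have hMn' := MM_nonneg (V := W) (e := e) hP2 hθ
  have f2 : R ≤ MM P e ψ V * MM P e θ W := by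
    unfold MM
    rw [Finset.sum_mul_sum]
    apply Finset.sum_le_sum; intro v _; apply Finset.sum_le_sum; intro w _
    have := mu_nonneg (e := e) hP2 hψ v
    have := mu_nonneg (e := e) hP2 hθ w
    split_ifs
    · exact le_rfl
    · positivity
  rw [← hR] at f1
  set z := rt (MM P e ψ V) * rt (MM P e θ W) with hz
  have hz0 : 0 ≤ z := mul_nonneg (rt_nonneg _) (rt_nonneg _)
  have hz4 : MM P e ψ V * MM P e θ W = z ^ 4 := by rw [hz, mul_pow, rt_pow hMn, rt_pow hMn']
  rw [hz4] at f1 f2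
  have f3 : R ≤ z ^ 2 := le_of_sq_le_sq_aux (by rw [← pow_mul]; exact f1) (by positivity)
  have f4 : R ≤ z ^ 3 := by
    rcases le_total z 1 with h | h
    · refine f2.trans (pow_le_pow_of_le_one hz0 h (by norm_num))
    · exact f3.trans (pow_le_pow_right₀ h (by norm_num))
  have := mul_le_mul_of_nonneg_left f4 hC0.le
  linarith

end QDS

namespace QDS
variable {P : Finset ℕ} {e : ℕ → ℕ → ℕ} {τ ψ θ : ℕ → ℝ} {V W : Finset ℕ}

lemma sum_rt6 (hP : ∀ p ∈ P, 2 ≤ p) (hψ : ∀ v, 0 ≤ ψ v) (p n : ℕ) (hVn : ∀ v ∈ V, e v p < n) :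
    ∑ i ∈ Finset.range n, (rt (MM P e ψ (V.filter (fun v => e v p = i))) ^ 3) ^ 2 ≤
      (rt (MM P e ψ V) ^ 3) ^ 2 := by
  have hM := MM_nonneg (V := V) (e := e) hP hψ
  have hMi : ∀ i, 0 ≤ MM P e ψ (V.filter (fun v => e v p = i)) := fun i => MM_nonneg hP hψ
  have e1 : ∀ x : ℝ, 0 ≤ x → (rt x ^ 3) ^ 2 = x * rt x ^ 2 := by
    intro x hx
    calc (rt x ^ 3) ^ 2 = rt x ^ 4 * rt x ^ 2 := by ring
      _ = _ := by rw [rt_pow hx]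
  rw [e1 _ hM]
  nth_rewrite 1 [← fiber_MM (P := P) (ψ := ψ) p n hVn]
  rw [Finset.sum_mul]
  apply Finset.sum_le_sum
  intro i hi
  rw [e1 _ (hMi i)]
  apply mul_le_mul_of_nonneg_left _ (hMi i)
  apply pow_le_pow_left₀ (rt_nonneg _)
  apply rt_mono
  rw [← fiber_MM (P := P) (ψ := ψ) p n hVn]
  exact Finset.single_le_sum (f := fun i => MM P e ψ (V.filter (fun v => e v p = i))) (fun i _ => hMi i) hi

lemma step_small {C : ℝ} (hC : 0 ≤ C) (hP : ∀ p ∈ P, 2 ≤ p) (hτ : ∀ p, 1 ≤ τ p) (hτ3 : ∀ p, τ p ≤ 3)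
    (p : ℕ) (hpP : p ∈ P) (hb : Bound (P.erase p) e τ C) : Bound P e τ (C * 40) := by
  intro V W ψ θ hψ hθ hV hW
  have hp2 := hP p hpP
  have hp2r : (2 : ℝ) ≤ p := by exact_mod_cast hp2
  obtain ⟨n, hVn, hWn⟩ := exists_bd p V W e
  set r := rt (1 / (p : ℝ)) with hr
  have hr0 : 0 < r := rt_pos (by positivity)
  have hr1 : r ≤ 85 / 100 := by
    by_contra h
    rw [not_le] at h
    have h4 : r ^ 4 = 1 / (p : ℝ) := rt_pow (by positivity)
    have : (85 / 100 : ℝ) ^ 4 ≤ r ^ 4 := pow_le_pow_left₀ (by norm_num) h.le 4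
    have h5 : 1 / (p : ℝ) ≤ 1 / 2 := one_div_le_one_div_of_le (by norm_num) hp2r
    norm_num at this
    linarith
  have hK : 1 + 6 * r / (1 - r) ≤ 40 := by
    have : 6 * r / (1 - r) ≤ 39 := by rw [div_le_iff₀ (by linarith)]; linarith
    linarith
  have hX := pow_nonneg (rt_nonneg (MM P e ψ V)) 3
  have hY := pow_nonneg (rt_nonneg (MM P e θ W)) 3
  have hs := schur (Finset.range n) (Finset.range n) (fun i j => ker r (dd i j))
    (fun i => rt (MM P e ψ (V.filter (fun v => e v p = i))) ^ 3)
    (fun i => rt (MM P e θ (W.filter (fun v => e v p = i))) ^ 3)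
    40 _ _ (fun i j => ker_nonneg r hr0 _) (by norm_num) hX hY
    (fun i _ => (ker_row r hr0 (by linarith) n i _ subset_rfl).trans hK)
    (fun j _ => by
      simp_rw [dd_comm _ j]
      exact (ker_row r hr0 (by linarith) n j _ subset_rfl).trans hK)
    (sum_rt6 hP hψ p n hVn) (sum_rt6 hP hθ p n hWn)
  unfold BB
  rw [fiber_sum p n hVn hWn]
  calc _ ≤ ∑ i ∈ Finset.range n, ∑ j ∈ Finset.range n, C * (ker r (dd i j) *
        (rt (MM P e ψ (V.filter (fun v => e v p = i))) ^ 3 *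
        rt (MM P e θ (W.filter (fun v => e v p = j))) ^ 3)) :=
        Finset.sum_le_sum fun i _ => Finset.sum_le_sum fun j _ =>
          BB_step hC hP hτ hτ3 hψ hθ p hpP hb hV hW i j
    _ = C * ∑ i ∈ Finset.range n, ∑ j ∈ Finset.range n, (ker r (dd i j) *
        (rt (MM P e ψ (V.filter (fun v => e v p = i))) ^ 3 *
        rt (MM P e θ (W.filter (fun v => e v p = j))) ^ 3)) := by simp_rw [Finset.mul_sum]
    _ ≤ C * (40 * (rt (MM P e ψ V) ^ 3 * rt (MM P e θ W) ^ 3)) := mul_le_mul_of_nonneg_left hs hC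
    _ = _ := by ring

lemma rt_summable : Summable (fun n : ℕ => rt (1 / (n : ℝ)) ^ 5) := by
  have h := (Real.summable_one_div_nat_rpow (p := 5 / 4)).2 (by norm_num)
  refine h.congr ?_
  intro n
  have hn : (0 : ℝ) ≤ 1 / n := by positivity
  unfold rt
  rw [Real.sqrt_eq_rpow, Real.sqrt_eq_rpow, ← Real.rpow_mul hn, ← Real.rpow_natCast, ← Real.rpow_mul hn,
    Real.div_rpow (by norm_num) (by positivity), Real.one_rpow]
  norm_num

theorem thm2 : ∃ C : ℝ, 0 < C ∧ ∀ (u : ℕ → ℝ) (_ : ∀ p, 0 ≤ u p) (_ : ∀ p, u p ≤ 1) (e : ℕ → ℕ → ℕ)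
    (P : Finset ℕ) (_ : ∀ p ∈ P, p.Prime) (_ : ∑ p ∈ P, u p * (1 / (p : ℝ)) ≤ 2),
    Bound P e (fun p => Real.exp (u p)) C := by
  obtain ⟨s, hs⟩ := (summable_iff_vanishing_norm.1 rt_summable) (1 / (4 * 10 ^ 6)) (by norm_num)
  set C0 : ℝ := 2 * Real.exp (8 * 10 ^ 6) with hC0
  have hC0p : 0 < C0 := by positivity
  clear_value C0
  obtain ⟨s0, hs0s, hs0⟩ : ∃ s0 : Finset ℕ, s ⊆ s0 ∧ ∀ p, p ∉ s0 → 2000 ^ 4 ≤ p :=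
    ⟨s ∪ Finset.range (2000 ^ 4), Finset.subset_union_left, fun p hp' => by
      rw [Finset.mem_union, not_or, Finset.mem_range, not_lt] at hp'
      exact hp'.2⟩
  refine ⟨C0 * 40 ^ s0.card, by positivity, ?_⟩
  intro u hu0 hu1 e P hP hus
  have hτ : ∀ p, 1 ≤ Real.exp (u p) := fun p => Real.one_le_exp (hu0 p)
  have hτ3 : ∀ p, Real.exp (u p) ≤ 3 := fun p => by
    have := Real.exp_le_exp.2 (hu1 p)
    have h2 := Real.exp_one_lt_d9
    linarith
  have main : ∀ m : ℕ, ∀ P : Finset ℕ, (∀ p ∈ P, p.Prime) → ∑ p ∈ P, u p * (1 / (p : ℝ)) ≤ 2 →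
      (P ∩ s0).card = m → Bound P e (fun p => Real.exp (u p)) (C0 * 40 ^ m) := by
    intro m
    induction m with
    | zero =>
      intro P hP hus hc
      rw [Finset.card_eq_zero, ← Finset.disjoint_iff_inter_eq_empty] at hc
      rw [pow_zero, mul_one, hC0]
      apply thm1 u hu0 hu1 e P hP _ _ hus
      · intro p hp'
        have h1 := hs0 p (Finset.disjoint_left.1 hc hp')
        have h2 : (2000 ^ 4 : ℝ) ≤ p := by exact_mod_cast h1
        have h3 : 1 / (p : ℝ) ≤ (1 / 2000) ^ 4 := by
          rw [div_pow, one_pow]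
          exact one_div_le_one_div_of_le (by norm_num) h2
        have h4 := rt_mono h3
        rw [rt_npow (by norm_num)] at h4
        have h5 : rt (1 / 2000) ^ 4 = 1 / 2000 := rt_pow (by norm_num)
        rw [h5] at h4
        exact h4
      · have h1 := hs P (hc.mono_right hs0s)
        rw [Real.norm_eq_abs] at h1
        have h2 := (le_abs_self _).trans h1.le
        norm_num at h2 ⊢
        linarith
    | succ m ih =>
      intro P hP hus hc
      have hne : (P ∩ s0).Nonempty := by rw [← Finset.card_pos]; omega
      obtain ⟨p, hp'⟩ := hne
      have hpP := (Finset.mem_inter.1 hp').1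
      have := ih (P.erase p) (fun q hq => hP q (Finset.mem_of_mem_erase hq))
        (by
          refine le_trans ?_ hus
          apply Finset.sum_le_sum_of_subset_of_nonneg (Finset.erase_subset _ _)
          intro q _ _; exact mul_nonneg (hu0 q) (by positivity))
        (by rw [Finset.erase_inter, Finset.card_erase_of_mem hp', hc]; rfl)
      rw [pow_succ, ← mul_assoc]
      exact step_small (by positivity) (fun q hq => (hP q hq).two_le) hτ hτ3 p hpP this
  intro V W ψ θ hψ hθ hV hW
  refine (main _ P hP hus rfl V W ψ θ hψ hθ hV hW).trans ?_
  apply mul_le_mul_of_nonneg_right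
  · apply mul_le_mul_of_nonneg_left _ hC0p.le
    exact pow_le_pow_right₀ (by norm_num) (Finset.card_le_card Finset.inter_subset_right)
  · exact pow_nonneg (mul_nonneg (rt_nonneg _) (rt_nonneg _)) _

end QDS

namespace QDS

noncomputable def lam (ψ : ℕ → ℝ) (n : ℕ) : ℝ := 2 * (Nat.totient n : ℝ) * ψ n / n

/-- primes at which `v` and `w` have different valuations -/
def dp (v w : ℕ) : Finset ℕ := ((v / v.gcd w) * (w / v.gcd w)).primeFactors

noncomputable def LL (t v w : ℕ) : ℝ := ∑ p ∈ (dp v w).filter (fun p => t ≤ p), 1 / (p : ℝ)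

lemma fact_div_gcd {v w : ℕ} (hv : v ≠ 0) (hw : w ≠ 0) (p : ℕ) :
    (w / v.gcd w).factorization p = w.factorization p - v.factorization p := by
  rw [Nat.factorization_div (Nat.gcd_dvd_right v w), Nat.factorization_gcd hv hw]
  simp only [Finsupp.coe_tsub, Pi.sub_apply, Finsupp.inf_apply]
  omega

lemma div_gcd_ne {v w : ℕ} (hw : w ≠ 0) : w / v.gcd w ≠ 0 := by
  have h := Nat.gcd_dvd_right v w
  have h1 : 0 < v.gcd w := Nat.gcd_pos_of_pos_right _ (Nat.pos_of_ne_zero hw)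
  exact (Nat.div_pos (Nat.le_of_dvd (Nat.pos_of_ne_zero hw) h) h1).ne'

lemma div_gcd_ne' {v w : ℕ} (hv : v ≠ 0) : v / v.gcd w ≠ 0 := by
  rw [Nat.gcd_comm]; exact div_gcd_ne hv

lemma mem_dp {v w : ℕ} (hv : v ≠ 0) (hw : w ≠ 0) (p : ℕ) :
    p ∈ dp v w ↔ p.Prime ∧ v.factorization p ≠ w.factorization p := by
  unfold dp
  rw [← Nat.support_factorization, Finsupp.mem_support_iff,
    Nat.factorization_mul (div_gcd_ne' hv) (div_gcd_ne hw), Finsupp.add_apply, fact_div_gcd hv hw,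
    Nat.gcd_comm, fact_div_gcd hw hv]
  by_cases hp : p.Prime
  · simp only [hp, true_and]; omega
  · simp [hp, Nat.factorization_eq_zero_of_not_prime]

lemma prod_fact {w N : ℕ} (v : ℕ) (hv : v ≠ 0) (hw : w ≠ 0) (hN : w ≤ N) :
    ∏ p ∈ (Finset.Icc 1 N).filter Nat.Prime, (p : ℝ) ^ (w.factorization p - v.factorization p) =
      (w : ℝ) / (v.gcd w : ℝ) := by
  have h1 : ((w / v.gcd w : ℕ) : ℝ) = (w : ℝ) / (v.gcd w : ℝ) := by
    rw [Nat.cast_div (Nat.gcd_dvd_right v w)]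
    exact_mod_cast (Nat.gcd_pos_of_pos_right _ (Nat.pos_of_ne_zero hw)).ne'
  rw [← h1]
  conv_rhs => rw [← Nat.prod_factorization_pow_eq_self (div_gcd_ne (v := v) hw)]
  rw [Finsupp.prod_of_support_subset (s := (Finset.Icc 1 N).filter Nat.Prime)]
  · push_cast
    apply Finset.prod_congr rfl; intro p _; rw [fact_div_gcd hv hw]
  · intro p hp
    rw [Nat.support_factorization, Nat.mem_primeFactors] at hp
    rw [Finset.mem_filter, Finset.mem_Icc]
    refine ⟨⟨hp.1.one_lt.le, ?_⟩, hp.1⟩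
    refine (Nat.le_of_dvd (Nat.pos_of_ne_zero hp.2.2) hp.2.1).trans ((Nat.div_le_self _ _).trans hN)
  · simp

lemma prod_hp {v N : ℕ} (hv : v ≠ 0) (hN : v ≤ N) :
    ∏ p ∈ (Finset.Icc 1 N).filter Nat.Prime, hp p (v.factorization p) = (Nat.totient v : ℝ) / v := by
  have hv0 : (v : ℝ) ≠ 0 := by exact_mod_cast hv
  have h := Nat.totient_eq_mul_prod_factors v
  have h' : (Nat.totient v : ℝ) = v * ∏ p ∈ v.primeFactors, (1 - (p : ℝ)⁻¹) := by
    have := congrArg (fun x : ℚ => (x : ℝ)) h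
    push_cast at this
    exact this
  rw [h', mul_div_cancel_left₀ _ hv0]
  symm
  rw [← Finset.prod_subset (s₁ := v.primeFactors) (s₂ := (Finset.Icc 1 N).filter Nat.Prime)
    (f := fun p => hp p (v.factorization p))]
  · apply Finset.prod_congr rfl; intro p hp'
    unfold hp
    rw [if_neg, one_div]
    rw [← Nat.support_factorization, Finsupp.mem_support_iff] at hp'
    exact hp'
  · intro p hp'
    rw [Nat.mem_primeFactors] at hp'
    rw [Finset.mem_filter, Finset.mem_Icc]
    exact ⟨⟨hp'.1.one_lt.le, (Nat.le_of_dvd (Nat.pos_of_ne_zero hv) hp'.2.1).trans hN⟩, hp'.1⟩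
  · intro p _ hp'
    unfold hp
    rw [if_pos]
    rw [← Nat.support_factorization, Finsupp.mem_support_iff, not_not] at hp'
    exact hp'

lemma sum_inv_sq (t N : ℕ) (ht : 1 ≤ t) : ∑ n ∈ Finset.Icc t N, (t : ℝ) / n * (1 / n) ≤ 2 := by
  have ht' : (1 : ℝ) ≤ t := by exact_mod_cast ht
  rcases le_or_gt t N with h | h
  · rw [Finset.Icc_eq_cons_Ioc h, Finset.sum_cons]
    have h1 := sum_Ioc_inv_sq_le_sub (α := ℝ) (by omega : t ≠ 0) h
    have h2 : ∑ n ∈ Finset.Ioc t N, (t : ℝ) / n * (1 / n) = t * ∑ n ∈ Finset.Ioc t N, ((n : ℝ) ^ 2)⁻¹ := by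
      rw [Finset.mul_sum]; apply Finset.sum_congr rfl; intro n _
      rw [div_mul_div_comm, mul_one, sq, div_eq_mul_inv]
    rw [h2]
    have h3 : (0 : ℝ) ≤ (N : ℝ)⁻¹ := by positivity
    have h4 : (t : ℝ) * ∑ n ∈ Finset.Ioc t N, ((n : ℝ) ^ 2)⁻¹ ≤ t * (t : ℝ)⁻¹ :=
      mul_le_mul_of_nonneg_left (by linarith) (by linarith)
    rw [mul_inv_cancel₀ (by linarith)] at h4
    have h5 : (t : ℝ) / t * (1 / t) ≤ 1 := by
      rw [div_self (by linarith), one_mul, div_le_one (by linarith)]; exact ht'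
    linarith
  · rw [Finset.Icc_eq_empty (by omega)]; simp

theorem corB : ∃ C : ℝ, 0 < C ∧ ∀ (t N : ℕ) (_ : 1 ≤ t) (ψ : ℕ → ℝ) (_ : ∀ n, 0 ≤ ψ n) (c : ℝ) (_ : 0 < c),
    ∑ v ∈ Finset.Icc 1 N, ∑ w ∈ Finset.Icc 1 N,
      (if (w : ℝ) * ψ v ≤ c * v.gcd w ∧ (v : ℝ) * ψ w ≤ c * v.gcd w then
        lam ψ v * lam ψ w * Real.exp (t * LL t v w) else 0) ≤
      C * Real.sqrt c * ((∑ n ∈ Finset.Icc 1 N, lam ψ n) * Real.sqrt (∑ n ∈ Finset.Icc 1 N, lam ψ n)) := by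
  obtain ⟨C, hC, h⟩ := thm2
  refine ⟨4 * C, by positivity, ?_⟩
  intro t N ht ψ hψ c hc
  have ht' : (1 : ℝ) ≤ t := by exact_mod_cast ht
  set P := (Finset.Icc 1 N).filter Nat.Prime with hPd
  set u : ℕ → ℝ := fun p => if t ≤ p then (t : ℝ) / p else 0 with hu
  have hu0 : ∀ p, 0 ≤ u p := by intro p; simp only [hu]; split_ifs <;> positivity
  have hu1 : ∀ p, u p ≤ 1 := by
    intro p; simp only [hu]; split_ifs with hp
    · have : (t : ℝ) ≤ p := by exact_mod_cast hp
      rw [div_le_one (by linarith)]; exact this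
    · norm_num
  have hP : ∀ p ∈ P, p.Prime := fun p hp => (Finset.mem_filter.1 hp).2
  have hus : ∑ p ∈ P, u p * (1 / (p : ℝ)) ≤ 2 := by
    refine le_trans ?_ (sum_inv_sq t N ht)
    calc ∑ p ∈ P, u p * (1 / (p : ℝ)) = ∑ p ∈ P.filter (fun p => t ≤ p), (t : ℝ) / p * (1 / p) := by
          rw [Finset.sum_filter (s := P)]; apply Finset.sum_congr rfl; intro p _
          simp only [hu]; split_ifs <;> simp
      _ ≤ _ := by
          apply Finset.sum_le_sum_of_subset_of_nonneg
          · intro p hp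
            rw [hPd, Finset.mem_filter, Finset.mem_filter, Finset.mem_Icc] at hp
            rw [Finset.mem_Icc]; exact ⟨hp.2, hp.1.1.2⟩
          · intro p _ _; positivity
  have hne : ∀ v ∈ Finset.Icc 1 N, v ≠ 0 := fun v hv => by
    rw [Finset.mem_Icc] at hv; omega
  have hleN : ∀ v ∈ Finset.Icc 1 N, v ≤ N := fun v hv => (Finset.mem_Icc.1 hv).2
  have hInj : Inj P (fun v p => v.factorization p) (Finset.Icc 1 N) := by
    intro v hv v' hv' hvv
    apply Nat.eq_of_factorization_eq (hne v hv) (hne v' hv')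
    intro p
    by_cases hp : p ∈ P
    · exact hvv p hp
    · have : ∀ v ∈ Finset.Icc 1 N, v.factorization p = 0 := by
        intro v hv
        by_contra h0
        have h1 : p ∈ v.primeFactors := by
          rw [← Nat.support_factorization, Finsupp.mem_support_iff]; exact h0
        rw [Nat.mem_primeFactors] at h1
        apply hp
        rw [hPd, Finset.mem_filter, Finset.mem_Icc]
        exact ⟨⟨h1.1.one_lt.le, (Nat.le_of_dvd (Nat.pos_of_ne_zero h1.2.2) h1.2.1).trans (hleN v hv)⟩, h1.1⟩
      rw [this v hv, this v' hv']
  have hB := h u hu0 hu1 (fun v p => v.factorization p) P hP hus (Finset.Icc 1 N) (Finset.Icc 1 N)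
    (fun v => ψ v / c) (fun v => ψ v / c) (fun v => div_nonneg (hψ v) hc.le)
    (fun v => div_nonneg (hψ v) hc.le) hInj hInj
  have hmu : ∀ v ∈ Finset.Icc 1 N, mu P (fun v p => v.factorization p) (fun v => ψ v / c) v = lam ψ v / (2 * c) := by
    intro v hv
    unfold mu lam
    rw [prod_hp (hne v hv) (hleN v hv)]
    field_simp
  set M := ∑ n ∈ Finset.Icc 1 N, lam ψ n with hM
  have hM0 : 0 ≤ M := Finset.sum_nonneg fun n _ => by
    unfold lam; have := hψ n; positivity
  have hMM : MM P (fun v p => v.factorization p) (fun v => ψ v / c) (Finset.Icc 1 N) = M / (2 * c) := by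
    unfold MM
    rw [Finset.sum_congr rfl hmu, ← Finset.sum_div]
  have hterm : ∀ v ∈ Finset.Icc 1 N, ∀ w ∈ Finset.Icc 1 N,
      term P (fun v p => v.factorization p) (fun p => Real.exp (u p)) (fun v => ψ v / c) (fun v => ψ v / c) v w =
      1 / (2 * c) ^ 2 * (if (w : ℝ) * ψ v ≤ c * v.gcd w ∧ (v : ℝ) * ψ w ≤ c * v.gcd w then
        lam ψ v * lam ψ w * Real.exp (t * LL t v w) else 0) := by
    intro v hv w hw
    have hg : (0 : ℝ) < v.gcd w := by
      exact_mod_cast Nat.gcd_pos_of_pos_right _ (Nat.pos_of_ne_zero (hne w hw))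
    have hc' : cond P (fun v p => v.factorization p) (fun v => ψ v / c) (fun v => ψ v / c) v w ↔
        ((w : ℝ) * ψ v ≤ c * v.gcd w ∧ (v : ℝ) * ψ w ≤ c * v.gcd w) := by
      unfold cond
      rw [prod_fact v (hne v hv) (hne w hw) (hleN w hw), prod_fact w (hne w hw) (hne v hv) (hleN v hv),
        Nat.gcd_comm w v, div_mul_div_comm, div_mul_div_comm, div_le_one (by positivity),
        div_le_one (by positivity), mul_comm (w : ℝ), mul_comm (v : ℝ)]
    unfold term
    by_cases hcc : cond P (fun v p => v.factorization p) (fun v => ψ v / c) (fun v => ψ v / c) v w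
    · rw [if_pos hcc, if_pos (hc'.1 hcc), hmu v hv, hmu w hw, wt_eq]
      have : ∑ p ∈ P, (if v.factorization p ≠ w.factorization p then u p else 0) = t * LL t v w := by
        unfold LL
        rw [Finset.mul_sum, ← Finset.sum_filter]
        simp only [hu]
        rw [← Finset.sum_filter]
        apply Finset.sum_congr
        · ext p
          simp only [Finset.mem_filter, mem_dp (hne v hv) (hne w hw), hPd, Finset.mem_Icc]
          constructor
          · rintro ⟨⟨⟨⟨_, _⟩, h3⟩, h4⟩, h5⟩; exact ⟨⟨h3, h4⟩, h5⟩
          · rintro ⟨⟨h3, h4⟩, h5⟩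
            refine ⟨⟨⟨⟨h3.one_lt.le, ?_⟩, h3⟩, h4⟩, h5⟩
            by_contra hpN
            apply h4
            rw [Nat.factorization_eq_zero_of_lt, Nat.factorization_eq_zero_of_lt]
            · have := hleN w hw; omega
            · have := hleN v hv; omega
        · intro p _; ring
      rw [this]
      field_simp
    · rw [if_neg hcc, if_neg (fun h' => hcc (hc'.2 h')), mul_zero]
  unfold BB at hB
  rw [Finset.sum_congr rfl (fun v hv => Finset.sum_congr rfl (fun w hw => hterm v hv w hw)), hMM] at hB
  simp_rw [← Finset.mul_sum] at hB
  rw [one_div_mul_eq_div, div_le_iff₀ (by positivity)] at hB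
  refine hB.trans ?_
  have hx : 0 ≤ M / (2 * c) := by positivity
  have e6 : (rt (M / (2 * c)) * rt (M / (2 * c))) ^ 3 = M / (2 * c) * Real.sqrt (M / (2 * c)) := by
    calc (rt (M / (2 * c)) * rt (M / (2 * c))) ^ 3 = rt (M / (2 * c)) ^ 4 * rt (M / (2 * c)) ^ 2 := by ring
      _ = _ := by
        rw [rt_pow hx]; congr 1
        unfold rt; rw [Real.sq_sqrt (Real.sqrt_nonneg _)]
  rw [e6]
  have h7 : Real.sqrt (M / (2 * c)) ≤ Real.sqrt M / Real.sqrt c := by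
    rw [← Real.sqrt_div hM0]
    apply Real.sqrt_le_sqrt
    apply div_le_div_of_nonneg_left hM0 hc; linarith
  have hsc : 0 < Real.sqrt c := Real.sqrt_pos.2 hc
  have hsc2 : c = Real.sqrt c * Real.sqrt c := (Real.mul_self_sqrt hc.le).symm
  calc C * (M / (2 * c) * Real.sqrt (M / (2 * c))) * (2 * c) ^ 2
      ≤ C * (M / (2 * c) * (Real.sqrt M / Real.sqrt c)) * (2 * c) ^ 2 := by gcongr
    _ = 2 * (C * M * Real.sqrt M) * (c / Real.sqrt c) := by field_simp
    _ = 2 * (C * M * Real.sqrt M) * Real.sqrt c := by rw [Real.div_sqrt]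
    _ ≤ _ := by
      have : 0 ≤ C * M * Real.sqrt M * Real.sqrt c := by positivity
      nlinarith

end QDS

namespace QDS

/-- length of the intersection of two intervals of half-lengths `a ≤ b` with centres at distance `x` -/
noncomputable def ww (a b x : ℝ) : ℝ := max 0 (a + b - x) - max 0 (b - a - x)

noncomputable def wP (a b x : ℝ) : ℝ :=
  2 * a * b - (max 0 (a + b - x) ^ 2 - max 0 (b - a - x) ^ 2) / 2

lemma ww_nonneg {a : ℝ} (ha : 0 ≤ a) (b x : ℝ) : 0 ≤ ww a b x := by
  unfold ww
  rw [sub_nonneg]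
  exact max_le_max le_rfl (by linarith)

lemma ww_zero {a b x : ℝ} (ha : 0 ≤ a) (h : a + b ≤ x) : ww a b x = 0 := by
  unfold ww
  rw [max_eq_left (by linarith), max_eq_left (by linarith)]; ring

lemma ww_at_zero {a b : ℝ} (ha : 0 ≤ a) (h : a ≤ b) : ww a b 0 = 2 * a := by
  unfold ww
  rw [max_eq_right (by linarith), max_eq_right (by linarith)]; ring

lemma wP_zero {a b : ℝ} (ha : 0 ≤ a) (h : a ≤ b) : wP a b 0 = 0 := by
  unfold wP
  rw [max_eq_right (by linarith), max_eq_right (by linarith)]; ring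

lemma wP_big {a b x : ℝ} (ha : 0 ≤ a) (h : a + b ≤ x) : wP a b x = 2 * a * b := by
  unfold wP
  rw [max_eq_left (by linarith), max_eq_left (by linarith)]; ring

lemma wP_le {a : ℝ} (ha : 0 ≤ a) (b x : ℝ) : wP a b x ≤ 2 * a * b := by
  unfold wP
  have h1 : max 0 (b - a - x) ≤ max 0 (a + b - x) := max_le_max le_rfl (by linarith)
  have h0 : 0 ≤ max 0 (b - a - x) := le_max_left _ _
  nlinarith

lemma wP_lower {a h : ℝ} (ha : 0 ≤ a) (hh : 0 ≤ h) (b x : ℝ) :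
    h * ww a b (x + h) ≤ wP a b (x + h) - wP a b x := by
  unfold wP ww
  rcases le_total 0 (b - a - x) with h1 | h1 <;> rcases le_total 0 (b - a - (x + h)) with h2 | h2 <;>
  rcases le_total 0 (a + b - x) with h3 | h3 <;> rcases le_total 0 (a + b - (x + h)) with h4 | h4 <;>
  simp only [max_eq_left, max_eq_right, h1, h2, h3, h4] <;> nlinarith

lemma wP_upper {a h : ℝ} (ha : 0 ≤ a) (hh : 0 ≤ h) (b x : ℝ) :
    wP a b (x + h) - wP a b x ≤ h * ww a b x := by
  unfold wP ww
  rcases le_total 0 (b - a - x) with h1 | h1 <;> rcases le_total 0 (b - a - (x + h)) with h2 | h2 <;>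
  rcases le_total 0 (a + b - x) with h3 | h3 <;> rcases le_total 0 (a + b - (x + h)) with h4 | h4 <;>
  simp only [max_eq_left, max_eq_right, h1, h2, h3, h4] <;> nlinarith

lemma ww_sum_le {a b h : ℝ} (ha : 0 ≤ a) (hab : a ≤ b) (hh : 0 < h) (n : ℕ) :
    ∑ i ∈ Finset.range n, ww a b ((i + 1 : ℕ) * h) ≤ 2 * a * b / h := by
  have key : h * ∑ i ∈ Finset.range n, ww a b ((i + 1 : ℕ) * h) ≤ wP a b (n * h) := by
    induction n with
    | zero => simp [wP_zero ha hab]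
    | succ n ih =>
      rw [Finset.sum_range_succ, mul_add]
      have := wP_lower ha hh.le b (n * h)
      rw [show (n : ℝ) * h + h = ((n + 1 : ℕ) : ℝ) * h by push_cast; ring] at this
      linarith
  rw [le_div_iff₀ hh, mul_comm]
  exact key.trans (wP_le ha _ _)

lemma ww_sum_ge {a b h : ℝ} (ha : 0 ≤ a) (hab : a ≤ b) (hh : 0 < h) (n : ℕ) (hn : a + b ≤ (n + 1 : ℕ) * h) :
    2 * a * b / h - 2 * a ≤ ∑ i ∈ Finset.range n, ww a b ((i + 1 : ℕ) * h) := by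
  have key : ∀ n : ℕ, wP a b (n * h) ≤ h * ∑ i ∈ Finset.range n, ww a b (i * h) := by
    intro n
    induction n with
    | zero => simp [wP_zero ha hab]
    | succ n ih =>
      rw [Finset.sum_range_succ, mul_add]
      have := wP_upper ha hh.le b (n * h)
      rw [show (n : ℝ) * h + h = ((n + 1 : ℕ) : ℝ) * h by push_cast; ring] at this
      linarith
  have k := key (n + 1)
  rw [wP_big ha hn, Finset.sum_range_succ'] at k
  simp only [Nat.cast_zero, zero_mul, ww_at_zero ha hab] at k
  rw [sub_le_iff_le_add, div_le_iff₀ hh, mul_comm _ h]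
  exact k

lemma sum_mult (K d : ℕ) (hd : 1 ≤ d) (f : ℕ → ℝ) :
    ∑ k ∈ (Finset.Icc 1 K).filter (fun k => d ∣ k), f k = ∑ i ∈ Finset.range (K / d), f ((i + 1) * d) := by
  symm
  apply Finset.sum_bij (fun i _ => (i + 1) * d)
  · intro i hi
    rw [Finset.mem_range] at hi
    rw [Finset.mem_filter, Finset.mem_Icc]
    refine ⟨⟨Nat.mul_pos (by omega) hd, ?_⟩, Dvd.intro_left _ rfl⟩
    exact (Nat.le_div_iff_mul_le hd).1 hi
  · intro i _ j _ h
    have := Nat.eq_of_mul_eq_mul_right hd h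
    omega
  · intro k hk
    rw [Finset.mem_filter, Finset.mem_Icc] at hk
    obtain ⟨⟨h1, h2⟩, c, rfl⟩ := hk
    have hc : 1 ≤ c := by
      rcases Nat.eq_zero_or_pos c with h | h
      · subst h; simp at h1
      · exact h
    refine ⟨c - 1, ?_, ?_⟩
    · rw [Finset.mem_range, Nat.lt_div_iff_mul_lt hd]
      have : d * c = d * (c - 1) + d := by
        obtain ⟨c, rfl⟩ := Nat.exists_eq_add_of_le hc
        simp; ring
      rw [mul_comm (c-1)]; omega
    · rw [Nat.sub_add_cancel hc, mul_comm]
  · intro i _; rfl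

/-- the two-sided estimate for sums over multiples of `d` -/
lemma W_bounds {a b L : ℝ} (ha : 0 ≤ a) (hab : a ≤ b) (hL : 0 < L) (K d : ℕ) (hd : 1 ≤ d)
    (hK : L * (a + b) ≤ K) :
    2 * a * b * L / d - 2 * a ≤ ∑ k ∈ (Finset.Icc 1 K).filter (fun k => d ∣ k), ww a b (k / L) ∧
    ∑ k ∈ (Finset.Icc 1 K).filter (fun k => d ∣ k), ww a b (k / L) ≤ 2 * a * b * L / d := by
  have hd0 : (0 : ℝ) < d := by exact_mod_cast hd
  have hh : 0 < (d : ℝ) / L := by positivity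
  have e1 : 2 * a * b * L / d = 2 * a * b / ((d : ℝ) / L) := by field_simp
  have e2 : ∀ i : ℕ, (((i + 1) * d : ℕ) : ℝ) / L = (i + 1 : ℕ) * ((d : ℝ) / L) := by
    intro i; push_cast; ring
  rw [sum_mult K d hd (fun k => ww a b (k / L)), e1]
  simp_rw [e2]
  refine ⟨ww_sum_ge ha hab hh _ ?_, ww_sum_le ha hab hh _⟩
  have h1 : K < (K / d + 1) * d := by
    have := Nat.lt_div_mul_add (a := K) hd
    rw [add_mul]; linarith
  have h2 : (K : ℝ) < ((K / d + 1 : ℕ) : ℝ) * d := by exact_mod_cast h1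
  rw [← mul_div_assoc, le_div_iff₀ hL]
  linarith

lemma inter_le {δ ε : ℝ} (hδ : 0 ≤ δ) (hε : 0 ≤ ε) (x y : ℝ) :
    min (x + δ) (y + ε) - max (x - δ) (y - ε) ≤ ww (min δ ε) (max δ ε) |x - y| := by
  unfold ww
  have h1 : min δ ε + max δ ε = δ + ε := min_add_max δ ε
  have a1 := min_le_left (x + δ) (y + ε)
  have a2 := min_le_right (x + δ) (y + ε)
  have a3 := le_max_left (x - δ) (y - ε)
  have a4 := le_max_right (x - δ) (y - ε)
  rw [h1]
  have m1 := le_max_right 0 (δ + ε - |x - y|)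
  have m0 := le_max_left 0 (δ + ε - |x - y|)
  have hm : min (x + δ) (y + ε) - max (x - δ) (y - ε) ≤ 2 * min δ ε := by
    rcases le_total δ ε with h | h
    · rw [min_eq_left h]; linarith
    · rw [min_eq_right h]; linarith
  have hd : min (x + δ) (y + ε) - max (x - δ) (y - ε) ≤ δ + ε - |x - y| := by
    rcases abs_cases (x - y) with h | h <;> linarith
  rcases le_total 0 (max δ ε - min δ ε - |x - y|) with h | h
  · rw [max_eq_right h]; linarith
  · rw [max_eq_left h]; linarith

end QDS

namespace QDS

lemma sieve_core (a b : ℕ → ℝ) (W : ℕ → ℝ) (K : ℕ) (Y W0 : ℝ)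
    (hV : ∀ d : ℕ, 1 ≤ d → Y / d - W0 ≤ ∑ k ∈ (Finset.Icc 1 K).filter (fun k => d ∣ k), W k ∧
      ∑ k ∈ (Finset.Icc 1 K).filter (fun k => d ∣ k), W k ≤ Y / d)
    (Q : Finset ℕ) (hQ : ∀ p ∈ Q, p.Prime ∧ 0 ≤ a p ∧ 0 ≤ b p ∧ a p + b p / p = 1) :
    ∀ d : ℕ, 1 ≤ d → (∀ p ∈ Q, ¬ p ∣ d) →
      Y / d - W0 * ∏ p ∈ Q, (a p + b p) ≤ ∑ k ∈ (Finset.Icc 1 K).filter (fun k => d ∣ k),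
        (∏ p ∈ Q, (a p + if p ∣ k then b p else 0)) * W k ∧
      ∑ k ∈ (Finset.Icc 1 K).filter (fun k => d ∣ k),
        (∏ p ∈ Q, (a p + if p ∣ k then b p else 0)) * W k ≤ Y / d := by
  induction Q using Finset.induction_on with
  | empty => intro d hd _; simpa using hV d hd
  | insert p Q hpQ ih =>
    intro d hd hQd
    have ih := ih (fun q hq => hQ q (Finset.mem_insert_of_mem hq))
    obtain ⟨pp, ha, hb, hab⟩ := hQ p (Finset.mem_insert_self _ _)
    have hpd : ¬ p ∣ d := hQd p (Finset.mem_insert_self _ _)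
    have h1 := ih d hd (fun q hq => hQd q (Finset.mem_insert_of_mem hq))
    have h2 := ih (d * p) (Nat.mul_pos hd pp.pos) (fun q hq h => by
      have hqp := (hQ q (Finset.mem_insert_of_mem hq)).1
      rcases hqp.dvd_mul.1 h with h | h
      · exact hQd q (Finset.mem_insert_of_mem hq) h
      · rw [(Nat.prime_dvd_prime_iff_eq hqp pp).1 h] at hq
        exact hpQ hq)
    set G : ℕ → ℝ := fun k => (∏ p ∈ Q, (a p + if p ∣ k then b p else 0)) * W k with hG
    have e : ∑ k ∈ (Finset.Icc 1 K).filter (fun k => d ∣ k),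
        (∏ p ∈ insert p Q, (a p + if p ∣ k then b p else 0)) * W k
        = a p * ∑ k ∈ (Finset.Icc 1 K).filter (fun k => d ∣ k), G k
          + b p * ∑ k ∈ (Finset.Icc 1 K).filter (fun k => d * p ∣ k), G k := by
      have : (Finset.Icc 1 K).filter (fun k => d * p ∣ k)
          = ((Finset.Icc 1 K).filter (fun k => d ∣ k)).filter (fun k => p ∣ k) := by
        ext k
        simp only [Finset.mem_filter, and_assoc]
        have hc : Nat.Coprime d p := ((Nat.Prime.coprime_iff_not_dvd pp).2 hpd).symm
        constructor
        · rintro ⟨h, h'⟩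
          exact ⟨h, (dvd_mul_right d p).trans h', (dvd_mul_left p d).trans h'⟩
        · rintro ⟨h, h', h''⟩
          exact ⟨h, hc.mul_dvd_of_dvd_of_dvd h' h''⟩
      rw [this, Finset.sum_filter (p := fun k => p ∣ k), Finset.mul_sum, Finset.mul_sum,
        ← Finset.sum_add_distrib]
      refine Finset.sum_congr rfl fun k _ => ?_
      rw [Finset.prod_insert hpQ, hG]
      simp only
      split_ifs <;> ring
    rw [e, Finset.prod_insert hpQ]
    have hp0 : (0:ℝ) < p := by exact_mod_cast pp.pos
    have hd0 : (0:ℝ) < d := by exact_mod_cast hd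
    have e2 : Y / d = a p * (Y / d) + b p * (Y / (d * p : ℕ)) := by
      have : a p * (Y / d) + b p * (Y / (d * p : ℕ)) = Y / d * (a p + b p / p) := by
        push_cast; field_simp
      rw [this, hab, mul_one]
    constructor
    · have := mul_le_mul_of_nonneg_left h1.1 ha
      have := mul_le_mul_of_nonneg_left h2.1 hb
      rw [e2]
      nlinarith
    · rw [e2]
      exact add_le_add (mul_le_mul_of_nonneg_left h1.2 ha) (mul_le_mul_of_nonneg_left h2.2 hb)

lemma bonf (P : Finset ℕ) (r : ℕ) : (if P = ∅ then (1:ℝ) else 0) ≤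
    ∑ s ∈ P.powerset, if s.card ≤ 2 * r then (-1 : ℝ) ^ s.card else 0 := by
  rw [Finset.sum_powerset_apply_card (f := fun m => if m ≤ 2 * r then (-1 : ℝ) ^ m else 0)]
  split_ifs with h
  · subst h; simp
  · obtain ⟨n, hn⟩ : ∃ n, P.card = n + 1 := ⟨P.card - 1, by
      have := Finset.card_pos.2 (Finset.nonempty_iff_ne_empty.2 h); omega⟩
    have key := @Int.alternating_sum_range_choose_eq_choose n (2 * r)
    have key2 : ∑ k ∈ Finset.range (2 * r + 1), ((-1 : ℝ) ^ k * (n + 1).choose k) = n.choose (2 * r) := by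
      have := congrArg (fun z : ℤ => (z : ℝ)) key
      push_cast at this
      rw [this]; simp
    have e : ∑ m ∈ Finset.range (P.card + 1), P.card.choose m • (if m ≤ 2 * r then (-1 : ℝ) ^ m else 0)
       = ∑ k ∈ Finset.range (2 * r + 1), ((-1 : ℝ) ^ k * (n + 1).choose k) := by
      rw [hn]
      have h1 : ∀ m, (n+1).choose m • (if m ≤ 2 * r then (-1 : ℝ) ^ m else 0)
        = if m ∈ Finset.range (2 * r + 1) then (-1 : ℝ) ^ m * (n + 1).choose m else 0 := by
        intro m
        simp only [Finset.mem_range, Nat.lt_succ_iff, nsmul_eq_mul]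
        split_ifs <;> ring
      simp_rw [h1]
      rw [Finset.sum_ite_mem]
      refine Finset.sum_subset Finset.inter_subset_right ?_
      intro m hm hm'
      have : n + 1 < m := by
        simp only [Finset.mem_inter, Finset.mem_range] at hm hm'
        omega
      rw [Nat.choose_eq_zero_of_lt this]; simp
    rw [e, key2]
    positivity

lemma sieve (a b : ℕ → ℝ) (W : ℕ → ℝ) (hW : ∀ k, 0 ≤ W k) (K : ℕ) (Y W0 : ℝ) (hY : 0 ≤ Y)
    (hW0 : 0 ≤ W0)
    (hV : ∀ d : ℕ, 1 ≤ d → Y / d - W0 ≤ ∑ k ∈ (Finset.Icc 1 K).filter (fun k => d ∣ k), W k ∧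
      ∑ k ∈ (Finset.Icc 1 K).filter (fun k => d ∣ k), W k ≤ Y / d)
    (Q : Finset ℕ) (hQ : ∀ p ∈ Q, p.Prime ∧ 0 ≤ a p ∧ 0 ≤ b p ∧ a p + b p / p = 1)
    (Q1 : Finset ℕ) (hQ1 : ∀ p ∈ Q1, p.Prime) (hdis : ∀ p ∈ Q1, p ∉ Q) (r : ℕ) :
    ∑ k ∈ Finset.Icc 1 K, (if ∀ p ∈ Q1, ¬ p ∣ k then
        (∏ p ∈ Q, (a p + if p ∣ k then b p else 0)) * W k else 0) ≤
      Y * (∏ p ∈ Q1, (1 - 1 / (p:ℝ)) + (∏ p ∈ Q1, (1 + 2 / (p:ℝ))) / 2 ^ (2 * r)) +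
      W0 * (∏ p ∈ Q, (a p + b p)) * (Q1.powerset.filter (fun s => s.card ≤ 2 * r)).card := by
  set G : ℕ → ℝ := fun k => (∏ p ∈ Q, (a p + if p ∣ k then b p else 0)) * W k with hG
  have hG0 : ∀ k, 0 ≤ G k := by
    intro k
    refine mul_nonneg (Finset.prod_nonneg fun p hp => ?_) (hW k)
    have := hQ p hp
    split_ifs <;> linarith [this.2.1, this.2.2.1]
  have hB0 : 0 ≤ W0 * ∏ p ∈ Q, (a p + b p) := by
    refine mul_nonneg hW0 (Finset.prod_nonneg fun p hp => ?_)
    have := hQ p hp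
    linarith [this.2.1, this.2.2.1]
  set B := W0 * ∏ p ∈ Q, (a p + b p) with hB
  -- step 1
  have s1 : ∑ k ∈ Finset.Icc 1 K, (if ∀ p ∈ Q1, ¬ p ∣ k then G k else 0) ≤
      ∑ s ∈ Q1.powerset.filter (fun s => s.card ≤ 2 * r), (-1 : ℝ) ^ s.card *
        ∑ k ∈ (Finset.Icc 1 K).filter (fun k => (∏ p ∈ s, p) ∣ k), G k := by
    simp_rw [Finset.mul_sum, Finset.sum_filter]
    have : ∑ s ∈ Q1.powerset, (if s.card ≤ 2 * r then ∑ k ∈ Finset.Icc 1 K,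
        (if (∏ p ∈ s, p) ∣ k then (-1 : ℝ) ^ s.card * G k else 0) else 0)
        = ∑ k ∈ Finset.Icc 1 K, ∑ s ∈ Q1.powerset, (if s.card ≤ 2 * r then
        (if (∏ p ∈ s, p) ∣ k then (-1 : ℝ) ^ s.card * G k else 0) else 0) := by
      rw [Finset.sum_comm]
      refine Finset.sum_congr rfl fun s _ => ?_
      split_ifs <;> simp
    rw [this]
    refine Finset.sum_le_sum fun k hk => ?_
    have hb := bonf (Q1.filter (fun p => p ∣ k)) r
    have e1 : ∑ s ∈ Q1.powerset, (if s.card ≤ 2 * r then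
        (if (∏ p ∈ s, p) ∣ k then (-1 : ℝ) ^ s.card * G k else 0) else 0)
        = (∑ s ∈ (Q1.filter (fun p => p ∣ k)).powerset,
          if s.card ≤ 2 * r then (-1 : ℝ) ^ s.card else 0) * G k := by
      have h2 : (Q1.filter (fun p => p ∣ k)).powerset
          = Q1.powerset.filter (fun s => (∏ p ∈ s, p) ∣ k) := by
        ext s
        simp only [Finset.mem_powerset, Finset.mem_filter]
        constructor
        · intro h
          refine ⟨h.trans (Finset.filter_subset _ _), ?_⟩
          exact Finset.prod_primes_dvd k (fun p hp => (hQ1 p (Finset.mem_filter.1 (h hp)).1).prime)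
            (fun p hp => (Finset.mem_filter.1 (h hp)).2)
        · rintro ⟨h, h'⟩ p hp
          exact Finset.mem_filter.2 ⟨h hp, (Finset.dvd_prod_of_mem _ hp).trans h'⟩
      rw [h2, Finset.sum_filter, Finset.sum_mul]
      refine Finset.sum_congr rfl fun s _ => ?_
      split_ifs <;> simp
    rw [e1]
    have e2 : (if ∀ p ∈ Q1, ¬ p ∣ k then G k else 0)
        = (if Q1.filter (fun p => p ∣ k) = ∅ then (1:ℝ) else 0) * G k := by
      simp only [Finset.filter_eq_empty_iff]
      split_ifs <;> simp
    rw [e2]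
    exact mul_le_mul_of_nonneg_right hb (hG0 k)
  -- step 2
  have s2 : ∀ s ∈ Q1.powerset.filter (fun s => s.card ≤ 2 * r), (-1 : ℝ) ^ s.card *
        ∑ k ∈ (Finset.Icc 1 K).filter (fun k => (∏ p ∈ s, p) ∣ k), G k
        ≤ (-1 : ℝ) ^ s.card * (Y / ∏ p ∈ s, (p : ℝ)) + B := by
    intro s hs
    have hsQ : s ⊆ Q1 := Finset.mem_powerset.1 (Finset.mem_filter.1 hs).1
    have hc := sieve_core a b W K Y W0 hV Q hQ (∏ p ∈ s, p)
      (Finset.prod_pos fun p hp => (hQ1 p (hsQ hp)).pos) (by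
        intro p hp h
        have pp := (hQ p hp).1
        obtain ⟨q, hq, hpq⟩ := (pp.prime.dvd_finset_prod_iff _).1 h
        have : p = q := (Nat.prime_dvd_prime_iff_eq pp (hQ1 q (hsQ hq))).1 hpq
        exact hdis q (hsQ hq) (this ▸ hp))
    push_cast at hc
    rcases neg_one_pow_eq_or ℝ s.card with h | h
    · rw [h]; linarith [hc.2]
    · rw [h]; linarith [hc.1]
  refine s1.trans ((Finset.sum_le_sum s2).trans ?_)
  rw [Finset.sum_add_distrib, Finset.sum_const, nsmul_eq_mul, mul_comm _ B]
  have s3 : ∑ s ∈ Q1.powerset.filter (fun s => s.card ≤ 2 * r),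
      (-1 : ℝ) ^ s.card * (1 / ∏ p ∈ s, (p : ℝ)) ≤
      ∏ p ∈ Q1, (1 - 1 / (p:ℝ)) + (∏ p ∈ Q1, (1 + 2 / (p:ℝ))) / 2 ^ (2 * r) := by
    have p1 : ∏ p ∈ Q1, (1 - 1 / (p:ℝ)) = ∑ s ∈ Q1.powerset, (-1 : ℝ) ^ s.card * (1 / ∏ p ∈ s, (p : ℝ)) := by
      have := Finset.prod_add (fun p : ℕ => -(1 / (p:ℝ))) (fun _ => (1:ℝ)) Q1
      simp only [Finset.prod_const_one, mul_one] at this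
      rw [show (∏ p ∈ Q1, (1 - 1 / (p:ℝ))) = ∏ p ∈ Q1, (-(1 / (p:ℝ)) + 1) from
        Finset.prod_congr rfl fun _ _ => by ring, this]
      refine Finset.sum_congr rfl fun s _ => ?_
      rw [Finset.prod_neg]; simp
    have p2 : ∏ p ∈ Q1, (1 + 2 / (p:ℝ)) = ∑ s ∈ Q1.powerset, (2 : ℝ) ^ s.card * (1 / ∏ p ∈ s, (p : ℝ)) := by
      have := Finset.prod_add (fun p : ℕ => 2 / (p:ℝ)) (fun _ => (1:ℝ)) Q1
      simp only [Finset.prod_const_one, mul_one] at this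
      rw [show (∏ p ∈ Q1, (1 + 2 / (p:ℝ))) = ∏ p ∈ Q1, (2 / (p:ℝ) + 1) from
        Finset.prod_congr rfl fun _ _ => by ring, this]
      refine Finset.sum_congr rfl fun s _ => ?_
      rw [Finset.prod_div_distrib]; simp [div_eq_mul_inv]
    rw [p1, p2, Finset.sum_filter, Finset.sum_div, ← Finset.sum_add_distrib]
    refine Finset.sum_le_sum fun s _ => ?_
    have hs0 : (0:ℝ) ≤ 1 / ∏ p ∈ s, (p : ℝ) := by positivity
    split_ifs with h
    · have : (0:ℝ) ≤ 2 ^ s.card * (1 / ∏ p ∈ s, (p:ℝ)) / 2 ^ (2 * r) := by positivity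
      linarith
    · have h1 : (1:ℝ) ≤ 2 ^ s.card / 2 ^ (2 * r) := by
        rw [one_le_div (by positivity)]
        exact pow_le_pow_right₀ (by norm_num) (by omega)
      have h2 : (2:ℝ) ^ s.card * (1 / ∏ p ∈ s, (p:ℝ)) / 2 ^ (2 * r)
          = (2 ^ s.card / 2 ^ (2 * r)) * (1 / ∏ p ∈ s, (p:ℝ)) := by ring
      rw [h2, ← add_mul]
      refine mul_nonneg ?_ hs0
      rcases neg_one_pow_eq_or ℝ s.card with h | h <;> rw [h] <;> linarith
  have s4 : ∑ s ∈ Q1.powerset.filter (fun s => s.card ≤ 2 * r),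
      (-1 : ℝ) ^ s.card * (Y / ∏ p ∈ s, (p : ℝ)) = Y * ∑ s ∈ Q1.powerset.filter (fun s => s.card ≤ 2 * r),
      (-1 : ℝ) ^ s.card * (1 / ∏ p ∈ s, (p : ℝ)) := by
    rw [Finset.mul_sum]
    refine Finset.sum_congr rfl fun s _ => by ring
  rw [s4]
  gcongr

lemma card_small (Q : Finset ℕ) (T r : ℕ) (hT : 1 ≤ T) (h : Q.card ≤ T) :
    ((Q.powerset.filter (fun s => s.card ≤ 2 * r)).card : ℝ) ≤ 3 * (T:ℝ) ^ (2 * r) := by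
  have hT0 : (1:ℝ) ≤ T := by exact_mod_cast hT
  have h1 : ((Q.powerset.filter (fun s => s.card ≤ 2 * r)).card : ℝ)
      ≤ ∑ s ∈ Q.powerset, (T:ℝ) ^ (2 * r) * (1 / T) ^ s.card := by
    rw [Finset.card_filter]
    push_cast
    refine Finset.sum_le_sum fun s _ => ?_
    split_ifs with h
    · rw [div_pow, one_pow, mul_one_div, one_le_div (by positivity)]
      exact pow_le_pow_right₀ hT0 h
    · positivity
  refine h1.trans ?_
  rw [← Finset.mul_sum, mul_comm (3:ℝ)]
  gcongr
  have h2 := Finset.prod_add (fun _ : ℕ => 1 / (T:ℝ)) (fun _ => (1:ℝ)) Q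
  simp only [Finset.prod_const, one_pow, mul_one] at h2
  rw [← h2]
  have h3 : (1 / (T:ℝ) + 1) ^ Q.card ≤ Real.exp (1 / T) ^ Q.card := by
    gcongr
    exact Real.add_one_le_exp _
  refine h3.trans ?_
  rw [← Real.exp_nat_mul]
  have h4 : (Q.card : ℝ) * (1 / T) ≤ 1 := by
    rw [mul_one_div, div_le_one (by positivity)]; exact_mod_cast h
  refine (Real.exp_le_exp.2 h4).trans ?_
  linarith [Real.exp_one_lt_d9]

end QDS

namespace QDS

lemma crt_count (P : Finset ℕ) (hP : ∀ p ∈ P, p.Prime) (g : ℕ) (hg : (∏ p ∈ P, p) ∣ g)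
    (G : ℕ → Finset ℕ) :
    ((Finset.range g).filter (fun t => ∀ p ∈ P, t % p ∈ G p)).card
      ≤ (g / ∏ p ∈ P, p) * ∏ p ∈ P, (G p).card := by
  set R := ∏ p ∈ P, p with hR
  have hR0 : 0 < R := Finset.prod_pos fun p hp => (hP p hp).pos
  rw [← Finset.card_pi, ← Finset.card_range (g / R), ← Finset.card_product]
  refine Finset.card_le_card_of_injOn (fun t => (t / R, fun p _ => t % p)) ?_ ?_
  · intro t ht
    simp only [Finset.coe_filter, Finset.mem_range, Set.mem_ofPred_eq] at ht
    simp only [Finset.coe_product, Set.mem_prod, Finset.mem_coe, Finset.mem_range, Finset.mem_pi]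
    refine ⟨?_, ht.2⟩
    obtain ⟨c, rfl⟩ := hg
    rw [Nat.mul_div_cancel_left _ hR0]
    exact (Nat.div_lt_iff_lt_mul hR0).2 (by rw [mul_comm]; exact ht.1)
  · intro t _ t' _ h
    simp only [Prod.mk.injEq] at h
    have h2 : R ∣ ((t:ℤ) - t').natAbs := by
      refine Finset.prod_primes_dvd _ (fun p hp => (hP p hp).prime) fun p hp => ?_
      have h3 : t % p = t' % p := by
        have := congrFun (congrFun h.2 p) hp
        exact this
      have h4 : ((p:ℤ)) ∣ (t:ℤ) - t' := by
        have : t' ≡ t [MOD p] := h3.symm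
        exact this.dvd
      exact Int.natCast_dvd.1 h4
    have h5 : (R:ℤ) ∣ (t:ℤ) - t' := Int.natCast_dvd.2 h2
    have h6 : t' ≡ t [MOD R] := (Nat.modEq_iff_dvd).2 h5
    rw [← Nat.div_add_mod t R, ← Nat.div_add_mod t' R, h.1, h6.symm]

lemma excl {p : ℕ} (pp : p.Prime) (c d : ℤ) (hd : ¬ (p:ℤ) ∣ d) :
    ∃ u ∈ Finset.range p, (p:ℤ) ∣ c + u * d := by
  have : Fact p.Prime := ⟨pp⟩
  have hd' : (d : ZMod p) ≠ 0 := by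
    rw [Ne, ZMod.intCast_zmod_eq_zero_iff_dvd]; exact hd
  refine ⟨(-(c : ZMod p) / d).val, Finset.mem_range.2 (ZMod.val_lt _), ?_⟩
  rw [← ZMod.intCast_zmod_eq_zero_iff_dvd]
  push_cast
  rw [ZMod.natCast_val, ZMod.cast_id, div_mul_cancel₀ _ hd']
  ring

/-- admissible residues -/
def Gp (a0 β m' n' : ℤ) (p : ℕ) : Finset ℕ :=
  (Finset.range p).filter (fun u => ¬ (p:ℤ) ∣ a0 + u * m' ∧ ¬ (p:ℤ) ∣ β + u * n')

lemma Gp_card1 {p : ℕ} (pp : p.Prime) (a0 β m' n' : ℤ) (h : ¬ (p:ℤ) ∣ m' ∨ ¬ (p:ℤ) ∣ n') :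
    (Gp a0 β m' n' p).card ≤ p - 1 := by
  have : ∃ u ∈ Finset.range p, u ∉ Gp a0 β m' n' p := by
    rcases h with h | h
    · obtain ⟨u, hu, h⟩ := excl pp a0 m' h
      exact ⟨u, hu, fun h' => (Finset.mem_filter.1 h').2.1 h⟩
    · obtain ⟨u, hu, h⟩ := excl pp β n' h
      exact ⟨u, hu, fun h' => (Finset.mem_filter.1 h').2.2 h⟩
  obtain ⟨u, hu, h⟩ := this
  have h2 : Gp a0 β m' n' p ⊆ (Finset.range p).erase u := by
    intro v hv
    refine Finset.mem_erase.2 ⟨fun e => h (e ▸ hv), (Finset.mem_filter.1 hv).1⟩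
  have := Finset.card_le_card h2
  rwa [Finset.card_erase_of_mem hu, Finset.card_range] at this

lemma Gp_card2 {p : ℕ} (pp : p.Prime) (a0 β m' n' : ℤ) (hm : ¬ (p:ℤ) ∣ m') (hn : ¬ (p:ℤ) ∣ n')
    (hk : ¬ (p:ℤ) ∣ a0 * n' - β * m') :
    (Gp a0 β m' n' p).card ≤ p - 2 := by
  obtain ⟨u, hu, h⟩ := excl pp a0 m' hm
  obtain ⟨v, hv, h'⟩ := excl pp β n' hn
  have huv : u ≠ v := by
    rintro rfl
    apply hk
    have e : a0 * n' - β * m' = (a0 + u * m') * n' - (β + u * n') * m' := by ring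
    rw [e]
    exact dvd_sub (h.mul_right _) (h'.mul_right _)
  have h2 : Gp a0 β m' n' p ⊆ ((Finset.range p).erase u).erase v := by
    intro w hw
    have hw2 := (Finset.mem_filter.1 hw).2
    refine Finset.mem_erase.2 ⟨fun e => hw2.2 (e ▸ h'), Finset.mem_erase.2 ⟨fun e => hw2.1 (e ▸ h), 
      (Finset.mem_filter.1 hw).1⟩⟩
  have := Finset.card_le_card h2
  rwa [Finset.card_erase_of_mem (Finset.mem_erase.2 ⟨huv.symm, hv⟩), Finset.card_erase_of_mem hu,
    Finset.card_range, Nat.sub_sub] at this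

noncomputable def ap (p : ℕ) : ℝ := 1 - 1 / ((p:ℝ) - 1) ^ 2
noncomputable def bp (p : ℕ) : ℝ := p / ((p:ℝ) - 1) ^ 2

lemma ab_facts {p : ℕ} (pp : p.Prime) : 0 ≤ ap p ∧ 0 ≤ bp p ∧ ap p + bp p / p = 1 ∧
    ap p + bp p = 1 + 1 / ((p:ℝ) - 1) ∧ ap p ≤ 1 := by
  have h2 : (2:ℝ) ≤ p := by exact_mod_cast pp.two_le
  have h3 : (0:ℝ) < (p:ℝ) - 1 := by linarith
  unfold ap bp
  refine ⟨?_, by positivity, ?_, ?_, ?_⟩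
  · rw [sub_nonneg, div_le_one (by positivity)]; nlinarith
  · field_simp; ring
  · field_simp; ring
  · have : 0 ≤ 1 / ((p:ℝ) - 1) ^ 2 := by positivity
    linarith

/-- pairs -/
def prs (m n : ℕ) : Finset (ℕ × ℕ) :=
  ((Finset.range m) ×ˢ (Finset.range n)).filter (fun x => x.1.Coprime m ∧ x.2.Coprime n)

def kap (m n : ℕ) (x : ℕ × ℕ) : ℤ := (x.1 : ℤ) * (n / m.gcd n : ℕ) - (x.2 : ℤ) * (m / m.gcd n : ℕ)

def qq (m n : ℕ) : ℕ := (m / m.gcd n) * (n / m.gcd n)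

def P2 (m n : ℕ) : Finset ℕ := (m.gcd n).primeFactors.filter (fun p => ¬ p ∣ qq m n)

noncomputable def c0 (m n : ℕ) : ℝ := (m.gcd n : ℝ) *
  ∏ p ∈ (m.gcd n).primeFactors, (if p ∣ qq m n then (1 - 1 / (p:ℝ)) else (1 - 1 / (p:ℝ)) ^ 2)

lemma kap_coprime {m n : ℕ} (hm : 0 < m) (hn : 0 < n) {x : ℕ × ℕ} (hx : x ∈ prs m n) :
    Nat.Coprime (kap m n x).natAbs (qq m n) := by
  have hx := (Finset.mem_filter.1 hx).2
  have hc : Nat.Coprime (m / m.gcd n) (n / m.gcd n) :=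
    Nat.coprime_div_gcd_div_gcd (Nat.gcd_pos_of_pos_left _ hm)
  refine Nat.coprime_of_dvd fun p pp hpk hpq => ?_
  have hpk : (p:ℤ) ∣ kap m n x := Int.natCast_dvd.2 hpk
  unfold kap at hpk
  unfold qq at hpq
  rcases pp.dvd_mul.1 hpq with h | h
  · have h1 : (p:ℤ) ∣ (x.1 : ℤ) * (n / m.gcd n : ℕ) :=
      (dvd_sub_left ((Int.natCast_dvd_natCast.2 h).mul_left _)).1 hpk
    have h1 : p ∣ x.1 * (n / m.gcd n) := by exact_mod_cast h1
    rcases pp.dvd_mul.1 h1 with h2 | h2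
    · exact Nat.not_coprime_of_dvd_of_dvd pp.one_lt h2 (h.trans (Nat.div_dvd_of_dvd (Nat.gcd_dvd_left _ _))) hx.1
    · exact Nat.not_coprime_of_dvd_of_dvd pp.one_lt h h2 hc
  · have h1 : (p:ℤ) ∣ (x.2 : ℤ) * (m / m.gcd n : ℕ) :=
      (dvd_sub_right ((Int.natCast_dvd_natCast.2 h).mul_left _)).1 hpk
    have h1 : p ∣ x.2 * (m / m.gcd n) := by exact_mod_cast h1
    rcases pp.dvd_mul.1 h1 with h2 | h2
    · exact Nat.not_coprime_of_dvd_of_dvd pp.one_lt h2 (h.trans (Nat.div_dvd_of_dvd (Nat.gcd_dvd_right _ _))) hx.2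
    · exact Nat.not_coprime_of_dvd_of_dvd pp.one_lt h2 h hc

lemma cnt_le {m n : ℕ} (hm : 0 < m) (hn : 0 < n) (κ : ℤ) :
    (((prs m n).filter (fun x => kap m n x = κ)).card : ℝ) ≤
      c0 m n * ∏ p ∈ P2 m n, (ap p + if p ∣ κ.natAbs then bp p else 0) := by
  set g := m.gcd n with hg
  have hg0 : 0 < g := Nat.gcd_pos_of_pos_left _ hm
  have hpr : ∀ p ∈ g.primeFactors, p.Prime := fun p hp => Nat.prime_of_mem_primeFactors hp
  have hfac : ∀ p ∈ g.primeFactors, (0:ℝ) ≤ 1 - 1 / (p:ℝ) := by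
    intro p hp
    have : (1:ℝ) ≤ p := by exact_mod_cast (hpr p hp).pos
    rw [sub_nonneg, div_le_one (by linarith)]; exact this
  have hc0 : 0 ≤ c0 m n := by
    unfold c0
    refine mul_nonneg (by positivity) (Finset.prod_nonneg fun p hp => ?_)
    have := hfac p hp
    split_ifs <;> positivity
  have hP2 : ∀ p ∈ P2 m n, p.Prime := fun p hp => hpr p (Finset.mem_filter.1 hp).1
  rcases Finset.eq_empty_or_nonempty ((prs m n).filter (fun x => kap m n x = κ)) with he | ⟨y, hy⟩
  · rw [he]
    simp only [Finset.card_empty, Nat.cast_zero]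
    refine mul_nonneg hc0 (Finset.prod_nonneg fun p hp => ?_)
    have := ab_facts (hP2 p hp)
    split_ifs <;> linarith
  set m' := m / g with hm'
  set n' := n / g with hn'
  have em : m = m' * g := (Nat.div_mul_cancel (Nat.gcd_dvd_left _ _)).symm
  have en : n = n' * g := (Nat.div_mul_cancel (Nat.gcd_dvd_right _ _)).symm
  have hm'0 : 0 < m' := Nat.pos_of_ne_zero (by rintro h; rw [h] at em; omega)
  have hn'0 : 0 < n' := Nat.pos_of_ne_zero (by rintro h; rw [h] at en; omega)
  have hc : Nat.Coprime m' n' := Nat.coprime_div_gcd_div_gcd hg0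
  have hqq : qq m n = m' * n' := rfl
  have hkap : ∀ x, kap m n x = (x.1 : ℤ) * n' - (x.2:ℤ) * m' := fun x => rfl
  have hy2 := (Finset.mem_filter.1 hy).2
  rw [hkap] at hy2
  -- base point
  set a0 : ℤ := (y.1 : ℤ) - (y.1 / m' : ℕ) * m' with ha0
  set β : ℤ := (y.2 : ℤ) - (y.1 / m' : ℕ) * n' with hβ
  have hκ : a0 * n' - β * m' = κ := by rw [← hy2, ha0, hβ]; ring
  have hpar : ∀ x ∈ (prs m n).filter (fun x => kap m n x = κ),
      (x.1 : ℤ) = a0 + (x.1 / m' : ℕ) * m' ∧ (x.2 : ℤ) = β + (x.1 / m' : ℕ) * n' := by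
    intro x hx
    have hx2 := (Finset.mem_filter.1 hx).2
    rw [hkap] at hx2
    have h1 : ((x.1:ℤ) - y.1) * n' = ((x.2:ℤ) - y.2) * m' := by linarith
    have h2 : (m':ℤ) ∣ (x.1:ℤ) - y.1 := by
      have : (m':ℤ) ∣ ((x.1:ℤ) - y.1) * n' := h1 ▸ dvd_mul_left _ _
      exact IsCoprime.dvd_of_dvd_mul_right (Nat.isCoprime_iff_coprime.2 hc) this
    have h3 : y.1 ≡ x.1 [MOD m'] := Nat.modEq_iff_dvd.2 h2
    have h4 : (x.1:ℤ) = a0 + (x.1 / m' : ℕ) * m' := by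
      have e1 := Nat.div_add_mod x.1 m'
      have e2 := Nat.div_add_mod y.1 m'
      have e3 : x.1 % m' = y.1 % m' := h3.symm
      rw [ha0]
      have e1' : (x.1:ℤ) = m' * (x.1 / m' : ℕ) + (x.1 % m' : ℕ) := by exact_mod_cast e1.symm
      have e2' : (y.1:ℤ) = m' * (y.1 / m' : ℕ) + (y.1 % m' : ℕ) := by exact_mod_cast e2.symm
      rw [e3] at e1'
      linarith
    refine ⟨h4, ?_⟩
    have hm'1 : (m':ℤ) ≠ 0 := by exact_mod_cast hm'0.ne'
    apply mul_right_cancel₀ hm'1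
    have : (x.2:ℤ) * m' = x.1 * n' - κ := by linarith
    rw [this, h4, ← hκ]; ring
  have h1 : ((prs m n).filter (fun x => kap m n x = κ)).card ≤
      ((Finset.range g).filter (fun t => ∀ p ∈ g.primeFactors, t % p ∈ Gp a0 β m' n' p)).card := by
    refine Finset.card_le_card_of_injOn (fun x => x.1 / m') ?_ ?_
    · intro x hx
      have hx : x ∈ (prs m n).filter (fun x => kap m n x = κ) := hx
      obtain ⟨p1, p2⟩ := hpar x hx
      have hx1 := Finset.mem_filter.1 (Finset.mem_filter.1 hx).1
      have hx3 := Finset.mem_product.1 hx1.1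
      simp only [Finset.coe_filter, Finset.mem_range, Set.mem_ofPred_eq]
      refine ⟨(Nat.div_lt_iff_lt_mul hm'0).2 (by
        rw [mul_comm, ← em]; exact Finset.mem_range.1 hx3.1), fun p hp => ?_⟩
      have pp := hpr p hp
      have hpg := Nat.dvd_of_mem_primeFactors hp
      have hmod : (p:ℤ) ∣ ((x.1 / m' : ℕ) : ℤ) - ((x.1 / m' % p : ℕ):ℤ) :=
        (Nat.modEq_iff_dvd).1 (Nat.mod_modEq _ _)
      refine Finset.mem_filter.2 ⟨Finset.mem_range.2 (Nat.mod_lt _ pp.pos), fun h => ?_, fun h => ?_⟩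
      · have : (p:ℤ) ∣ (x.1:ℤ) := by
          rw [p1, show a0 + ((x.1 / m' : ℕ):ℤ) * m' = (a0 + ((x.1 / m' % p : ℕ):ℤ) * m')
            + (((x.1 / m' : ℕ) : ℤ) - ((x.1 / m' % p : ℕ):ℤ)) * m' by ring]
          exact dvd_add h (hmod.mul_right _)
        exact Nat.not_coprime_of_dvd_of_dvd pp.one_lt (Int.natCast_dvd_natCast.1 this)
          (hpg.trans (Nat.gcd_dvd_left _ _)) hx1.2.1
      · have : (p:ℤ) ∣ (x.2:ℤ) := by
          rw [p2, show β + ((x.1 / m' : ℕ):ℤ) * n' = (β + ((x.1 / m' % p : ℕ):ℤ) * n')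
            + (((x.1 / m' : ℕ) : ℤ) - ((x.1 / m' % p : ℕ):ℤ)) * n' by ring]
          exact dvd_add h (hmod.mul_right _)
        exact Nat.not_coprime_of_dvd_of_dvd pp.one_lt (Int.natCast_dvd_natCast.1 this)
          (hpg.trans (Nat.gcd_dvd_right _ _)) hx1.2.2
    · intro x hx z hz h
      obtain ⟨p1, p2⟩ := hpar x hx
      obtain ⟨q1, q2⟩ := hpar z hz
      simp only at h
      rw [h] at p1 p2
      have e1 : x.1 = z.1 := by exact_mod_cast p1.trans q1.symm
      have e2 : x.2 = z.2 := by exact_mod_cast p2.trans q2.symm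
      exact Prod.ext e1 e2
  have hRg : (∏ p ∈ g.primeFactors, p) ∣ g := Nat.prod_primeFactors_dvd g
  have h2 := h1.trans (crt_count g.primeFactors hpr g hRg (Gp a0 β m' n'))
  have h3 : (((prs m n).filter (fun x => kap m n x = κ)).card : ℝ) ≤
      (g:ℝ) * ∏ p ∈ g.primeFactors, ((Gp a0 β m' n' p).card / (p:ℝ)) := by
    refine (Nat.cast_le.2 h2).trans (le_of_eq ?_)
    have hR0 : (∏ p ∈ g.primeFactors, (p:ℝ)) ≠ 0 :=
      Finset.prod_ne_zero_iff.2 fun p hp => by exact_mod_cast (hpr p hp).ne_zero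
    rw [Finset.prod_div_distrib]
    rw [Nat.cast_mul, Nat.cast_div hRg (by rw [Nat.cast_prod]; exact hR0), Nat.cast_prod, Nat.cast_prod]
    rw [div_mul_eq_mul_div, mul_div_assoc]
  refine h3.trans ?_
  unfold c0 P2
  rw [mul_assoc, Finset.prod_filter, ← Finset.prod_mul_distrib]
  refine mul_le_mul_of_nonneg_left ?_ (Nat.cast_nonneg _)
  refine Finset.prod_le_prod (fun p _ => div_nonneg (Nat.cast_nonneg _) (Nat.cast_nonneg _)) fun p hp => ?_
  have pp := hpr p hp
  have hp2 : (2:ℝ) ≤ p := by exact_mod_cast pp.two_le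
  have hp3 : (0:ℝ) < (p:ℝ) - 1 := by linarith
  have hor : ¬ (p:ℤ) ∣ (m':ℤ) ∨ ¬ (p:ℤ) ∣ (n':ℤ) := by
    by_contra hcon
    push Not at hcon
    exact Nat.not_coprime_of_dvd_of_dvd pp.one_lt (Int.natCast_dvd_natCast.1 hcon.1)
      (Int.natCast_dvd_natCast.1 hcon.2) hc
  have g1 : ((Gp a0 β m' n' p).card : ℝ) ≤ (p:ℝ) - 1 := by
    have := Gp_card1 pp a0 β m' n' hor
    have h' : ((Gp a0 β m' n' p).card : ℝ) ≤ ((p - 1 : ℕ) : ℝ) := by exact_mod_cast this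
    rwa [Nat.cast_sub pp.one_le, Nat.cast_one] at h'
  by_cases hpq : p ∣ qq m n
  · simp only [hpq, if_true, not_true, if_false, mul_one]
    rw [div_le_iff₀ (by linarith)]
    have : (1 - 1 / (p:ℝ)) * p = p - 1 := by field_simp
    rw [this]; exact g1
  · simp only [hpq, if_false, not_false_iff, if_true]
    by_cases hpk : p ∣ κ.natAbs
    · simp only [hpk, if_true]
      rw [(ab_facts pp).2.2.2.1, div_le_iff₀ (by linarith)]
      have : (1 - 1 / (p:ℝ)) ^ 2 * (1 + 1 / ((p:ℝ) - 1)) * p = p - 1 := by field_simp; ring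
      rw [this]; exact g1
    · simp only [hpk, if_false, add_zero]
      have g2 : ((Gp a0 β m' n' p).card : ℝ) ≤ (p:ℝ) - 2 := by
        have hm1 : ¬ p ∣ m' := fun h => hpq (hqq ▸ h.mul_right _)
        have hn1 : ¬ p ∣ n' := fun h => hpq (hqq ▸ h.mul_left _)
        have := Gp_card2 pp a0 β m' n' (fun h => hm1 (Int.natCast_dvd_natCast.1 h))
          (fun h => hn1 (Int.natCast_dvd_natCast.1 h))
          (fun h => hpk (by rw [hκ] at h; exact Int.natCast_dvd.1 h))
        have h' : ((Gp a0 β m' n' p).card : ℝ) ≤ ((p - 2 : ℕ) : ℝ) := by exact_mod_cast this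
        rwa [Nat.cast_sub pp.two_le, Nat.cast_ofNat] at h'
      rw [div_le_iff₀ (by linarith)]
      have : (1 - 1 / (p:ℝ)) ^ 2 * ap p * p = p - 2 := by unfold ap; field_simp; ring
      rw [this]; exact g2

end QDS

namespace QDS

lemma tot_prod (n U : ℕ) (hU : U ≠ 0) (hn : n ∣ U) :
    (Nat.totient n : ℝ) = n * ∏ p ∈ U.primeFactors, (if p ∣ n then (1 - 1 / (p:ℝ)) else 1) := by
  have h := Nat.totient_eq_mul_prod_factors n
  have h2 : (Nat.totient n : ℝ) = n * ∏ p ∈ n.primeFactors, (1 - 1 / (p:ℝ)) := by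
    have := congrArg (fun z : ℚ => (z : ℝ)) h
    push_cast at this
    simpa [one_div] using this
  rw [h2, ← Finset.prod_filter]
  congr 2
  have hn0 : n ≠ 0 := fun h => hU (by rw [h] at hn; exact Nat.eq_zero_of_zero_dvd hn)
  ext p
  simp only [Nat.mem_primeFactors, Finset.mem_filter]
  exact ⟨fun h => ⟨⟨h.1, h.2.1.trans hn, hU⟩, h.2.1⟩, fun h => ⟨h.1.1, h.2, hn0⟩⟩

lemma c0_nonneg (m n : ℕ) : 0 ≤ c0 m n := by
  unfold c0
  refine mul_nonneg (Nat.cast_nonneg _) (Finset.prod_nonneg fun p hp => ?_)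
  have h0 : (1:ℝ) ≤ p := by exact_mod_cast (Nat.prime_of_mem_primeFactors hp).pos
  have : (0:ℝ) ≤ 1 - 1 / (p:ℝ) := by
    rw [sub_nonneg, div_le_one (by linarith)]; exact h0
  split_ifs <;> positivity

lemma tot_id {m n : ℕ} (hm : 0 < m) (hn : 0 < n) :
    c0 m n * ((m:ℝ) * n / (m.gcd n : ℝ)) * ∏ p ∈ dp m n, (1 - 1 / (p:ℝ)) =
      (Nat.totient m : ℝ) * (Nat.totient n : ℝ) := by
  have hU : m * n ≠ 0 := (Nat.mul_pos hm hn).ne'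
  have hg0 : 0 < m.gcd n := Nat.gcd_pos_of_pos_left _ hm
  have hg1 : m.gcd n ∣ m * n := (Nat.gcd_dvd_left m n).mul_right n
  have em : m = m / m.gcd n * m.gcd n := (Nat.div_mul_cancel (Nat.gcd_dvd_left _ _)).symm
  have en : n = n / m.gcd n * m.gcd n := (Nat.div_mul_cancel (Nat.gcd_dvd_right _ _)).symm
  have hq1 : qq m n ∣ m * n := Nat.mul_dvd_mul (Nat.div_dvd_of_dvd (Nat.gcd_dvd_left _ _))
    (Nat.div_dvd_of_dvd (Nat.gcd_dvd_right _ _))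
  have hsub : ∀ d : ℕ, d ∣ m * n → d ≠ 0 → d.primeFactors = (m * n).primeFactors.filter (fun p => p ∣ d) := by
    intro d hd hd0
    ext p
    simp only [Nat.mem_primeFactors, Finset.mem_filter]
    exact ⟨fun h => ⟨⟨h.1, h.2.1.trans hd, hU⟩, h.2.1⟩, fun h => ⟨h.1.1, h.2, hd0⟩⟩
  have hq0 : qq m n ≠ 0 := fun h => hU (by rw [h] at hq1; exact Nat.eq_zero_of_zero_dvd hq1)
  have hdp : dp m n = (qq m n).primeFactors := rfl
  rw [tot_prod m (m * n) hU (dvd_mul_right _ _), tot_prod n (m * n) hU (dvd_mul_left _ _), hdp,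
    hsub _ hq1 hq0]
  unfold c0
  rw [hsub _ hg1 hg0.ne', Finset.prod_filter, Finset.prod_filter]
  have hgR : (m.gcd n : ℝ) ≠ 0 := by exact_mod_cast hg0.ne'
  have key : (∏ p ∈ (m * n).primeFactors, if p ∣ m.gcd n then
      (if p ∣ qq m n then (1 - 1 / (p:ℝ)) else (1 - 1 / (p:ℝ)) ^ 2) else 1) *
      (∏ p ∈ (m * n).primeFactors, if p ∣ qq m n then (1 - 1 / (p:ℝ)) else 1) =
      (∏ p ∈ (m * n).primeFactors, if p ∣ m then (1 - 1 / (p:ℝ)) else 1) *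
      (∏ p ∈ (m * n).primeFactors, if p ∣ n then (1 - 1 / (p:ℝ)) else 1) := by
    rw [← Finset.prod_mul_distrib, ← Finset.prod_mul_distrib]
    refine Finset.prod_congr rfl fun p hp => ?_
    have pp := Nat.prime_of_mem_primeFactors hp
    have hpmn := pp.dvd_mul.1 (Nat.dvd_of_mem_primeFactors hp)
    by_cases h1 : p ∣ m.gcd n
    · have a1 : p ∣ m := h1.trans (Nat.gcd_dvd_left _ _)
      have a2 : p ∣ n := h1.trans (Nat.gcd_dvd_right _ _)
      simp only [h1, a1, a2, if_true]
      split_ifs <;> ring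
    · have hq : p ∣ qq m n := by
        unfold qq
        rcases hpmn with h | h
        · rw [em] at h
          exact ((pp.dvd_mul.1 h).resolve_right h1).mul_right _
        · rw [en] at h
          exact ((pp.dvd_mul.1 h).resolve_right h1).mul_left _
      simp only [h1, hq, if_true, if_false]
      by_cases a1 : p ∣ m
      · have a2 : ¬ p ∣ n := fun h => h1 (Nat.dvd_gcd a1 h)
        simp [a1, a2]
      · have a2 : p ∣ n := hpmn.resolve_left a1
        simp [a1, a2]
  calc _ = ((m:ℝ) * n) * ((∏ p ∈ (m * n).primeFactors, if p ∣ m.gcd n then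
      (if p ∣ qq m n then (1 - 1 / (p:ℝ)) else (1 - 1 / (p:ℝ)) ^ 2) else 1) *
      (∏ p ∈ (m * n).primeFactors, if p ∣ qq m n then (1 - 1 / (p:ℝ)) else 1)) := by
        field_simp
    _ = _ := by rw [key]; ring

/-- local factor -/
noncomputable def loc (m n k : ℕ) : ℝ := ∏ p ∈ P2 m n, (ap p + if p ∣ k then bp p else 0)

lemma P2_prime {m n p : ℕ} (h : p ∈ P2 m n) : p.Prime :=
  Nat.prime_of_mem_primeFactors (Finset.mem_filter.1 h).1

lemma pair_sum {m n : ℕ} (hm : 0 < m) (hn : 0 < n) (hmn : m ≠ n) (w : ℕ → ℝ) (hw : ∀ k, 0 ≤ w k) :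
    ∑ x ∈ prs m n, w (kap m n x).natAbs ≤
      2 * c0 m n * ∑ k ∈ Finset.Icc 1 (m * n), (if k.Coprime (qq m n) then loc m n k * w k else 0) := by
  have hg0 : 0 < m.gcd n := Nat.gcd_pos_of_pos_left _ hm
  have hmaps : ∀ x ∈ prs m n, (kap m n x).natAbs ∈ Finset.Icc 1 (m * n) := by
    intro x hx
    have hc := kap_coprime hm hn hx
    have hx3 := Finset.mem_product.1 (Finset.mem_filter.1 hx).1
    rw [Finset.mem_range, Finset.mem_range] at hx3
    rw [Finset.mem_Icc]
    constructor
    · by_contra h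
      have h0 : (kap m n x).natAbs = 0 := by omega
      rw [h0, Nat.coprime_zero_left] at hc
      have h1 := Nat.eq_one_of_mul_eq_one_right hc
      have h2 := Nat.eq_one_of_mul_eq_one_left hc
      have em : m = m / m.gcd n * m.gcd n := (Nat.div_mul_cancel (Nat.gcd_dvd_left _ _)).symm
      have en : n = n / m.gcd n * m.gcd n := (Nat.div_mul_cancel (Nat.gcd_dvd_right _ _)).symm
      rw [h1] at em
      rw [h2] at en
      exact hmn (em.trans en.symm)
    · unfold kap
      have h1 : x.1 * (n / m.gcd n) ≤ m * n := Nat.mul_le_mul hx3.1.le (Nat.div_le_self _ _)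
      have h2 : x.2 * (m / m.gcd n) ≤ m * n := by
        rw [mul_comm m n]; exact Nat.mul_le_mul hx3.2.le (Nat.div_le_self _ _)
      have h1' : (x.1:ℤ) * (n / m.gcd n : ℕ) ≤ m * n := by exact_mod_cast h1
      have h2' : (x.2:ℤ) * (m / m.gcd n : ℕ) ≤ m * n := by exact_mod_cast h2
      have h3 : 0 ≤ (x.1:ℤ) * (n / m.gcd n : ℕ) := by positivity
      have h4 : 0 ≤ (x.2:ℤ) * (m / m.gcd n : ℕ) := by positivity
      have h5 : |(x.1:ℤ) * (n / m.gcd n : ℕ) - (x.2:ℤ) * (m / m.gcd n : ℕ)| ≤ (m * n : ℕ) := by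
        rw [abs_le]
        push_cast [-Nat.cast_ite] at h1' h2' h3 h4 ⊢
        constructor <;> linarith
      rw [Int.abs_eq_natAbs] at h5
      exact_mod_cast h5
  rw [← Finset.sum_fiberwise_of_maps_to hmaps, Finset.mul_sum]
  refine Finset.sum_le_sum fun k hk => ?_
  have e1 : ∑ x ∈ (prs m n).filter (fun x => (kap m n x).natAbs = k), w (kap m n x).natAbs
      = ((prs m n).filter (fun x => (kap m n x).natAbs = k)).card * w k := by
    rw [← nsmul_eq_mul]
    refine Finset.sum_eq_card_nsmul fun x hx => ?_
    rw [(Finset.mem_filter.1 hx).2]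
  rw [e1]
  by_cases hkc : k.Coprime (qq m n)
  · rw [if_pos hkc, ← mul_assoc]
    refine mul_le_mul_of_nonneg_right ?_ (hw k)
    have hsub : (prs m n).filter (fun x => (kap m n x).natAbs = k) ⊆
        (prs m n).filter (fun x => kap m n x = (k:ℤ)) ∪ (prs m n).filter (fun x => kap m n x = -(k:ℤ)) := by
      intro x hx
      obtain ⟨h1, h2⟩ := Finset.mem_filter.1 hx
      rw [Finset.mem_union, Finset.mem_filter, Finset.mem_filter]
      rcases Int.natAbs_eq (kap m n x) with h | h
      · left; exact ⟨h1, by rw [h, h2]⟩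
      · right; exact ⟨h1, by rw [h, h2]⟩
    have h1 := (Finset.card_le_card hsub).trans (Finset.card_union_le _ _)
    have h2 := cnt_le hm hn (k:ℤ)
    have h3 := cnt_le hm hn (-(k:ℤ))
    rw [Int.natAbs_neg] at h3
    rw [Int.natAbs_natCast] at h2 h3
    have h1' : (((prs m n).filter (fun x => (kap m n x).natAbs = k)).card : ℝ) ≤
       ((prs m n).filter (fun x => kap m n x = (k:ℤ))).card +
       ((prs m n).filter (fun x => kap m n x = -(k:ℤ))).card := by exact_mod_cast h1
    unfold loc
    linarith
  · rw [if_neg hkc, mul_zero, Finset.filter_eq_empty_iff.2]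
    · simp
    · intro x hx h
      exact hkc (h ▸ kap_coprime hm hn hx)

/-- counting function -/
noncomputable def FF (ψ : ℕ → ℝ) (n : ℕ) (α : ℝ) : ℝ :=
  ∑ a ∈ (Finset.range n).filter (fun a => a.Coprime n),
    (Set.Icc ((a:ℝ) / n - ψ n / n) ((a:ℝ) / n + ψ n / n)).indicator (fun _ => (1:ℝ)) α

lemma FF_integrable (ψ : ℕ → ℝ) (n : ℕ) : Integrable (FF ψ n) volume := by
  unfold FF
  refine integrable_finsetSum _ fun a _ => ?_
  exact (integrable_indicator_iff measurableSet_Icc).2 (by simp [integrableOn_const_iff])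

lemma FF_nonneg (ψ : ℕ → ℝ) (n : ℕ) (α : ℝ) : 0 ≤ FF ψ n α :=
  Finset.sum_nonneg fun a _ => Set.indicator_nonneg (fun _ _ => zero_le_one) α

lemma int_ind (a b : ℝ) (h : a ≤ b) :
    ∫ α, (Set.Icc a b).indicator (fun _ => (1:ℝ)) α = b - a := by
  rw [integral_indicator measurableSet_Icc]
  simp [h]

lemma FF_int (ψ : ℕ → ℝ) (hψ : ∀ n, 0 ≤ ψ n) (n : ℕ) : ∫ α, FF ψ n α = lam ψ n := by
  unfold FF
  rw [integral_finsetSum]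
  · have : ∀ a ∈ (Finset.range n).filter (fun a => a.Coprime n),
      ∫ α, (Set.Icc ((a:ℝ) / n - ψ n / n) ((a:ℝ) / n + ψ n / n)).indicator (fun _ => (1:ℝ)) α
        = 2 * ψ n / n := by
      intro a _
      have : 0 ≤ ψ n / n := div_nonneg (hψ n) (Nat.cast_nonneg _)
      rw [int_ind _ _ (by linarith)]; ring
    rw [Finset.sum_congr rfl this, Finset.sum_const, nsmul_eq_mul]
    have hc : ((Finset.range n).filter (fun a => a.Coprime n)).card = Nat.totient n := by
      rw [Nat.totient_eq_card_coprime]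
      congr 1
      ext a
      simp [Nat.coprime_comm]
    rw [hc]; unfold lam; ring
  · intro a _
    exact (integrable_indicator_iff measurableSet_Icc).2 (by simp [integrableOn_const_iff])

lemma int_ind_mul (a b c d : ℝ) :
    ∫ α, (Set.Icc a b).indicator (fun _ => (1:ℝ)) α * (Set.Icc c d).indicator (fun _ => (1:ℝ)) α
      = max 0 (min b d - max a c) := by
  have : ∀ α, (Set.Icc a b).indicator (fun _ => (1:ℝ)) α * (Set.Icc c d).indicator (fun _ => (1:ℝ)) α
     = (Set.Icc (max a c) (min b d)).indicator (fun _ => (1:ℝ)) α := by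
    intro α
    have := Set.inter_indicator_mul (s := Set.Icc a b) (t := Set.Icc c d)
      (fun _ => (1:ℝ)) (fun _ => (1:ℝ)) α
    rw [Set.Icc_inter_Icc] at this
    simp only [mul_one] at this
    exact this.symm
  simp_rw [this]
  rw [integral_indicator measurableSet_Icc]
  simp [max_comm]

lemma ind_mul_integrable (a b c d : ℝ) : Integrable (fun α =>
    (Set.Icc a b).indicator (fun _ => (1:ℝ)) α * (Set.Icc c d).indicator (fun _ => (1:ℝ)) α) volume := by
  have : (fun α => (Set.Icc a b).indicator (fun _ => (1:ℝ)) α * (Set.Icc c d).indicator (fun _ => (1:ℝ)) α)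
     = (Set.Icc a b ∩ Set.Icc c d).indicator (fun _ => (1:ℝ)) := by
    funext α
    have := Set.inter_indicator_mul (s := Set.Icc a b) (t := Set.Icc c d)
      (fun _ => (1:ℝ)) (fun _ => (1:ℝ)) α
    simp only [mul_one] at this
    exact this.symm
  rw [this, Set.Icc_inter_Icc]
  exact (integrable_indicator_iff measurableSet_Icc).2 (by simp [integrableOn_const_iff])

lemma FFmul_eq (ψ : ℕ → ℝ) (m n : ℕ) (α : ℝ) : FF ψ m α * FF ψ n α = ∑ x ∈ prs m n,
    (Set.Icc ((x.1:ℝ) / m - ψ m / m) ((x.1:ℝ) / m + ψ m / m)).indicator (fun _ => (1:ℝ)) α *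
    (Set.Icc ((x.2:ℝ) / n - ψ n / n) ((x.2:ℝ) / n + ψ n / n)).indicator (fun _ => (1:ℝ)) α := by
  unfold FF prs
  rw [Finset.sum_mul_sum, ← Finset.sum_product', ← Finset.filter_product]

lemma FFmul_integrable (ψ : ℕ → ℝ) (m n : ℕ) : Integrable (fun α => FF ψ m α * FF ψ n α) volume := by
  simp_rw [FFmul_eq]
  exact integrable_finsetSum _ fun x _ => ind_mul_integrable _ _ _ _

lemma overlap_sum (ψ : ℕ → ℝ) (hψ : ∀ n, 0 ≤ ψ n) {m n : ℕ} (hm : 0 < m) (hn : 0 < n) (hmn : m ≠ n) :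
    ∫ α, FF ψ m α * FF ψ n α ≤ 2 * c0 m n * ∑ k ∈ Finset.Icc 1 (m * n),
      (if k.Coprime (qq m n) then loc m n k * ww (min (ψ m / m) (ψ n / n)) (max (ψ m / m) (ψ n / n))
        ((k:ℝ) / ((m:ℝ) * n / (m.gcd n : ℝ))) else 0) := by
  have hδ : 0 ≤ ψ m / m := div_nonneg (hψ m) (Nat.cast_nonneg _)
  have hε : 0 ≤ ψ n / n := div_nonneg (hψ n) (Nat.cast_nonneg _)
  simp_rw [FFmul_eq]
  rw [integral_finsetSum _ fun x _ => ind_mul_integrable _ _ _ _]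
  refine le_trans ?_ (pair_sum hm hn hmn (fun k => ww (min (ψ m / m) (ψ n / n))
    (max (ψ m / m) (ψ n / n)) ((k:ℝ) / ((m:ℝ) * n / (m.gcd n : ℝ)))) fun k => ww_nonneg (le_min hδ hε) _ _)
  refine Finset.sum_le_sum fun x _ => ?_
  rw [int_ind_mul]
  have hg0 : 0 < m.gcd n := Nat.gcd_pos_of_pos_left _ hm
  have e : (((kap m n x).natAbs : ℕ) : ℝ) / ((m:ℝ) * n / (m.gcd n : ℝ)) = |(x.1:ℝ) / m - (x.2:ℝ) / n| := by
    have hgR : (m.gcd n : ℝ) ≠ 0 := by exact_mod_cast hg0.ne'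
    have hmR : (0:ℝ) < m := by exact_mod_cast hm
    have hnR : (0:ℝ) < n := by exact_mod_cast hn
    have hL : (0:ℝ) ≤ (m:ℝ) * n / (m.gcd n : ℝ) := by positivity
    rw [Nat.cast_natAbs, Int.cast_abs, ← abs_of_nonneg hL, ← abs_div]
    congr 1
    unfold kap
    simp only [Int.cast_sub, Int.cast_mul, Int.cast_natCast]
    rw [Nat.cast_div (Nat.gcd_dvd_right m n) hgR, Nat.cast_div (Nat.gcd_dvd_left m n) hgR]
    field_simp
  rw [e]
  exact max_le (ww_nonneg (le_min hδ hε) _ _) (inter_le hδ hε _ _)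

end QDS

namespace QDS

noncomputable def ivp (Q : Finset ℕ) : ℝ := ∏ p ∈ Q, (1 + 1 / ((p:ℝ) - 1))

lemma ivp_one_le {p : ℕ} (pp : p.Prime) : (1:ℝ) ≤ 1 + 1 / ((p:ℝ) - 1) := by
  have h2 : (2:ℝ) ≤ p := by exact_mod_cast pp.two_le
  have : 0 ≤ 1 / ((p:ℝ) - 1) := div_nonneg zero_le_one (by linarith)
  linarith

lemma inv_two {p : ℕ} (pp : p.Prime) : 1 / ((p:ℝ) - 1) ≤ 2 / p := by
  have h2 : (2:ℝ) ≤ p := by exact_mod_cast pp.two_le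
  rw [div_le_div_iff₀ (by linarith) (by linarith)]; linarith

lemma ivp_exp {Q : Finset ℕ} (hQ : ∀ p ∈ Q, p.Prime) : ivp Q ≤ Real.exp (2 * ∑ p ∈ Q, 1 / (p:ℝ)) := by
  unfold ivp
  rw [Finset.mul_sum, Real.exp_sum]
  refine Finset.prod_le_prod (fun p hp => by linarith [ivp_one_le (hQ p hp)]) fun p hp => ?_
  have h1 := Real.add_one_le_exp (2 * (1 / (p:ℝ)))
  have := inv_two (hQ p hp)
  have e : 2 * (1 / (p:ℝ)) = 2 / p := by ring
  rw [e] at h1 ⊢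
  linarith

lemma ivp_mul {Q : Finset ℕ} (hQ : ∀ p ∈ Q, p.Prime) : (∏ p ∈ Q, (1 - 1 / (p:ℝ))) * ivp Q = 1 := by
  unfold ivp
  rw [← Finset.prod_mul_distrib]
  refine Finset.prod_eq_one fun p hp => ?_
  have h2 : (2:ℝ) ≤ p := by exact_mod_cast (hQ p hp).two_le
  have : (p:ℝ) - 1 ≠ 0 := by linarith
  field_simp
  ring

lemma ivp_one {Q : Finset ℕ} (hQ : ∀ p ∈ Q, p.Prime) : 1 ≤ ivp Q := by
  unfold ivp
  have := Finset.prod_le_prod (s := Q) (f := fun _ => (1:ℝ)) (g := fun p : ℕ => 1 + 1 / ((p:ℝ) - 1))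
    (fun _ _ => zero_le_one) fun p hp => ivp_one_le (hQ p hp)
  simpa using this

lemma tele (T : ℕ) (hT : 1 ≤ T) : ∏ p ∈ Finset.Icc 2 T, (1 + 1 / ((p:ℝ) - 1)) = T := by
  induction T, hT using Nat.le_induction with
  | base => simp
  | succ n hn ih =>
    rw [Finset.prod_Icc_succ_top (by omega), ih]
    have : (n:ℝ) ≠ 0 := by exact_mod_cast (by omega : n ≠ 0)
    push_cast
    rw [add_sub_cancel_right, mul_add, mul_one, mul_one_div, div_self this]

lemma ivp_le {Q : Finset ℕ} (T : ℕ) (hT : 1 ≤ T) (hQ : ∀ p ∈ Q, p.Prime ∧ p ≤ T) : ivp Q ≤ T := by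
  rw [← tele T hT]
  unfold ivp
  have hsub : Q ⊆ Finset.Icc 2 T := fun p hp => Finset.mem_Icc.2 ⟨(hQ p hp).1.two_le, (hQ p hp).2⟩
  rw [← Finset.prod_sdiff hsub]
  refine le_mul_of_one_le_left (Finset.prod_nonneg fun p hp => by linarith [ivp_one_le (hQ p hp).1]) ?_
  have := Finset.prod_le_prod (s := Finset.Icc 2 T \ Q) (f := fun _ => (1:ℝ))
    (g := fun p : ℕ => 1 + 1 / ((p:ℝ) - 1)) (fun _ _ => zero_le_one) fun p hp => by
      have h2 : (2:ℝ) ≤ p := by exact_mod_cast (Finset.mem_Icc.1 (Finset.mem_sdiff.1 hp).1).1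
      have : 0 ≤ 1 / ((p:ℝ) - 1) := div_nonneg zero_le_one (by linarith)
      linarith
  simpa using this

lemma two_le_ivp {Q : Finset ℕ} (hQ : ∀ p ∈ Q, p.Prime) : ∏ p ∈ Q, (1 + 2 / (p:ℝ)) ≤ ivp Q ^ 2 := by
  unfold ivp
  rw [← Finset.prod_pow]
  refine Finset.prod_le_prod (fun p hp => by positivity) fun p hp => ?_
  have h2 : (2:ℝ) ≤ p := by exact_mod_cast (hQ p hp).two_le
  have h3 : 0 ≤ 1 / ((p:ℝ) - 1) := div_nonneg zero_le_one (by linarith)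
  have h4 : 2 / (p:ℝ) ≤ 2 * (1 / ((p:ℝ) - 1)) := by
    rw [mul_one_div]
    exact div_le_div_of_nonneg_left (by norm_num) (by linarith) (by linarith)
  nlinarith

lemma dp_prime {m n p : ℕ} (h : p ∈ dp m n) : p.Prime := Nat.prime_of_mem_primeFactors h

/-- The quantity `D`. -/
noncomputable def DD (ψ : ℕ → ℝ) (m n : ℕ) : ℝ := max ((n:ℝ) * ψ m) ((m:ℝ) * ψ n) / (m.gcd n : ℝ)

section
variable (ψ : ℕ → ℝ) (hψ : ∀ n, ψ n ∈ Set.Icc (0:ℝ) (1/2)) {m n : ℕ} (hm : 0 < m) (hn : 0 < n)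

lemma Y_id (hm : 0 < m) (hn : 0 < n) :
    2 * c0 m n * (2 * min (ψ m / m) (ψ n / n) * max (ψ m / m) (ψ n / n) * ((m:ℝ) * n / (m.gcd n : ℝ)))
      = lam ψ m * lam ψ n * ivp (dp m n) := by
  have h := tot_id hm hn
  have h2 := ivp_mul (Q := dp m n) (fun p hp => dp_prime hp)
  have hmR : (m:ℝ) ≠ 0 := by exact_mod_cast hm.ne'
  have hnR : (n:ℝ) ≠ 0 := by exact_mod_cast hn.ne'
  have e : lam ψ m * lam ψ n = 4 * (ψ m / m * (ψ n / n)) * (Nat.totient m * Nat.totient n) := by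
    unfold lam; ring
  rw [e, ← h, mul_assoc 2 (min _ _), min_mul_max]
  linear_combination (-(4 * (ψ m / m * (ψ n / n)) * (c0 m n * ((m:ℝ) * n / (m.gcd n : ℝ))))) * h2

lemma V_bd (hψ : ∀ n, ψ n ∈ Set.Icc (0:ℝ) (1/2)) (hm : 0 < m) (hn : 0 < n) (d : ℕ) (hd : 1 ≤ d) :
    2 * min (ψ m / m) (ψ n / n) * max (ψ m / m) (ψ n / n) * ((m:ℝ) * n / (m.gcd n : ℝ)) / d
      - 2 * min (ψ m / m) (ψ n / n) ≤ ∑ k ∈ (Finset.Icc 1 (m * n)).filter (fun k => d ∣ k),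
        ww (min (ψ m / m) (ψ n / n)) (max (ψ m / m) (ψ n / n)) (k / ((m:ℝ) * n / (m.gcd n : ℝ))) ∧
    ∑ k ∈ (Finset.Icc 1 (m * n)).filter (fun k => d ∣ k),
        ww (min (ψ m / m) (ψ n / n)) (max (ψ m / m) (ψ n / n)) (k / ((m:ℝ) * n / (m.gcd n : ℝ))) ≤
      2 * min (ψ m / m) (ψ n / n) * max (ψ m / m) (ψ n / n) * ((m:ℝ) * n / (m.gcd n : ℝ)) / d :=
  W_bounds (a := min (ψ m / m) (ψ n / n)) (b := max (ψ m / m) (ψ n / n))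
    (L := (m:ℝ) * n / (m.gcd n : ℝ))
    (le_min (div_nonneg (hψ m).1 (Nat.cast_nonneg _)) (div_nonneg (hψ n).1 (Nat.cast_nonneg _)))
    min_le_max (div_pos (mul_pos (Nat.cast_pos.2 hm) (Nat.cast_pos.2 hn))
      (Nat.cast_pos.2 (Nat.gcd_pos_of_pos_left _ hm))) (m * n) d hd (by
      rw [min_add_max]
      have hmR : (1:ℝ) ≤ m := by exact_mod_cast hm
      have hnR : (1:ℝ) ≤ n := by exact_mod_cast hn
      have hg : (1:ℝ) ≤ (m.gcd n : ℝ) := by exact_mod_cast (Nat.gcd_pos_of_pos_left _ hm)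
      have h1 : ψ m / m ≤ 1 / 2 := (div_le_self (hψ m).1 hmR).trans (hψ m).2
      have h2 : ψ n / n ≤ 1 / 2 := (div_le_self (hψ n).1 hnR).trans (hψ n).2
      have h3 : (m:ℝ) * n / (m.gcd n : ℝ) ≤ m * n := div_le_self (by positivity) hg
      have h4 : 0 ≤ (m:ℝ) * n / (m.gcd n : ℝ) := by positivity
      push_cast
      calc _ ≤ (m:ℝ) * n / (m.gcd n : ℝ) * 1 := by gcongr; linarith
        _ ≤ _ := by linarith)

lemma loc_hQ {Q : Finset ℕ} (hQ : Q ⊆ P2 m n) :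
    ∀ p ∈ Q, p.Prime ∧ 0 ≤ ap p ∧ 0 ≤ bp p ∧ ap p + bp p / p = 1 := by
  intro p hp
  have pp := P2_prime (hQ hp)
  have := ab_facts pp
  exact ⟨pp, this.1, this.2.1, this.2.2.1⟩

lemma loc_nonneg {Q : Finset ℕ} (hQ : Q ⊆ P2 m n) (k : ℕ) :
    0 ≤ ∏ p ∈ Q, (ap p + if p ∣ k then bp p else 0) := by
  refine Finset.prod_nonneg fun p hp => ?_
  have := loc_hQ hQ p hp
  split_ifs <;> linarith

lemma overlap_crude (hψ : ∀ n, ψ n ∈ Set.Icc (0:ℝ) (1/2)) (hm : 0 < m) (hn : 0 < n) (hmn : m ≠ n) :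
    ∫ α, FF ψ m α * FF ψ n α ≤ lam ψ m * lam ψ n * Real.exp (2 * LL 2 m n) := by
  have hδ : 0 ≤ ψ m / m := div_nonneg (hψ m).1 (Nat.cast_nonneg _)
  have hε : 0 ≤ ψ n / n := div_nonneg (hψ n).1 (Nat.cast_nonneg _)
  refine (overlap_sum ψ (fun n => (hψ n).1) hm hn hmn).trans ?_
  have hs := (sieve_core ap bp (fun k : ℕ => ww (min (ψ m / m) (ψ n / n)) (max (ψ m / m) (ψ n / n))
    ((k:ℝ) / ((m:ℝ) * n / (m.gcd n : ℝ)))) (m * n) _ _ (V_bd ψ hψ hm hn) (P2 m n) (loc_hQ subset_rfl) 1 le_rfl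
    (fun p hp h => (P2_prime hp).one_lt.ne' (Nat.dvd_one.1 h))).2
  have h1 : ∑ k ∈ Finset.Icc 1 (m * n),
      (if k.Coprime (qq m n) then loc m n k * ww (min (ψ m / m) (ψ n / n)) (max (ψ m / m) (ψ n / n))
        ((k:ℝ) / ((m:ℝ) * n / (m.gcd n : ℝ))) else 0) ≤
      2 * min (ψ m / m) (ψ n / n) * max (ψ m / m) (ψ n / n) * ((m:ℝ) * n / (m.gcd n : ℝ)) := by
    rw [Nat.cast_one, div_one] at hs
    refine le_trans ?_ hs
    rw [Finset.sum_filter]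
    refine Finset.sum_le_sum fun k _ => ?_
    rw [if_pos (one_dvd k)]
    have : 0 ≤ loc m n k * ww (min (ψ m / m) (ψ n / n)) (max (ψ m / m) (ψ n / n))
        ((k:ℝ) / ((m:ℝ) * n / (m.gcd n : ℝ))) :=
      mul_nonneg (loc_nonneg subset_rfl k) (ww_nonneg (le_min hδ hε) _ _)
    split_ifs
    · exact le_rfl
    · exact this
  refine (mul_le_mul_of_nonneg_left h1 (mul_nonneg zero_le_two (c0_nonneg m n))).trans ?_
  rw [Y_id ψ hm hn]
  have hl : ∀ k, 0 ≤ lam ψ k := fun k => by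
    unfold lam; have := (hψ k).1; positivity
  refine mul_le_mul_of_nonneg_left ?_ (mul_nonneg (hl _) (hl _))
  have := ivp_exp (Q := dp m n) (fun p hp => dp_prime hp)
  have e : LL 2 m n = ∑ p ∈ dp m n, 1 / (p:ℝ) := by
    unfold LL
    congr 1
    exact Finset.filter_true_of_mem fun p hp => (dp_prime hp).two_le
  rw [e]; exact this

lemma overlap_sharp (hψ : ∀ n, ψ n ∈ Set.Icc (0:ℝ) (1/2)) (hm : 0 < m) (hn : 0 < n) (hmn : m ≠ n)
    (T r j : ℕ) (hT : 1 ≤ T) (hD0 : 0 < DD ψ m n) (hD : DD ψ m n < 2 ^ (j + 1)) :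
    ∫ α, FF ψ m α * FF ψ n α ≤ lam ψ m * lam ψ n * Real.exp (2 * LL T m n) *
      (Real.exp (2 * (j + 2) / T) * (1 + (T:ℝ) ^ 3 / 2 ^ (2 * r) + 3 * (T:ℝ) ^ (2 * r + 2) / DD ψ m n)) := by
  have hδ : 0 ≤ ψ m / m := div_nonneg (hψ m).1 (Nat.cast_nonneg _)
  have hε : 0 ≤ ψ n / n := div_nonneg (hψ n).1 (Nat.cast_nonneg _)
  refine (overlap_sum ψ (fun n => (hψ n).1) hm hn hmn).trans ?_
  have hYid := Y_id ψ hm hn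
  have hmR : (0:ℝ) < m := by exact_mod_cast hm
  have hnR : (0:ℝ) < n := by exact_mod_cast hn
  have hgR : (0:ℝ) < (m.gcd n : ℝ) := by exact_mod_cast (Nat.gcd_pos_of_pos_left _ hm)
  have hDb : DD ψ m n = (m:ℝ) * n / (m.gcd n : ℝ) * max (ψ m / m) (ψ n / n) := by
    unfold DD
    rw [mul_max_of_nonneg _ _ (by positivity), ← max_div_div_right hgR.le]
    congr 1 <;> field_simp
  have hV := V_bd ψ hψ hm hn
  have hL : (0:ℝ) < (m:ℝ) * n / (m.gcd n : ℝ) := by positivity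
  have ha : 0 ≤ min (ψ m / m) (ψ n / n) := le_min hδ hε
  have hab : min (ψ m / m) (ψ n / n) ≤ max (ψ m / m) (ψ n / n) := min_le_max
  generalize min (ψ m / m) (ψ n / n) = a at *
  generalize max (ψ m / m) (ψ n / n) = b at *
  generalize (m:ℝ) * n / (m.gcd n : ℝ) = L at *
  generalize DD ψ m n = D at *
  have hb : 0 ≤ b := ha.trans hab
  set Q1 := (dp m n).filter (fun p => ¬ T ≤ p) with hQ1
  set Q2 := (P2 m n).filter (fun p => ¬ T ≤ p) with hQ2
  have q1p : ∀ p ∈ Q1, p.Prime ∧ p ≤ T := fun p hp =>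
    ⟨dp_prime (Finset.mem_filter.1 hp).1, (not_le.1 (Finset.mem_filter.1 hp).2).le⟩
  have q2p : ∀ p ∈ Q2, p.Prime ∧ p ≤ T := fun p hp =>
    ⟨P2_prime (Finset.mem_filter.1 hp).1, (not_le.1 (Finset.mem_filter.1 hp).2).le⟩
  have hs := sieve ap bp (fun k => ww a b ((k:ℝ) / L)) (fun k => ww_nonneg ha _ _) (m * n) (2 * a * b * L) (2 * a)
    (by positivity) (by positivity) hV Q2 (loc_hQ (Finset.filter_subset _ _)) Q1
    (fun p hp => (q1p p hp).1) (by
      intro p hp1 hp2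
      have h1 := (Finset.mem_filter.1 hp1).1
      have h2 := (Finset.mem_filter.1 (Finset.mem_filter.1 hp2).1).2
      exact h2 (Nat.dvd_of_mem_primeFactors h1)) r
  set E := Real.exp (2 * (j + 2) / T) with hE
  have hTR : (1:ℝ) ≤ T := by exact_mod_cast hT
  have h1 : ∑ k ∈ Finset.Icc 1 (m * n),
      (if k.Coprime (qq m n) then loc m n k * ww a b ((k:ℝ) / L) else 0) ≤
      E * ∑ k ∈ Finset.Icc 1 (m * n), (if ∀ p ∈ Q1, ¬ p ∣ k then
        (∏ p ∈ Q2, (ap p + if p ∣ k then bp p else 0)) * ww a b ((k:ℝ) / L) else 0) := by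
    rw [Finset.mul_sum]
    refine Finset.sum_le_sum fun k hk => ?_
    have hk1 := (Finset.mem_Icc.1 hk).1
    have hnn : 0 ≤ (∏ p ∈ Q2, (ap p + if p ∣ k then bp p else 0)) * ww a b ((k:ℝ) / L) :=
      mul_nonneg (loc_nonneg (Finset.filter_subset _ _) k) (ww_nonneg ha _ _)
    by_cases hc : k.Coprime (qq m n)
    · rw [if_pos hc, if_pos]
      · by_cases hbig : a + b ≤ (k:ℝ) / L
        · rw [ww_zero ha hbig]; simp
        · rw [← mul_assoc]
          refine mul_le_mul_of_nonneg_right ?_ (ww_nonneg ha _ _)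
          unfold loc
          rw [← Finset.prod_filter_mul_prod_filter_not (P2 m n) (fun p => T ≤ p)]
          refine mul_le_mul_of_nonneg_right ?_ (loc_nonneg (Finset.filter_subset _ _) k)
          have hk2 : (k:ℝ) < 2 ^ (j + 2) := by
            rw [not_le, div_lt_iff₀ hL] at hbig
            have : (a + b) * L ≤ 2 * D := by rw [hDb]; nlinarith
            have e : (2:ℝ) ^ (j + 2) = 2 * 2 ^ (j + 1) := by ring
            linarith
          have hk3 : k < 2 ^ (j + 2) := by exact_mod_cast hk2
          set R := ((P2 m n).filter (fun p => T ≤ p)).filter (fun p => p ∣ k) with hR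
          have hRp : ∀ p ∈ R, p.Prime := fun p hp =>
            P2_prime (Finset.mem_filter.1 (Finset.mem_filter.1 hp).1).1
          have hRc : R.card ≤ j + 2 := by
            have h1 : 2 ^ R.card ≤ ∏ p ∈ R, p := Finset.pow_card_le_prod _ _ _ fun p hp => (hRp p hp).two_le
            have h2 : (∏ p ∈ R, p) ∣ k := Finset.prod_primes_dvd k (fun p hp => (hRp p hp).prime)
              (fun p hp => (Finset.mem_filter.1 hp).2)
            have h3 := Nat.le_of_dvd hk1 h2
            exact ((Nat.pow_lt_pow_iff_right (by norm_num)).1 (h1.trans_lt (h3.trans_lt hk3))).le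
          have e1 : ∏ p ∈ (P2 m n).filter (fun p => T ≤ p), (ap p + if p ∣ k then bp p else 0)
              ≤ ∏ p ∈ (P2 m n).filter (fun p => T ≤ p), (if p ∣ k then Real.exp (2 / T) else 1) := by
            refine Finset.prod_le_prod (fun p hp => ?_) fun p hp => ?_
            · have := loc_hQ (Finset.filter_subset _ _) p hp
              split_ifs <;> linarith
            · have pp := P2_prime (Finset.mem_filter.1 hp).1
              have hTp : (T:ℝ) ≤ p := by exact_mod_cast (Finset.mem_filter.1 hp).2
              have hf := ab_facts pp
              split_ifs
              · rw [hf.2.2.2.1]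
                have i1 := inv_two pp
                have i2 : 2 / (p:ℝ) ≤ 2 / T := div_le_div_of_nonneg_left (by norm_num) (by linarith) hTp
                have := Real.add_one_le_exp (2 / (T:ℝ))
                linarith
              · rw [add_zero]; exact hf.2.2.2.2
          refine e1.trans ?_
          rw [← Finset.prod_filter, Finset.prod_const, ← Real.exp_nat_mul, hE]
          apply Real.exp_le_exp.2
          have : (R.card : ℝ) ≤ j + 2 := by exact_mod_cast hRc
          rw [mul_div_assoc', mul_comm (2:ℝ)]
          gcongr
      · intro p hp hpk
        have h1 := (Finset.mem_filter.1 hp).1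
        exact Nat.not_coprime_of_dvd_of_dvd (q1p p hp).1.one_lt hpk (Nat.dvd_of_mem_primeFactors h1) hc
    · rw [if_neg hc]
      refine mul_nonneg (Real.exp_pos _).le ?_
      split_ifs
      · exact hnn
      · exact le_rfl
  have hcard : Q1.card ≤ T := by
    have : Q1 ⊆ Finset.Icc 1 T := fun p hp => Finset.mem_Icc.2 ⟨(q1p p hp).1.pos, (q1p p hp).2⟩
    simpa using Finset.card_le_card this
  have h2 := card_small Q1 T r hT hcard
  set Y := 2 * a * b * L with hY
  have hY0 : 0 ≤ Y := by positivity
  have hbp : 0 < b := by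
    rcases hb.lt_or_eq with h | h
    · exact h
    · rw [← h] at hDb; simp at hDb; linarith
  have hW0 : 2 * a = Y / D := by rw [hDb, hY]; field_simp
  have i2 : ivp Q2 ≤ T := ivp_le T hT q2p
  have i1 : ivp Q1 ≤ T := ivp_le T hT q1p
  have i11 : 1 ≤ ivp Q1 := ivp_one fun p hp => (q1p p hp).1
  have i3 := two_le_ivp (Q := Q1) fun p hp => (q1p p hp).1
  have i4 := ivp_mul (Q := Q1) fun p hp => (q1p p hp).1
  have e2 : ∏ p ∈ Q2, (ap p + bp p) = ivp Q2 :=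
    Finset.prod_congr rfl fun p hp => (ab_facts (q2p p hp).1).2.2.2.1
  rw [e2, hW0] at hs
  set Z := ∏ p ∈ Q1, (1 - 1 / (p:ℝ)) with hZ
  have hZ0 : 0 < Z := by
    by_contra h
    nlinarith
  have h3 : Y * (Z + (∏ p ∈ Q1, (1 + 2 / (p:ℝ))) / 2 ^ (2 * r)) + Y / D * ivp Q2 *
      ((Q1.powerset.filter (fun s => s.card ≤ 2 * r)).card : ℝ) ≤
      Y * Z * (1 + (T:ℝ) ^ 3 / 2 ^ (2 * r) + 3 * (T:ℝ) ^ (2 * r + 2) / D) := by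
    have j1 : (∏ p ∈ Q1, (1 + 2 / (p:ℝ))) ≤ Z * (T:ℝ) ^ 3 := by
      calc _ ≤ ivp Q1 ^ 2 := i3
        _ = Z * ivp Q1 ^ 3 := by linear_combination (-(ivp Q1 ^ 2)) * i4
        _ ≤ _ := by gcongr
    have j2 : ivp Q2 * ((Q1.powerset.filter (fun s => s.card ≤ 2 * r)).card : ℝ) ≤
        Z * (3 * (T:ℝ) ^ (2 * r + 2)) := by
      calc _ ≤ T * (3 * (T:ℝ) ^ (2 * r)) := mul_le_mul i2 h2 (Nat.cast_nonneg _) (Nat.cast_nonneg _)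
        _ = 3 * (T:ℝ) ^ (2 * r + 1) * (Z * ivp Q1) := by rw [i4]; ring
        _ ≤ 3 * (T:ℝ) ^ (2 * r + 1) * (Z * T) := by gcongr
        _ = _ := by ring
    calc _ = Y * (Z + (∏ p ∈ Q1, (1 + 2 / (p:ℝ))) / 2 ^ (2 * r) +
          (ivp Q2 * ((Q1.powerset.filter (fun s => s.card ≤ 2 * r)).card : ℝ)) / D) := by ring
      _ ≤ Y * (Z + (Z * (T:ℝ) ^ 3) / 2 ^ (2 * r) + (Z * (3 * (T:ℝ) ^ (2 * r + 2))) / D) := by gcongr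
      _ = _ := by ring
  have hsplit : ivp (dp m n) * Z = ivp ((dp m n).filter (fun p => T ≤ p)) := by
    have : ivp (dp m n) = ivp ((dp m n).filter (fun p => T ≤ p)) * ivp Q1 :=
      (Finset.prod_filter_mul_prod_filter_not (dp m n) (fun p => T ≤ p) _).symm
    rw [this]; linear_combination ivp ((dp m n).filter (fun p => T ≤ p)) * i4
  have i5 : ivp ((dp m n).filter (fun p => T ≤ p)) ≤ Real.exp (2 * LL T m n) :=
    ivp_exp fun p hp => dp_prime (Finset.mem_filter.1 hp).1
  have hl : ∀ k, 0 ≤ lam ψ k := fun k => by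
    unfold lam; have := (hψ k).1; positivity
  have hl2 : 0 ≤ lam ψ m * lam ψ n := mul_nonneg (hl _) (hl _)
  have hX : 0 ≤ (1 + (T:ℝ) ^ 3 / 2 ^ (2 * r) + 3 * (T:ℝ) ^ (2 * r + 2) / D) := by positivity
  have hc0 := c0_nonneg m n
  have hE0 : 0 < E := Real.exp_pos _
  calc _ ≤ 2 * c0 m n * (E * (Y * Z * (1 + (T:ℝ) ^ 3 / 2 ^ (2 * r) + 3 * (T:ℝ) ^ (2 * r + 2) / D))) := by
        refine mul_le_mul_of_nonneg_left ?_ (by positivity)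
        refine h1.trans ?_
        refine mul_le_mul_of_nonneg_left ?_ hE0.le
        exact hs.trans h3
    _ = lam ψ m * lam ψ n * (ivp (dp m n) * Z) * (E * (1 + (T:ℝ) ^ 3 / 2 ^ (2 * r) + 3 * (T:ℝ) ^ (2 * r + 2) / D)) := by
        linear_combination (E * Z * (1 + (T:ℝ) ^ 3 / 2 ^ (2 * r) + 3 * (T:ℝ) ^ (2 * r + 2) / D)) * hYid
    _ ≤ _ := by
        rw [hsplit]
        gcongr
end
end QDS

namespace QDS

lemma ev_pow (M : ℕ) : ∃ s1 : ℕ, ∀ s ≥ s1, (s + 1) ^ M ≤ 2 ^ s := by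
  have h := tendsto_pow_const_div_const_pow_of_one_lt M (r := (2:ℝ)) (by norm_num)
  have h2 := h.eventually (gt_mem_nhds (show (0:ℝ) < 1 / 2 by norm_num))
  obtain ⟨s1, hs1⟩ := eventually_atTop.1 h2
  refine ⟨s1, fun s hs => ?_⟩
  have := hs1 (s + 1) (by omega)
  rw [div_lt_iff₀ (by positivity), pow_succ] at this
  have h3 : ((s + 1 : ℕ) : ℝ) ^ M ≤ 2 ^ s := by linarith
  exact_mod_cast h3

lemma Xj_aux (A : ℕ) : ∃ j1 : ℕ, 6 ≤ j1 ∧ ∀ j ≥ j1, ∃ r : ℕ,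
    (j ^ (A + 2)) ^ 3 * j ^ A ≤ 2 ^ (2 * r) ∧ 3 * (j ^ (A + 2)) ^ (2 * r + 2) * j ^ A ≤ 2 ^ j := by
  obtain ⟨s1, hs1⟩ := ev_pow (10 * A + 18)
  refine ⟨(s1 + 3) ^ 2, by have := Nat.pow_le_pow_left (show 3 ≤ s1 + 3 by omega) 2; omega, fun j hj => ⟨j.sqrt, ?_⟩⟩
  have hs : s1 + 3 ≤ j.sqrt := Nat.le_sqrt'.2 hj
  have h1 : j ≤ (j.sqrt + 1) ^ 2 := (Nat.lt_succ_sqrt' j).le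
  have h2 : j.sqrt ^ 2 ≤ j := Nat.sqrt_le' j
  generalize j.sqrt = s at *
  have hM := hs1 s (by omega)
  constructor
  · calc (j ^ (A + 2)) ^ 3 * j ^ A = j ^ (4 * A + 6) := by ring
      _ ≤ ((s + 1) ^ 2) ^ (4 * A + 6) := Nat.pow_le_pow_left h1 _
      _ = (s + 1) ^ (8 * A + 12) := by rw [← pow_mul]; congr 1; ring
      _ ≤ (s + 1) ^ (10 * A + 18) := Nat.pow_le_pow_right (by omega) (by omega)
      _ ≤ 2 ^ s := hM
      _ ≤ _ := Nat.pow_le_pow_right (by omega) (by omega)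
  · calc 3 * (j ^ (A + 2)) ^ (2 * s + 2) * j ^ A = 3 * j ^ ((A + 2) * (2 * s + 2) + A) := by
          rw [← pow_mul, mul_assoc, ← pow_add]
      _ ≤ 3 * ((s + 1) ^ 2) ^ ((A + 2) * (2 * s + 2) + A) := by gcongr
      _ = 3 * (s + 1) ^ (2 * ((A + 2) * (2 * s + 2) + A)) := by rw [← pow_mul]
      _ ≤ (s + 1) ^ 1 * (s + 1) ^ (2 * ((A + 2) * (2 * s + 2) + A)) := by
          rw [pow_one]; exact Nat.mul_le_mul_right _ (by omega)
      _ = (s + 1) ^ (1 + 2 * ((A + 2) * (2 * s + 2) + A)) := by rw [← pow_add]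
      _ ≤ (s + 1) ^ ((10 * A + 18) * s) := Nat.pow_le_pow_right (by omega) (by nlinarith)
      _ = ((s + 1) ^ (10 * A + 18)) ^ s := by rw [pow_mul]
      _ ≤ (2 ^ s) ^ s := Nat.pow_le_pow_left hM _
      _ = 2 ^ (s ^ 2) := by rw [← pow_mul, sq]
      _ ≤ _ := Nat.pow_le_pow_right (by omega) h2

lemma Xj (A : ℕ) : ∃ j1 : ℕ, 6 ≤ j1 ∧ ∀ j ≥ j1, ∃ r : ℕ, ∀ D : ℝ, 2 ^ j ≤ D →
    Real.exp (2 * (j + 2) / (j ^ (A + 2) : ℕ)) * (1 + ((j ^ (A + 2) : ℕ):ℝ) ^ 3 / 2 ^ (2 * r)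
      + 3 * ((j ^ (A + 2) : ℕ):ℝ) ^ (2 * r + 2) / D) ≤ 1 + 38 / (j:ℝ) ^ A := by
  obtain ⟨j1, hj6, h⟩ := Xj_aux A
  refine ⟨j1, hj6, fun j hj => ?_⟩
  obtain ⟨r, h1, h2⟩ := h j hj
  refine ⟨r, fun D hD => ?_⟩
  have hjR : (6:ℝ) ≤ j := by exact_mod_cast hj6.trans hj
  have h1' : (((j ^ (A + 2) : ℕ):ℝ)) ^ 3 * (j:ℝ) ^ A ≤ 2 ^ (2 * r) := by exact_mod_cast h1
  have h2' : 3 * (((j ^ (A + 2) : ℕ):ℝ)) ^ (2 * r + 2) * (j:ℝ) ^ A ≤ 2 ^ j := by exact_mod_cast h2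
  set e := 1 / (j:ℝ) ^ A with he
  have hjA : (1:ℝ) ≤ (j:ℝ) ^ A := one_le_pow₀ (by linarith)
  have he0 : 0 < e := by positivity
  have he1 : e ≤ 1 := by rw [he, div_le_one (by linarith)]; exact hjA
  have b1 : ((j ^ (A + 2) : ℕ):ℝ) ^ 3 / 2 ^ (2 * r) ≤ e := by
    rw [he, div_le_div_iff₀ (by positivity) (by linarith)]; linarith
  have b2 : 3 * ((j ^ (A + 2) : ℕ):ℝ) ^ (2 * r + 2) / D ≤ e := by
    have : (0:ℝ) < 2 ^ j := by positivity
    rw [he, div_le_div_iff₀ (by linarith) (by linarith)]; linarith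
  have b3 : 2 * ((j:ℝ) + 2) / (j ^ (A + 2) : ℕ) ≤ 6 * e / j := by
    rw [he]
    push_cast
    rw [mul_one_div, div_div, div_le_div_iff₀ (by positivity) (by positivity), pow_add]
    have : 2 * ((j:ℝ) + 2) ≤ 6 * j := by linarith
    calc 2 * ((j:ℝ) + 2) * ((j:ℝ) ^ A * j) ≤ 6 * j * ((j:ℝ) ^ A * j) := by gcongr
      _ = _ := by ring
  have b4 : 6 * e / j ≤ e := by
    rw [div_le_iff₀ (by linarith)]; nlinarith
  have b5 : Real.exp (2 * (j + 2) / (j ^ (A + 2) : ℕ)) ≤ 1 + 2 * e := by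
    refine (Real.exp_le_exp.2 (b3.trans b4)).trans ?_
    have := Real.abs_exp_sub_one_le (x := e) (by rw [abs_of_pos he0]; exact he1)
    rw [abs_of_pos he0] at this
    linarith [le_abs_self (Real.exp e - 1)]
  have e38 : 38 / (j:ℝ) ^ A = 38 * e := by rw [he]; ring
  rw [e38]
  have hD0 : 0 < D := lt_of_lt_of_le (by positivity) hD
  calc _ ≤ (1 + 2 * e) * (1 + e + e) := by gcongr
    _ ≤ _ := by nlinarith

lemma lam_nonneg {ψ : ℕ → ℝ} (hψ : ∀ n, ψ n ∈ Set.Icc (0:ℝ) (1/2)) (k : ℕ) : 0 ≤ lam ψ k := by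
  unfold lam; have := (hψ k).1; positivity

lemma LL_nonneg (t m n : ℕ) : 0 ≤ LL t m n := Finset.sum_nonneg fun p _ => by positivity

/-- kernel in `corB`. -/
noncomputable def KB (ψ : ℕ → ℝ) (t : ℕ) (c : ℝ) (v w : ℕ) : ℝ :=
  if (w:ℝ) * ψ v ≤ c * v.gcd w ∧ (v:ℝ) * ψ w ≤ c * v.gcd w then
    lam ψ v * lam ψ w * Real.exp (t * LL t v w) else 0

lemma KB_nonneg {ψ : ℕ → ℝ} (hψ : ∀ n, ψ n ∈ Set.Icc (0:ℝ) (1/2)) (t : ℕ) (c : ℝ) (v w : ℕ) :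
    0 ≤ KB ψ t c v w := by
  unfold KB
  have := lam_nonneg hψ v
  have := lam_nonneg hψ w
  split_ifs
  · positivity
  · exact le_rfl

lemma KB_of {ψ : ℕ → ℝ} {t : ℕ} {c : ℝ} {v w : ℕ} (hv : 0 < v) (h : DD ψ v w ≤ c) :
    KB ψ t c v w = lam ψ v * lam ψ w * Real.exp (t * LL t v w) := by
  unfold KB
  have hg : (0:ℝ) < (v.gcd w : ℝ) := by exact_mod_cast (Nat.gcd_pos_of_pos_left _ hv)
  unfold DD at h
  rw [div_le_iff₀ hg] at h
  rw [if_pos ⟨(le_max_left _ _).trans h, (le_max_right _ _).trans h⟩]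

lemma DD_lt {ψ : ℕ → ℝ} (hψ : ∀ n, ψ n ∈ Set.Icc (0:ℝ) (1/2)) {m n N : ℕ} (hm : 0 < m) (hn : 0 < n)
    (hmN : m ≤ N) (hnN : n ≤ N) : DD ψ m n ≤ N := by
  unfold DD
  have hg : (1:ℝ) ≤ (m.gcd n : ℝ) := by exact_mod_cast (Nat.gcd_pos_of_pos_left _ hm)
  have hmR : (m:ℝ) ≤ N := by exact_mod_cast hmN
  have hnR : (n:ℝ) ≤ N := by exact_mod_cast hnN
  have h0 : (0:ℝ) < m := by exact_mod_cast hm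
  have h0' : (0:ℝ) < n := by exact_mod_cast hn
  have h1 := hψ m
  have h2 := hψ n
  rw [div_le_iff₀ (by linarith)]
  have : (N:ℝ) ≤ N * (m.gcd n : ℝ) := by nlinarith
  exact max_le (by nlinarith [h1.1, h1.2]) (by nlinarith [h2.1, h2.2])

lemma pair_bound (A : ℕ) : ∃ j1 : ℕ, 6 ≤ j1 ∧ ∀ (ψ : ℕ → ℝ) (_ : ∀ n, ψ n ∈ Set.Icc (0:ℝ) (1/2))
    (N j0 : ℕ) (_ : j1 ≤ j0) (m n : ℕ) (_ : m ∈ Finset.Icc 1 N) (_ : n ∈ Finset.Icc 1 N) (_ : m ≠ n),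
    ∫ α, FF ψ m α * FF ψ n α ≤ KB ψ 2 (2 ^ j0) m n + lam ψ m * lam ψ n * (1 + 200 / (j0:ℝ) ^ A)
      + ∑ j ∈ Finset.Ico 1 (N + 1), 400 * Real.exp (- 2 * j) * KB ψ (j ^ (A + 2)) (2 ^ (j + 1)) m n := by
  obtain ⟨j1, hj6, h⟩ := Xj A
  refine ⟨j1, hj6, fun ψ hψ N j0 hj0 m n hm hn hmn => ?_⟩
  obtain ⟨hm, hmN⟩ := Finset.mem_Icc.1 hm
  obtain ⟨hn, hnN⟩ := Finset.mem_Icc.1 hn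
  have hl2 : 0 ≤ lam ψ m * lam ψ n := mul_nonneg (lam_nonneg hψ m) (lam_nonneg hψ n)
  have hs0 : ∀ j ∈ Finset.Ico 1 (N + 1), 0 ≤ 400 * Real.exp (- 2 * j) * KB ψ (j ^ (A + 2)) (2 ^ (j + 1)) m n :=
    fun j _ => mul_nonneg (by positivity) (KB_nonneg hψ _ _ _ _)
  have hs := Finset.sum_nonneg hs0
  have hmid : 0 ≤ lam ψ m * lam ψ n * (1 + 200 / (j0:ℝ) ^ A) := by positivity
  by_cases hlow : DD ψ m n ≤ 2 ^ j0
  · have h1 := overlap_crude ψ hψ hm hn hmn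
    rw [KB_of hm hlow]
    push_cast
    linarith
  rw [not_le] at hlow
  have hk0 := KB_nonneg hψ 2 (2 ^ j0) m n
  have hD1 : (1:ℝ) ≤ DD ψ m n := (one_le_pow₀ (by norm_num)).trans hlow.le
  set j := Nat.log 2 ⌊DD ψ m n⌋₊ with hj
  have hfl : ⌊DD ψ m n⌋₊ ≠ 0 := (Nat.floor_pos.2 hD1).ne'
  have hjl : (2:ℝ) ^ j ≤ DD ψ m n := by
    have h1 := Nat.pow_log_le_self 2 hfl
    have h2 := Nat.floor_le (zero_le_one.trans hD1)
    have : ((2 ^ j : ℕ):ℝ) ≤ (⌊DD ψ m n⌋₊ : ℝ) := by exact_mod_cast h1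
    push_cast at this
    linarith
  have hju : DD ψ m n < 2 ^ (j + 1) := by
    have h1 := Nat.lt_pow_succ_log_self (b := 2) (by norm_num) ⌊DD ψ m n⌋₊
    have := (Nat.floor_lt (zero_le_one.trans hD1)).1 h1
    push_cast at this
    exact this
  have hjj : j0 ≤ j := by
    have : (2:ℝ) ^ j0 < 2 ^ (j + 1) := hlow.trans hju
    have := (pow_lt_pow_iff_right₀ (by norm_num : (1:ℝ) < 2)).1 this
    omega
  have hjN : j < N + 1 := by
    have h1 := hjl.trans (DD_lt hψ hm hn hmN hnN)
    have h2 : 2 ^ j ≤ N := by exact_mod_cast h1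
    have := Nat.lt_two_pow_self (n := j)
    omega
  clear_value j
  obtain ⟨r, hr⟩ := h j (hj0.trans hjj)
  have hX := hr _ hjl
  have hj6' : 6 ≤ j := hj6.trans (hj0.trans hjj)
  have hjR : (6:ℝ) ≤ j := by exact_mod_cast hj6'
  have hT1 : 1 ≤ j ^ (A + 2) := Nat.one_le_pow _ _ (by omega)
  have hsh := overlap_sharp ψ hψ hm hn hmn (j ^ (A + 2)) r j hT1 (by linarith) hju
  have hj0R : (6:ℝ) ≤ j0 := by exact_mod_cast hj6.trans hj0
  have hjA : (1:ℝ) ≤ (j:ℝ) ^ A := one_le_pow₀ (by linarith)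
  have hej : 1 / (j:ℝ) ^ A ≤ 1 / (j0:ℝ) ^ A := by
    have : (j0:ℝ) ≤ j := by exact_mod_cast hjj
    exact one_div_le_one_div_of_le (by positivity) (by gcongr)
  set e := 1 / (j:ℝ) ^ A with he
  have he0 : 0 < e := by positivity
  have he1 : e ≤ 1 := by rw [he, div_le_one (by linarith)]; exact hjA
  have hX2 : Real.exp (2 * (j + 2) / (j ^ (A + 2) : ℕ)) * (1 + ((j ^ (A + 2) : ℕ):ℝ) ^ 3 / 2 ^ (2 * r)
      + 3 * ((j ^ (A + 2) : ℕ):ℝ) ^ (2 * r + 2) / DD ψ m n) ≤ 1 + 38 * e := by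
    rw [he, mul_one_div]; exact hX
  have hsh2 := hsh.trans (mul_le_mul_of_nonneg_left hX2 (by positivity))
  have hLL := LL_nonneg (j ^ (A + 2)) m n
  by_cases hgood : 2 * LL (j ^ (A + 2)) m n ≤ e
  · have hexp : Real.exp (2 * LL (j ^ (A + 2)) m n) ≤ 1 + 2 * e := by
      refine (Real.exp_le_exp.2 hgood).trans ?_
      have := Real.abs_exp_sub_one_le (x := e) (by rw [abs_of_pos he0]; exact he1)
      rw [abs_of_pos he0] at this
      linarith [le_abs_self (Real.exp e - 1)]
    have : ∫ α, FF ψ m α * FF ψ n α ≤ lam ψ m * lam ψ n * (1 + 200 / (j0:ℝ) ^ A) := by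
      refine hsh2.trans ?_
      rw [mul_assoc]
      refine mul_le_mul_of_nonneg_left ?_ hl2
      have e200 : 200 / (j0:ℝ) ^ A = 200 * (1 / (j0:ℝ) ^ A) := by ring
      rw [e200]
      calc _ ≤ (1 + 2 * e) * (1 + 38 * e) := by gcongr
        _ ≤ 1 + 200 * e := by nlinarith
        _ ≤ _ := by linarith
    linarith
  · rw [not_le] at hgood
    have hmem : j ∈ Finset.Ico 1 (N + 1) := Finset.mem_Ico.2 ⟨by omega, hjN⟩
    have hle := Finset.single_le_sum hs0 hmem
    rw [KB_of hm hju.le] at hle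
    have : ∫ α, FF ψ m α * FF ψ n α ≤ 400 * Real.exp (- 2 * j) *
        (lam ψ m * lam ψ n * Real.exp ((j ^ (A + 2) : ℕ) * LL (j ^ (A + 2)) m n)) := by
      refine hsh2.trans ?_
      have h1 : Real.exp (2 * LL (j ^ (A + 2)) m n) ≤
          Real.exp (- 2 * j) * Real.exp ((j ^ (A + 2) : ℕ) * LL (j ^ (A + 2)) m n) := by
        rw [← Real.exp_add]
        apply Real.exp_le_exp.2
        generalize LL (j ^ (A + 2)) m n = l at *
        push_cast
        have h2 : (j:ℝ) ^ 2 ≤ 2 * ((j:ℝ) ^ (A + 2) * l) := by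
          have : (j:ℝ) ^ (A + 2) * e = j ^ 2 := by rw [he, pow_add]; field_simp
          have h3 : (j:ℝ) ^ (A + 2) * e ≤ (j:ℝ) ^ (A + 2) * (2 * l) := by gcongr
          linarith
        have h4 : 36 * l ≤ (j:ℝ) ^ (A + 2) * l := by
          refine mul_le_mul_of_nonneg_right ?_ hLL
          rw [pow_add]; nlinarith
        nlinarith
      calc _ ≤ lam ψ m * lam ψ n * (Real.exp (- 2 * j) * Real.exp ((j ^ (A + 2) : ℕ) * LL (j ^ (A + 2)) m n)) * 400 := by
            gcongr
            linarith
        _ = _ := by ring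
    linarith

end QDS

namespace QDS

lemma diag (ψ : ℕ → ℝ) (hψ : ∀ n, ψ n ∈ Set.Icc (0:ℝ) (1/2)) {n : ℕ} (hn : 0 < n) :
    ∫ α, FF ψ n α * FF ψ n α ≤ lam ψ n := by
  have hnR : (0:ℝ) < n := by exact_mod_cast hn
  have h1 := (hψ n).1
  have h2 := (hψ n).2
  rw [← FF_int ψ (fun n => (hψ n).1) n]
  simp_rw [FFmul_eq]
  rw [integral_finsetSum _ fun x _ => ind_mul_integrable _ _ _ _]
  unfold FF
  rw [integral_finsetSum _ fun a _ =>
    (integrable_indicator_iff measurableSet_Icc).2 (by simp [integrableOn_const_iff])]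
  have hprs : prs n n = ((Finset.range n).filter (fun a => a.Coprime n)) ×ˢ
      ((Finset.range n).filter (fun a => a.Coprime n)) := by
    ext x; simp only [prs, Finset.mem_filter, Finset.mem_product]; tauto
  rw [hprs, Finset.sum_product]
  refine Finset.sum_le_sum fun a ha => ?_
  rw [Finset.sum_eq_single a]
  · simp only
    rw [int_ind_mul, int_ind, min_self, max_self, max_eq_right]
    · have : 0 ≤ ψ n / n := by positivity
      linarith
    · have : 0 ≤ ψ n / n := by positivity
      linarith
  · intro b hb hab
    simp only
    rw [int_ind_mul]
    apply max_eq_left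
    have hd : ψ n / n ≤ 1 / 2 / n := by gcongr
    have hab' : (a:ℝ) + 1 ≤ b ∨ (b:ℝ) + 1 ≤ a := by
      rcases lt_or_gt_of_ne hab with h | h
      · right; exact_mod_cast h
      · left; exact_mod_cast h
    have e2 : 1 / 2 / (n:ℝ) + 1 / 2 / n = 1 / n := by ring
    rcases hab' with h | h
    · have h3 : ((a:ℝ) + 1) / n ≤ b / n := by gcongr
      rw [add_div] at h3
      have := min_le_left ((a:ℝ) / n + ψ n / n) ((b:ℝ) / n + ψ n / n)
      have := le_max_right ((a:ℝ) / n - ψ n / n) ((b:ℝ) / n - ψ n / n)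
      linarith
    · have h3 : ((b:ℝ) + 1) / n ≤ a / n := by gcongr
      rw [add_div] at h3
      have := min_le_right ((a:ℝ) / n + ψ n / n) ((b:ℝ) / n + ψ n / n)
      have := le_max_left ((a:ℝ) / n - ψ n / n) ((b:ℝ) / n - ψ n / n)
      linarith
  · intro h; exact absurd ha h

lemma KB_sum : ∃ C : ℝ, 0 < C ∧ ∀ (t N : ℕ) (_ : 1 ≤ t) (ψ : ℕ → ℝ) (_ : ∀ n, 0 ≤ ψ n) (c : ℝ) (_ : 0 < c),
    ∑ v ∈ Finset.Icc 1 N, ∑ w ∈ Finset.Icc 1 N, KB ψ t c v w ≤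
      C * Real.sqrt c * ((∑ n ∈ Finset.Icc 1 N, lam ψ n) * Real.sqrt (∑ n ∈ Finset.Icc 1 N, lam ψ n)) := corB

lemma geo_bd (n : ℕ) : ∑ j ∈ Finset.Ico 1 n, Real.exp (-2 * j) * Real.sqrt (2 ^ (j + 1)) ≤ 2 := by
  have h : ∀ j ∈ Finset.Ico 1 n, Real.exp (-2 * j) * Real.sqrt (2 ^ (j + 1)) ≤ (1/2:ℝ) ^ j := by
    intro j hj
    have hj1 := (Finset.mem_Ico.1 hj).1
    have hs : Real.sqrt (2 ^ (j + 1)) ≤ 2 ^ j := by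
      rw [Real.sqrt_le_left (by positivity), ← pow_mul]
      exact pow_le_pow_right₀ (by norm_num) (by omega)
    have he : Real.exp (-2 * j) ≤ (1/4:ℝ) ^ j := by
      have : Real.exp (-2 * j) = (Real.exp (-2)) ^ j := by rw [← Real.exp_nat_mul]; ring_nf
      rw [this]
      have h2 : Real.exp (-2) ≤ 1/4 := by
        rw [Real.exp_neg, one_div]
        apply inv_anti₀ (by norm_num)
        have := Real.add_one_le_exp (1:ℝ)
        have e : Real.exp 2 = Real.exp 1 * Real.exp 1 := by rw [← Real.exp_add]; norm_num
        rw [e]; nlinarith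
      exact pow_le_pow_left₀ (Real.exp_pos _).le h2 j
    calc _ ≤ (1/4:ℝ) ^ j * 2 ^ j := by gcongr
      _ = _ := by rw [← mul_pow]; norm_num
  refine (Finset.sum_le_sum h).trans ?_
  calc ∑ j ∈ Finset.Ico 1 n, (1/2:ℝ) ^ j ≤ ∑' j : ℕ, (1/2:ℝ) ^ j :=
        Summable.sum_le_tsum _ (fun _ _ => by positivity) summable_geometric_two
    _ = 2 := tsum_geometric_two

/-- second moment bound with a free parameter `j0` -/
lemma second_moment (A : ℕ) : ∃ j1 : ℕ, 6 ≤ j1 ∧ ∃ C : ℝ, 0 < C ∧ ∀ (ψ : ℕ → ℝ)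
    (_ : ∀ n, ψ n ∈ Set.Icc (0:ℝ) (1/2)) (N j0 : ℕ) (_ : j1 ≤ j0) (P : ℝ)
    (_ : P = ∑ n ∈ Finset.Icc 1 N, lam ψ n),
    ∫ α, (∑ n ∈ Finset.Icc 1 N, FF ψ n α) ^ 2 ≤ P + C * Real.sqrt (2 ^ j0) * (P * Real.sqrt P)
      + P ^ 2 * (1 + 200 / (j0:ℝ) ^ A) + 800 * C * (P * Real.sqrt P) := by
  obtain ⟨j1, hj6, hpair⟩ := pair_bound A
  obtain ⟨C, hC, hKB⟩ := KB_sum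
  refine ⟨j1, hj6, C, hC, fun ψ hψ N j0 hj0 P hP => ?_⟩
  have hψ0 : ∀ n, 0 ≤ ψ n := fun n => (hψ n).1
  have e1 : ∫ α, (∑ n ∈ Finset.Icc 1 N, FF ψ n α) ^ 2 =
      ∑ m ∈ Finset.Icc 1 N, ∑ n ∈ Finset.Icc 1 N, ∫ α, FF ψ m α * FF ψ n α := by
    simp_rw [sq, Finset.sum_mul_sum]
    rw [integral_finsetSum _ fun m _ => integrable_finsetSum _ fun n _ => FFmul_integrable ψ m n]
    exact Finset.sum_congr rfl fun m _ => integral_finsetSum _ fun n _ => FFmul_integrable ψ m n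
  rw [e1]
  have e2 : ∀ m ∈ Finset.Icc 1 N, ∀ n ∈ Finset.Icc 1 N, ∫ α, FF ψ m α * FF ψ n α ≤
      (if m = n then lam ψ m else 0) + (KB ψ 2 (2 ^ j0) m n + lam ψ m * lam ψ n * (1 + 200 / (j0:ℝ) ^ A)
      + ∑ j ∈ Finset.Ico 1 (N + 1), 400 * Real.exp (- 2 * j) * KB ψ (j ^ (A + 2)) (2 ^ (j + 1)) m n) := by
    intro m hm n hn
    by_cases h : m = n
    · subst h
      rw [if_pos rfl]
      have h1 := diag ψ hψ (Finset.mem_Icc.1 hm).1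
      have h2 := KB_nonneg hψ 2 (2 ^ j0) m m
      have h3 : 0 ≤ lam ψ m * lam ψ m * (1 + 200 / (j0:ℝ) ^ A) := by
        have := lam_nonneg hψ m
        positivity
      have h4 : 0 ≤ ∑ j ∈ Finset.Ico 1 (N + 1), 400 * Real.exp (- 2 * j) * KB ψ (j ^ (A + 2)) (2 ^ (j + 1)) m m :=
        Finset.sum_nonneg fun j _ => mul_nonneg (by positivity) (KB_nonneg hψ _ _ _ _)
      linarith
    · rw [if_neg h, zero_add]
      exact hpair ψ hψ N j0 hj0 m n hm hn h
  refine (Finset.sum_le_sum fun m hm => Finset.sum_le_sum fun n hn => e2 m hm n hn).trans ?_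
  simp_rw [Finset.sum_add_distrib]
  have t1 : ∑ m ∈ Finset.Icc 1 N, ∑ n ∈ Finset.Icc 1 N, (if m = n then lam ψ m else 0) ≤ P := by
    rw [hP]
    refine Finset.sum_le_sum fun m hm => ?_
    rw [Finset.sum_ite_eq, if_pos hm]
  have t2 := hKB 2 N (by norm_num) ψ hψ0 (2 ^ j0) (by positivity)
  have t3 : ∑ m ∈ Finset.Icc 1 N, ∑ n ∈ Finset.Icc 1 N, lam ψ m * lam ψ n * (1 + 200 / (j0:ℝ) ^ A) =
      P ^ 2 * (1 + 200 / (j0:ℝ) ^ A) := by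
    rw [hP, sq, Finset.sum_mul_sum]
    simp_rw [Finset.sum_mul]
  have t4 : ∑ m ∈ Finset.Icc 1 N, ∑ n ∈ Finset.Icc 1 N, ∑ j ∈ Finset.Ico 1 (N + 1),
      400 * Real.exp (- 2 * j) * KB ψ (j ^ (A + 2)) (2 ^ (j + 1)) m n ≤ 800 * C * (P * Real.sqrt P) := by
    have : ∀ m ∈ Finset.Icc 1 N, ∑ n ∈ Finset.Icc 1 N, ∑ j ∈ Finset.Ico 1 (N + 1),
      400 * Real.exp (- 2 * j) * KB ψ (j ^ (A + 2)) (2 ^ (j + 1)) m n = ∑ j ∈ Finset.Ico 1 (N + 1),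
        ∑ n ∈ Finset.Icc 1 N, 400 * Real.exp (- 2 * j) * KB ψ (j ^ (A + 2)) (2 ^ (j + 1)) m n :=
      fun m _ => Finset.sum_comm
    rw [Finset.sum_congr rfl this, Finset.sum_comm]
    have hP0 : 0 ≤ P := by rw [hP]; exact Finset.sum_nonneg fun n _ => lam_nonneg hψ n
    have hj : ∀ j ∈ Finset.Ico 1 (N + 1), ∑ m ∈ Finset.Icc 1 N, ∑ n ∈ Finset.Icc 1 N,
        400 * Real.exp (- 2 * j) * KB ψ (j ^ (A + 2)) (2 ^ (j + 1)) m n ≤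
        400 * C * (P * Real.sqrt P) * (Real.exp (-2 * j) * Real.sqrt (2 ^ (j + 1))) := by
      intro j hj
      have hj1 := (Finset.mem_Ico.1 hj).1
      have := hKB (j ^ (A + 2)) N (Nat.one_le_pow _ _ hj1) ψ hψ0 (2 ^ (j + 1)) (by positivity)
      rw [← hP] at this
      simp_rw [← Finset.mul_sum]
      calc _ ≤ 400 * Real.exp (- 2 * j) * (C * Real.sqrt (2 ^ (j + 1)) * (P * Real.sqrt P)) := by gcongr
        _ = _ := by ring
    refine (Finset.sum_le_sum hj).trans ?_
    rw [← Finset.mul_sum]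
    have := geo_bd (N + 1)
    calc _ ≤ 400 * C * (P * Real.sqrt P) * 2 := by gcongr
      _ = _ := by ring
  rw [← hP] at t2
  rw [t3]
  linarith

lemma second_moment2 (A : ℕ) : ∃ C : ℝ, 0 < C ∧ ∃ P0 : ℝ, 3 ≤ P0 ∧ ∀ (ψ : ℕ → ℝ)
    (_ : ∀ n, ψ n ∈ Set.Icc (0:ℝ) (1/2)) (N : ℕ) (P : ℝ)
    (_ : P = ∑ n ∈ Finset.Icc 1 N, lam ψ n), P0 ≤ P →
    (∫ α, (∑ n ∈ Finset.Icc 1 N, FF ψ n α) ^ 2) + 2 * P ≤ P ^ 2 + C * (P ^ 2 / (Real.log P) ^ A) := by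
  obtain ⟨j1, hj6, C, hC, h⟩ := second_moment A
  have hlim : ∀ᶠ x : ℝ in atTop, (Real.log x) ^ A ≤ x ^ (1/4:ℝ) := by
    have := (isLittleO_log_rpow_rpow_atTop (A:ℝ) (by norm_num : (0:ℝ) < 1/4)).bound
      (by norm_num : (0:ℝ) < 1)
    filter_upwards [this, eventually_ge_atTop 1] with x hx h1
    rw [Real.norm_of_nonneg (Real.rpow_nonneg (Real.log_nonneg h1) _),
      Real.norm_of_nonneg (by positivity), Real.rpow_natCast, one_mul] at hx
    exact hx
  obtain ⟨P1, hP1⟩ := eventually_atTop.1 hlim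
  refine ⟨3 + C + 200 * 4 ^ A + 800 * C, by positivity,
    max (max P1 3) (Real.exp (2 * j1 + 4)), (le_max_right _ _).trans (le_max_left _ _), ?_⟩
  intro ψ hψ N P hP hPP
  have p1 : P1 ≤ P := (le_max_left _ _).trans ((le_max_left _ _).trans hPP)
  have p3 : 3 ≤ P := (le_max_right _ _).trans ((le_max_left _ _).trans hPP)
  have pe : Real.exp (2 * j1 + 4) ≤ P := (le_max_right _ _).trans hPP
  have p0 : 0 < P := by linarith
  have hl : 2 * (j1:ℝ) + 4 ≤ Real.log P := (Real.le_log_iff_exp_le p0).2 pe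
  have hlog := hP1 P p1
  set j0 := ⌊Real.log P / 2⌋₊ with hj0
  have hj1 : (0:ℝ) ≤ j1 := Nat.cast_nonneg _
  have a1 : (j0:ℝ) ≤ Real.log P / 2 := Nat.floor_le (by linarith)
  have a2 : Real.log P / 2 < j0 + 1 := Nat.lt_floor_add_one _
  have a3 : j1 ≤ j0 := Nat.le_floor (by linarith)
  have a4 : Real.log P / 4 ≤ j0 := by linarith
  clear_value j0
  have hm := h ψ hψ N j0 a3 P hP
  have hL : 0 < Real.log P := by linarith
  -- bounds
  have q : P ^ (1/4:ℝ) * (P ^ (1/4:ℝ) * Real.sqrt P) = P := by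
    rw [Real.sqrt_eq_rpow, ← Real.rpow_add p0, ← Real.rpow_add p0]; norm_num
  have r1 : Real.sqrt (2 ^ j0) ≤ P ^ (1/4:ℝ) := by
    have : (2:ℝ) ^ j0 ≤ P ^ (1/2:ℝ) := by
      calc (2:ℝ) ^ j0 ≤ (Real.exp 1) ^ j0 := by
            gcongr
            linarith [Real.add_one_le_exp (1:ℝ)]
        _ = Real.exp j0 := by rw [← Real.exp_nat_mul]; simp
        _ ≤ Real.exp (Real.log P * (1/2)) := Real.exp_le_exp.2 (by linarith)
        _ = _ := by rw [Real.rpow_def_of_pos p0]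
    rw [Real.sqrt_le_left (by positivity)]
    rw [sq, ← Real.rpow_add p0]
    norm_num at this ⊢
    exact this
  have r0 : (1:ℝ) ≤ P ^ (1/4:ℝ) := Real.one_le_rpow (by linarith) (by norm_num)
  set Q := P ^ (1/4:ℝ) with hQ
  set s := Real.sqrt P with hs
  have hs1 : 0 ≤ s := Real.sqrt_nonneg _
  set l := (Real.log P) ^ A with hl'
  have hl0 : 0 < l := by positivity
  have w : P / l * l = P := by field_simp
  have k1 : Q * (P * s) ≤ P ^ 2 / l := by
    rw [le_div_iff₀ hl0]
    calc Q * (P * s) * l ≤ Q * (P * s) * Q := by gcongr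
      _ = P * (Q * (Q * s)) := by ring
      _ = P ^ 2 := by rw [q]; ring
  have k2 : P * s ≤ P ^ 2 / l := le_trans (by nlinarith [mul_nonneg p0.le hs1]) k1
  have k3 : P ≤ P ^ 2 / l := by
    refine le_trans ?_ k2
    have : 1 ≤ s := by rw [hs]; exact Real.one_le_sqrt.2 (by linarith)
    nlinarith
  have k4 : 200 / (j0:ℝ) ^ A ≤ 200 * 4 ^ A / l := by
    have : (Real.log P / 4) ^ A ≤ (j0:ℝ) ^ A := by gcongr
    calc 200 / (j0:ℝ) ^ A ≤ 200 / (Real.log P / 4) ^ A := by gcongr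
      _ = _ := by rw [div_pow, ← hl']; field_simp
  calc _ ≤ P + C * Q * (P * s) + P ^ 2 * (1 + 200 * 4 ^ A / l) + 800 * C * (P * s) + 2 * P := by
        have : C * Real.sqrt (2 ^ j0) * (P * s) ≤ C * Q * (P * s) := by gcongr
        have : P ^ 2 * (1 + 200 / (j0:ℝ) ^ A) ≤ P ^ 2 * (1 + 200 * 4 ^ A / l) := by gcongr
        linarith
    _ = 3 * P + C * (Q * (P * s)) + P ^ 2 + 200 * 4 ^ A * (P ^ 2 / l) + 800 * C * (P * s) := by ring
    _ ≤ 3 * (P ^ 2 / l) + C * (P ^ 2 / l) + P ^ 2 + 200 * 4 ^ A * (P ^ 2 / l) + 800 * C * (P ^ 2 / l) := by gcongr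
    _ = _ := by ring

end QDS

namespace QDS

lemma lam_le_one {ψ : ℕ → ℝ} (hψ : ∀ n, ψ n ∈ Set.Icc (0:ℝ) (1/2)) (n : ℕ) : lam ψ n ≤ 1 := by
  unfold lam
  rcases Nat.eq_zero_or_pos n with h | h
  · subst h; simp
  have hnR : (0:ℝ) < n := by exact_mod_cast h
  rw [div_le_one hnR]
  have h1 := (hψ n).1
  have h2 := (hψ n).2
  have h3 : (Nat.totient n : ℝ) ≤ n := by exact_mod_cast Nat.totient_le n
  have h4 : (0:ℝ) ≤ Nat.totient n := Nat.cast_nonneg _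
  nlinarith

lemma FF_supp {ψ : ℕ → ℝ} (hψ : ∀ n, ψ n ∈ Set.Icc (0:ℝ) (1/2)) {n : ℕ} (hn : 2 ≤ n) (α : ℝ)
    (hα : α ∉ Set.Icc (0:ℝ) 1) : FF ψ n α = 0 := by
  unfold FF
  refine Finset.sum_eq_zero fun a ha => ?_
  rw [Finset.mem_filter, Finset.mem_range] at ha
  apply Set.indicator_of_notMem
  intro h
  apply hα
  have hnR : (2:ℝ) ≤ n := by exact_mod_cast hn
  have ha1 : 1 ≤ a := by
    rcases Nat.eq_zero_or_pos a with h0 | h0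
    · rw [h0, Nat.coprime_zero_left] at ha; omega
    · exact h0
  have ha1R : (1:ℝ) ≤ a := by exact_mod_cast ha1
  have ha2R : (a:ℝ) + 1 ≤ n := by exact_mod_cast ha.1
  have h2 := (hψ n).2
  rw [← sub_div, ← add_div] at h
  refine ⟨le_trans ?_ h.1, h.2.trans ?_⟩
  · apply div_nonneg <;> linarith
  · rw [div_le_one (by linarith)]; linarith

lemma FF_int01 {ψ : ℕ → ℝ} (hψ : ∀ n, ψ n ∈ Set.Icc (0:ℝ) (1/2)) (N : ℕ) :
    (∑ n ∈ Finset.Icc 1 N, lam ψ n) - 1 ≤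
      ∫ α in Set.Icc (0:ℝ) 1, ∑ n ∈ Finset.Icc 1 N, FF ψ n α := by
  rw [integral_finsetSum _ fun n _ => (FF_integrable ψ n).integrableOn]
  have h : ∀ n ∈ Finset.Icc 1 N, lam ψ n - (if n = 1 then 1 else 0) ≤
      ∫ α in Set.Icc (0:ℝ) 1, FF ψ n α := by
    intro n hn
    have hn1 := (Finset.mem_Icc.1 hn).1
    by_cases h1 : n = 1
    · rw [if_pos h1]
      have := lam_le_one hψ n
      have h2 : 0 ≤ ∫ α in Set.Icc (0:ℝ) 1, FF ψ n α := integral_nonneg fun α => FF_nonneg ψ n α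
      linarith
    · rw [if_neg h1, sub_zero, ← FF_int ψ (fun n => (hψ n).1) n]
      exact (setIntegral_eq_integral_of_forall_compl_eq_zero
        fun α hα => FF_supp hψ (by omega) α hα).ge
  refine le_trans ?_ (Finset.sum_le_sum h)
  rw [Finset.sum_sub_distrib, Finset.sum_ite_eq']
  split_ifs <;> linarith

lemma SF_sq_integrable (ψ : ℕ → ℝ) (N : ℕ) :
    Integrable (fun α => (∑ n ∈ Finset.Icc 1 N, FF ψ n α) ^ 2) volume := by
  simp_rw [sq, Finset.sum_mul_sum]
  exact integrable_finsetSum _ fun m _ => integrable_finsetSum _ fun n _ => FFmul_integrable ψ m n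

lemma dev_integrable (ψ : ℕ → ℝ) (N : ℕ) (P : ℝ) :
    Integrable (fun α => ((∑ n ∈ Finset.Icc 1 N, FF ψ n α) - P) ^ 2)
      (volume.restrict (Set.Icc (0:ℝ) 1)) := by
  have h1 := (SF_sq_integrable ψ N).integrableOn (s := Set.Icc (0:ℝ) 1)
  have h2 : Integrable (fun α => ∑ n ∈ Finset.Icc 1 N, FF ψ n α) (volume.restrict (Set.Icc (0:ℝ) 1)) :=
    integrable_finsetSum _ fun n _ => (FF_integrable ψ n).integrableOn
  have h3 : Integrable (fun _ : ℝ => P ^ 2) (volume.restrict (Set.Icc (0:ℝ) 1)) := integrable_const _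
  have := (h1.sub (h2.const_mul (2 * P))).add h3
  refine this.congr (Eventually.of_forall fun α => ?_)
  simp only [Pi.add_apply, Pi.sub_apply]
  ring

lemma variance (A : ℕ) : ∃ C : ℝ, 0 < C ∧ ∃ P0 : ℝ, 3 ≤ P0 ∧ ∀ (ψ : ℕ → ℝ)
    (_ : ∀ n, ψ n ∈ Set.Icc (0:ℝ) (1/2)) (N : ℕ) (P : ℝ)
    (_ : P = ∑ n ∈ Finset.Icc 1 N, lam ψ n), P0 ≤ P →
    ∫ α in Set.Icc (0:ℝ) 1, ((∑ n ∈ Finset.Icc 1 N, FF ψ n α) - P) ^ 2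
      ≤ C * (P ^ 2 / (Real.log P) ^ A) := by
  obtain ⟨C, hC, P0, hP0, h⟩ := second_moment2 A
  refine ⟨C, hC, P0, hP0, fun ψ hψ N P hP hPP => ?_⟩
  have h0 := h ψ hψ N P hP hPP
  have h1 := (SF_sq_integrable ψ N).integrableOn (s := Set.Icc (0:ℝ) 1)
  have h2 : Integrable (fun α => ∑ n ∈ Finset.Icc 1 N, FF ψ n α) (volume.restrict (Set.Icc (0:ℝ) 1)) :=
    integrable_finsetSum _ fun n _ => (FF_integrable ψ n).integrableOn
  have h3 : Integrable (fun _ : ℝ => P ^ 2) (volume.restrict (Set.Icc (0:ℝ) 1)) := integrable_const _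
  have e : ∫ α in Set.Icc (0:ℝ) 1, ((∑ n ∈ Finset.Icc 1 N, FF ψ n α) - P) ^ 2 =
      (∫ α in Set.Icc (0:ℝ) 1, (∑ n ∈ Finset.Icc 1 N, FF ψ n α) ^ 2) -
      2 * P * (∫ α in Set.Icc (0:ℝ) 1, ∑ n ∈ Finset.Icc 1 N, FF ψ n α) + P ^ 2 := by
    have e3 : ∫ α in Set.Icc (0:ℝ) 1, P ^ 2 = P ^ 2 := by simp
    have hs : Integrable (fun α => (∑ n ∈ Finset.Icc 1 N, FF ψ n α) ^ 2 -
        2 * P * ∑ n ∈ Finset.Icc 1 N, FF ψ n α) (volume.restrict (Set.Icc (0:ℝ) 1)) :=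
      Integrable.sub h1 (h2.const_mul _)
    have e4 := integral_add hs h3
    rw [integral_sub h1 (h2.const_mul _), e3, integral_const_mul] at e4
    rw [← e4]
    refine integral_congr_ae (Eventually.of_forall fun α => ?_)
    simp only
    ring
  rw [e]
  have h4 : ∫ α in Set.Icc (0:ℝ) 1, (∑ n ∈ Finset.Icc 1 N, FF ψ n α) ^ 2 ≤
      ∫ α, (∑ n ∈ Finset.Icc 1 N, FF ψ n α) ^ 2 :=
    setIntegral_le_integral (SF_sq_integrable ψ N) (Eventually.of_forall fun α => sq_nonneg _)
  have h5 := FF_int01 hψ N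
  rw [← hP] at h5
  nlinarith

end QDS

namespace QDS

open Classical in
noncomputable def sol (ψ : ℕ → ℝ) (α : ℝ) (n : ℕ) : Finset ℕ :=
  ((Finset.range n).filter (fun a => a.Coprime n)).filter
    (fun a : ℕ => α ∈ Set.Icc ((a:ℝ) / n - ψ n / n) ((a:ℝ) / n + ψ n / n))

lemma FF_card (ψ : ℕ → ℝ) (α : ℝ) (n : ℕ) : FF ψ n α = (sol ψ α n).card := by
  classical
  unfold FF sol
  rw [← Finset.sum_boole]
  refine Finset.sum_congr rfl fun a _ => ?_
  rw [Set.indicator_apply]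

lemma S_close {ψ : ℕ → ℝ} (hψ : ∀ n, ψ n ∈ Set.Icc (0:ℝ) (1/2)) (N : ℕ) (α : ℝ)
    (hα : α ∈ Set.Icc (0:ℝ) 1) :
    |(S ψ N α : ℝ) - ∑ n ∈ Finset.Icc 1 N, FF ψ n α| ≤ 2 := by
  classical
  set G : Finset (Σ _ : ℕ, ℕ) := (Finset.Icc 1 N).sigma (fun n => sol ψ α n) with hG
  have hF : ∑ n ∈ Finset.Icc 1 N, FF ψ n α = (G.card : ℝ) := by
    rw [hG, Finset.card_sigma]; push_cast
    exact Finset.sum_congr rfl fun n _ => FF_card ψ α n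
  set f : (Σ _ : ℕ, ℕ) → ℤ × ℕ := fun x => ((x.2 : ℤ), x.1) with hf
  have hinj : Function.Injective f := by
    rintro ⟨n, a⟩ ⟨m, b⟩ h
    simp only [hf, Prod.mk.injEq, Nat.cast_inj] at h
    obtain ⟨h1, h2⟩ := h
    subst h1; subst h2; rfl
  have hcard : (G.image f).card = G.card := Finset.card_image_of_injective _ hinj
  set T : Set (ℤ × ℕ) := {p : ℤ × ℕ | 1 ≤ p.2 ∧ p.2 ≤ N ∧ Int.gcd p.1 (p.2 : ℤ) = 1 ∧
    |α - (p.1 : ℝ) / (p.2 : ℝ)| ≤ ψ p.2 / p.2} with hT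
  have hS : S ψ N α = T.ncard := rfl
  have hsub1 : ((G.image f : Finset (ℤ × ℕ)) : Set (ℤ × ℕ)) ⊆ T := by
    intro p hp
    rw [Finset.mem_coe, Finset.mem_image] at hp
    obtain ⟨⟨n, a⟩, hx, rfl⟩ := hp
    rw [hG, Finset.mem_sigma] at hx
    obtain ⟨h1, h2⟩ := hx
    simp only [sol, Finset.mem_filter, Finset.mem_Icc, Set.mem_Icc] at h1 h2
    refine ⟨h1.1, h1.2, ?_, ?_⟩
    · simpa [hf, Nat.Coprime] using h2.1.2
    · simp only [hf, Int.cast_natCast]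
      rw [abs_le]
      constructor <;> linarith [h2.2.1, h2.2.2]
  have hsub2 : T ⊆ ((G.image f ∪ {((0:ℤ), 1), ((1:ℤ), 1)} : Finset (ℤ × ℕ)) : Set (ℤ × ℕ)) := by
    rintro ⟨a, n⟩ ⟨h1, h2, h3, h4⟩
    simp only at h1 h2 h3 h4
    have hnR : (1:ℝ) ≤ n := by exact_mod_cast h1
    have hψn := (hψ n).2
    have h4' := h4
    rw [abs_le] at h4
    have e1 : (a:ℝ) ≤ n * α + 1 / 2 := by
      have : (a:ℝ) / n ≤ α + ψ n / n := by linarith [h4.1]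
      rw [div_le_iff₀ (by linarith), add_mul, div_mul_cancel₀ _ (by linarith)] at this
      linarith
    have e2 : n * α - 1 / 2 ≤ (a:ℝ) := by
      have : α - ψ n / n ≤ (a:ℝ) / n := by linarith [h4.2]
      rw [le_div_iff₀ (by linarith), sub_mul, div_mul_cancel₀ _ (by linarith)] at this
      linarith
    have a0 : 0 ≤ a := by
      have : (-1:ℝ) < a := by nlinarith [hα.1]
      have : (-1:ℤ) < a := by exact_mod_cast this
      omega
    have an : a ≤ n := by
      have : (a:ℝ) < n + 1 := by nlinarith [hα.2]
      have : a < (n:ℤ) + 1 := by exact_mod_cast this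
      omega
    rw [Finset.mem_coe, Finset.mem_union]
    by_cases hn1 : n = 1
    · right
      subst hn1
      have : a = 0 ∨ a = 1 := by push_cast at an; omega
      rcases this with rfl | rfl <;> simp
    · left
      have an' : a ≠ n := by
        rintro rfl
        simp at h3; omega
      rw [Finset.mem_image]
      lift a to ℕ using a0
      refine ⟨⟨n, a⟩, ?_, rfl⟩
      rw [hG, Finset.mem_sigma]
      refine ⟨Finset.mem_Icc.2 ⟨h1, h2⟩, ?_⟩
      simp only [sol, Finset.mem_filter, Finset.mem_range, Set.mem_Icc]
      simp only [Int.cast_natCast] at h4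
      refine ⟨⟨by omega, by simpa [Nat.Coprime] using h3⟩, by linarith [h4.2], by linarith [h4.1]⟩
  have hfin : T.Finite := (Finset.finite_toSet _).subset hsub2
  have c1 : G.card ≤ T.ncard := by
    have := Set.ncard_le_ncard hsub1 hfin
    rwa [Set.ncard_coe_finset, hcard] at this
  have c2 : T.ncard ≤ G.card + 2 := by
    have := Set.ncard_le_ncard hsub2 (Finset.finite_toSet _)
    rw [Set.ncard_coe_finset] at this
    refine this.trans ((Finset.card_union_le _ _).trans ?_)
    rw [hcard]
    exact Nat.add_le_add_left Finset.card_le_two _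
  rw [hF, hS]
  have c1' : (G.card:ℝ) ≤ T.ncard := by exact_mod_cast c1
  have c2' : (T.ncard:ℝ) ≤ G.card + 2 := by exact_mod_cast c2
  rw [abs_le]
  constructor <;> linarith

end QDS

namespace QDS

lemma u_exists (a : ℕ) : ∃ u : ℕ → ℝ, (∀ k, 0 ≤ u k) ∧ ∀ k, u k ^ (a + 1) = k := by
  refine ⟨fun k => (k:ℝ) ^ ((1:ℝ) / ((a + 1 : ℕ):ℝ)), fun k => by positivity, fun k => ?_⟩
  rw [one_div]
  exact Real.rpow_inv_natCast_pow (Nat.cast_nonneg k) (by omega)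

/-- deterministic sandwich step -/
lemma sandwich (a : ℕ) {u v x P P1 P2 F F1 F2 : ℝ} (hu : 0 < u) (hv : v ^ (a + 1) = u ^ (a + 1) + 1)
    (hux : u ≤ x) (hxv : x ≤ v) (hu1 : 1 ≤ u ^ (a + 1)) (hP : P = Real.exp x)
    (hP1 : Real.exp u ≤ P1) (hP2 : P2 ≤ Real.exp v + 1)
    (hP2v : Real.exp v ≤ P2)
    (hF1 : |F1 - P1| ≤ P1 / (Real.log P1) ^ a) (hF2 : |F2 - P2| ≤ P2 / (Real.log P2) ^ a)
    (h1 : F1 ≤ F) (h2 : F ≤ F2) (hx2 : 2 ^ a ≤ x ^ a) (hxP : x ^ a ≤ P) :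
    |F - P| ≤ 7 * 2 ^ a * (P / x ^ a) := by
  have hv0 : 0 < v := by linarith
  have hx0 : 0 < x := by linarith
  have hua : 0 < u ^ a := by positivity
  have hP0 : 0 < P := by rw [hP]; exact Real.exp_pos _
  have huv : v - u ≤ 1 / u ^ a := by
    rw [le_div_iff₀ hua]
    have : u ^ a ≤ v ^ a := by gcongr; linarith
    rw [pow_succ, pow_succ] at hv
    nlinarith [mul_le_mul_of_nonneg_right this hv0.le]
  have hv2 : v ≤ 2 * u := by
    by_contra hc
    push Not at hc
    have h3 : (2 * u) ^ (a + 1) < v ^ (a + 1) := by gcongr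
    rw [mul_pow, hv] at h3
    have : (2:ℝ) ≤ 2 ^ (a + 1) := by
      rw [pow_succ]; linarith [one_le_pow₀ (n := a) (by norm_num : (1:ℝ) ≤ 2)]
    nlinarith
  set e := 2 ^ a / x ^ a with he
  have hxa : 0 < x ^ a := by positivity
  have he0 : 0 < e := by positivity
  have he1 : e ≤ 1 := by rw [he, div_le_one hxa]; exact hx2
  have hue : 1 / u ^ a ≤ e := by
    rw [he, div_le_div_iff₀ hua hxa, one_mul, ← mul_pow]
    gcongr; linarith
  have hvue : v - u ≤ e := huv.trans hue
  have hxe : 1 / x ^ a ≤ e := by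
    rw [he]; gcongr; exact one_le_pow₀ (by norm_num)
  have goal_eq : 7 * 2 ^ a * (P / x ^ a) = 7 * e * P := by rw [he]; ring
  rw [goal_eq]
  have hPe : 1 ≤ P * e := by
    calc (1:ℝ) ≤ P * (1 / x ^ a) := by rw [mul_one_div, le_div_iff₀ hxa]; linarith
      _ ≤ _ := by gcongr
  have hexp : Real.exp e ≤ 1 + 2 * e := by
    have := Real.abs_exp_sub_one_le (x := e) (by rw [abs_of_pos he0]; exact he1)
    rw [abs_of_pos he0] at this
    linarith [le_abs_self (Real.exp e - 1)]
  -- upper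
  have hL2 : v ≤ Real.log P2 := (Real.le_log_iff_exp_le ((Real.exp_pos v).trans_le hP2v)).2 hP2v
  have hL1 : u ≤ Real.log P1 := (Real.le_log_iff_exp_le ((Real.exp_pos u).trans_le hP1)).2 hP1
  have hP10 : 0 < P1 := (Real.exp_pos u).trans_le hP1
  have hP20 : 0 < P2 := (Real.exp_pos v).trans_le hP2v
  have b2 : P2 / (Real.log P2) ^ a ≤ P2 * e := by
    calc _ ≤ P2 / x ^ a := by gcongr; linarith
      _ = P2 * (1 / x ^ a) := by ring
      _ ≤ _ := by gcongr
  have b1 : P1 / (Real.log P1) ^ a ≤ P1 * e := by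
    calc _ ≤ P1 / u ^ a := by gcongr
      _ = P1 * (1 / u ^ a) := by ring
      _ ≤ _ := by gcongr
  have up : Real.exp v ≤ P * (1 + 2 * e) := by
    calc Real.exp v ≤ Real.exp (x + e) := Real.exp_le_exp.2 (by linarith)
      _ = P * Real.exp e := by rw [Real.exp_add, hP]
      _ ≤ _ := by gcongr
  have lo : P * (1 - e) ≤ Real.exp u := by
    calc P * (1 - e) ≤ P * Real.exp (-e) := by
          gcongr; linarith [Real.add_one_le_exp (-e)]
      _ = Real.exp (x - e) := by rw [hP, ← Real.exp_add]; ring_nf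
      _ ≤ _ := Real.exp_le_exp.2 (by linarith)
  have hu2 : P2 ≤ P * (1 + 3 * e) := by linarith
  rw [abs_le] at hF1 hF2 ⊢
  constructor
  · have : P * (1 - e) * (1 - e) ≤ P1 * (1 - e) :=
      mul_le_mul_of_nonneg_right (lo.trans hP1) (by linarith)
    have h5 : 0 ≤ P * e ^ 2 := by positivity
    have h6 : 0 ≤ P * e := by positivity
    have e1 : P * (1 - e) * (1 - e) = P - 2 * (P * e) + P * e ^ 2 := by ring
    have e2 : P1 * (1 - e) = P1 - P1 * e := by ring
    linarith [hF1.1]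
  · have : P2 * (1 + e) ≤ P * (1 + 3 * e) * (1 + e) :=
      mul_le_mul_of_nonneg_right hu2 (by linarith)
    have h5 : P * e ^ 2 ≤ P * e := by
      have : e ^ 2 ≤ e := by nlinarith
      gcongr
    have e1 : P * (1 + 3 * e) * (1 + e) = P + 4 * (P * e) + 3 * (P * e ^ 2) := by ring
    have e2 : P2 * (1 + e) = P2 + P2 * e := by ring
    linarith [hF2.2]

lemma main_ae {ψ : ℕ → ℝ} (hψ : ∀ n, ψ n ∈ Set.Icc (0:ℝ) (1/2))
    (hP : Tendsto (fun N => ∑ n ∈ Finset.Icc 1 N, lam ψ n) atTop atTop) (a : ℕ) :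
    ∀ᵐ α ∂(volume.restrict (Set.Icc (0:ℝ) 1)), ∀ᶠ N : ℕ in atTop,
      |(∑ n ∈ Finset.Icc 1 N, FF ψ n α) - ∑ n ∈ Finset.Icc 1 N, lam ψ n| ≤
        7 * 2 ^ a * ((∑ n ∈ Finset.Icc 1 N, lam ψ n) / (Real.log (∑ n ∈ Finset.Icc 1 N, lam ψ n)) ^ a) := by
  classical
  set P : ℕ → ℝ := fun N => ∑ n ∈ Finset.Icc 1 N, lam ψ n with hPdef
  set F : ℕ → ℝ → ℝ := fun N α => ∑ n ∈ Finset.Icc 1 N, FF ψ n α with hFdef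
  obtain ⟨u, hu0, hu⟩ := u_exists a
  obtain ⟨C, hC, P0, hP0, hvar⟩ := variance (2 * a + 2 * (a + 1))
  have hPm : Monotone P := by
    intro M N h
    exact Finset.sum_le_sum_of_subset_of_nonneg (Finset.Icc_subset_Icc_right h)
      fun n _ _ => lam_nonneg hψ n
  have hFm : ∀ α, Monotone fun N => F N α := by
    intro α M N h
    exact Finset.sum_le_sum_of_subset_of_nonneg (Finset.Icc_subset_Icc_right h)
      fun n _ _ => FF_nonneg ψ n α
  have hex : ∀ k, ∃ N, Real.exp (u k) ≤ P N := fun k =>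
    ((tendsto_atTop.1 hP (Real.exp (u k))).exists)
  set NN : ℕ → ℕ := fun k => Nat.find (hex k) with hNN
  have n1 : ∀ k, Real.exp (u k) ≤ P (NN k) := fun k => Nat.find_spec (hex k)
  have n2 : ∀ k, P (NN k) ≤ Real.exp (u k) + 1 := by
    intro k
    rcases Nat.eq_zero_or_pos (NN k) with h | h
    · rw [h]
      have : P 0 = 0 := by simp [hPdef]
      rw [this]; positivity
    · have h1 : P (NN k - 1) < Real.exp (u k) := by
        have := Nat.find_min (hex k) (m := NN k - 1) (by show NN k - 1 < NN k; omega)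
        exact not_le.1 this
      have h2 : P (NN k) = P (NN k - 1) + lam ψ (NN k) := by
        obtain ⟨m, hm⟩ : ∃ m, NN k = m + 1 := ⟨NN k - 1, by omega⟩
        rw [hm]
        simp only [hPdef, Nat.add_sub_cancel]
        rw [Finset.sum_Icc_succ_top (by omega)]
      linarith [lam_le_one hψ (NN k)]
  have n3 : ∀ k N, Real.exp (u k) ≤ P N → NN k ≤ N := fun k N h => Nat.find_min' (hex k) h
  clear_value NN
  set μ := (volume.restrict (Set.Icc (0:ℝ) 1)) with hμ
  set E : ℕ → Set ℝ := fun k => {α | (P (NN k) / (Real.log (P (NN k))) ^ a) ^ 2 ≤ (F (NN k) α - P (NN k)) ^ 2} with hE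
  have hutend : Tendsto u atTop atTop := by
    rw [tendsto_atTop]
    intro b
    obtain ⟨K, hK⟩ := exists_nat_ge ((max b 0) ^ (a + 1))
    filter_upwards [eventually_ge_atTop K] with k hk
    have : (max b 0) ^ (a + 1) ≤ u k ^ (a + 1) := by
      rw [hu]; exact hK.trans (by exact_mod_cast hk)
    exact (le_max_left b 0).trans ((pow_le_pow_iff_left₀ (le_max_right _ _) (hu0 k) (by omega)).1 this)
  have hbound : ∀ᶠ k in atTop, μ.real (E k) ≤ C * (1 / (k:ℝ) ^ 2) := by
    filter_upwards [hutend.eventually_ge_atTop P0, eventually_ge_atTop 1] with k hk hk1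
    have hkR : (1:ℝ) ≤ k := by exact_mod_cast hk1
    have hPk : P0 ≤ P (NN k) := by
      have := Real.add_one_le_exp (u k)
      linarith [n1 k]
    have hv := hvar ψ hψ (NN k) (P (NN k)) rfl hPk
    have hmk := mul_meas_ge_le_integral_of_nonneg (μ := μ)
      (f := fun α => (F (NN k) α - P (NN k)) ^ 2) (Eventually.of_forall fun α => sq_nonneg _)
      (dev_integrable ψ (NN k) (P (NN k))) ((P (NN k) / (Real.log (P (NN k))) ^ a) ^ 2)
    have hmk2 := hmk.trans hv
    change (P (NN k) / (Real.log (P (NN k))) ^ a) ^ 2 * μ.real (E k) ≤ _ at hmk2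
    have hp0 : 0 < P (NN k) := by linarith
    have hL : u k ≤ Real.log (P (NN k)) := (Real.le_log_iff_exp_le hp0).2 (n1 k)
    generalize μ.real (E k) = m at *
    generalize P (NN k) = p at *
    have hL0 : 0 < Real.log p := by linarith
    generalize Real.log p = l at *
    have e1 : C * (p ^ 2 / l ^ (2 * a + 2 * (a + 1))) = (p / l ^ a) ^ 2 * (C * (1 / (l ^ (a + 1)) ^ 2)) := by
      rw [pow_add, div_pow, ← pow_mul, ← pow_mul, mul_comm a 2, mul_comm (a + 1) 2]
      field_simp
    rw [e1] at hmk2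
    have h3 := le_of_mul_le_mul_left hmk2 (by positivity)
    refine h3.trans ?_
    have : (k:ℝ) ≤ l ^ (a + 1) := by
      rw [← hu k]
      exact pow_le_pow_left₀ (hu0 k) hL _
    gcongr
  have hsum : Summable fun k => μ.real (E k) := by
    refine Summable.of_norm_bounded_eventually_nat
      ((Real.summable_one_div_nat_pow.2 (by norm_num : 1 < 2)).mul_left C) ?_
    filter_upwards [hbound] with k hk
    rw [Real.norm_of_nonneg measureReal_nonneg]
    exact hk
  have hBC : ∀ᵐ α ∂μ, ∀ᶠ k in atTop, α ∉ E k := by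
    apply ae_eventually_notMem
    have : ∀ k, μ (E k) = ENNReal.ofReal (μ.real (E k)) := fun k => (ofReal_measureReal).symm
    simp_rw [this]
    exact hsum.tsum_ofReal_ne_top
  filter_upwards [hBC] with α hα
  obtain ⟨K, hK⟩ := eventually_atTop.1 hα
  have hlogx : Tendsto (fun N => Real.log (P N)) atTop atTop := Real.tendsto_log_atTop.comp hP
  have hlim : ∀ᶠ x : ℝ in atTop, x ^ a ≤ Real.exp x := by
    have := (Real.isLittleO_pow_exp_atTop (n := a)).bound (by norm_num : (0:ℝ) < 1)
    filter_upwards [this, eventually_ge_atTop 0] with x hx h1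
    rw [Real.norm_of_nonneg (by positivity), Real.norm_of_nonneg (by positivity), one_mul] at hx
    exact hx
  filter_upwards [hlogx.eventually hlim, hlogx.eventually_ge_atTop 2,
    hlogx.eventually_ge_atTop ((K:ℝ) + 1), hP.eventually_gt_atTop 0] with N g1 g2 g3 g4
  set x := Real.log (P N) with hx
  have hPx : P N = Real.exp x := (Real.exp_log g4).symm
  set k := ⌊x ^ (a + 1)⌋₊ with hk
  have hx0 : 0 ≤ x := by linarith
  have k1 : (k:ℝ) ≤ x ^ (a + 1) := Nat.floor_le (by positivity)
  have k2 : x ^ (a + 1) < k + 1 := Nat.lt_floor_add_one _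
  have hxx : x ≤ x ^ (a + 1) := le_self_pow₀ (by linarith) (by omega)
  have hkK : K ≤ k := Nat.le_floor (by linarith)
  have hk1 : 1 ≤ k := Nat.le_floor (by push_cast; linarith)
  have hk1R : (1:ℝ) ≤ k := by exact_mod_cast hk1
  clear_value k
  have hux : u k ≤ x := by
    rw [← hu k] at k1
    exact (pow_le_pow_iff_left₀ (hu0 k) hx0 (by omega)).1 k1
  have hxv : x < u (k + 1) := by
    have : x ^ (a + 1) < u (k + 1) ^ (a + 1) := by rw [hu]; push_cast; exact k2
    exact (pow_lt_pow_iff_left₀ hx0 (hu0 _) (by omega)).1 this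
  have hupos : 0 < u k := by
    rcases (hu0 k).lt_or_eq with h | h
    · exact h
    · have := hu k
      rw [← h, zero_pow (by omega)] at this
      linarith
  have hNk : NN k ≤ N := n3 k N (by rw [hPx]; exact Real.exp_le_exp.2 hux)
  have hgood : ∀ j, K ≤ j → |F (NN j) α - P (NN j)| ≤ P (NN j) / (Real.log (P (NN j))) ^ a := by
    intro j hj
    have := hK j hj
    simp only [hE, Set.mem_ofPred_eq, not_le] at this
    have hp1 : 1 ≤ P (NN j) := le_trans (Real.one_le_exp (hu0 j)) (n1 j)
    exact (abs_lt_of_sq_lt_sq this (div_nonneg (by linarith) (pow_nonneg (Real.log_nonneg hp1) _))).le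
  have hNk1 : N < NN (k + 1) := by
    apply hPm.reflect_lt
    rw [hPx]; exact (Real.exp_lt_exp.2 hxv).trans_le (n1 _)
  have hv : u (k + 1) ^ (a + 1) = u k ^ (a + 1) + 1 := by rw [hu, hu]; push_cast; ring
  exact sandwich a hupos hv hux hxv.le (by rw [hu]; exact hk1R) hPx (n1 k) (n2 _) (n1 _)
    (hgood k hkK) (hgood (k + 1) (by omega)) (hFm α hNk) (hFm α hNk1.le)
    (pow_le_pow_left₀ (by norm_num) g2 a) (g1.trans hPx.ge)

lemma Psi_tendsto {ψ : ℕ → ℝ} (hψ : ∀ n, ψ n ∈ Set.Icc (0:ℝ) (1/2))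
    (hdiv : ¬ Summable (fun n : ℕ => ψ n * (Nat.totient n : ℝ) / n)) :
    Tendsto (fun N => ∑ n ∈ Finset.Icc 1 N, lam ψ n) atTop atTop := by
  have h1 : ¬ Summable (lam ψ) := by
    intro h
    apply hdiv
    refine (h.mul_left (1/2)).congr fun n => ?_
    unfold lam; ring
  have h2 := (not_summable_iff_tendsto_nat_atTop_of_nonneg (lam_nonneg hψ)).1 h1
  have h3 := h2.comp (tendsto_add_atTop_nat 1)
  refine h3.congr fun N => ?_
  simp only [Function.comp]
  rw [Finset.sum_range_succ', Finset.range_eq_Ico, Finset.sum_Ico_add' (fun n => lam ψ n) 0 N 1]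
  have : lam ψ 0 = 0 := by simp [lam]
  rw [this, add_zero]
  rfl

end QDS

/-- **Aistleitner–Borda–Hauke**: quantitative Duffin–Schaeffer with error term
`O_{α,A}((log Ψ(N))^{-A})`. -/
theorem quantitative_duffin_schaeffer (ψ : ℕ → ℝ)
    (hψ : ∀ n, ψ n ∈ Set.Icc (0:ℝ) (1/2))
    (hdiv : ¬ Summable (fun n : ℕ => ψ n * (Nat.totient n : ℝ) / n))
    (A : ℝ) (hA : 0 < A) :
    ∀ᵐ α ∂(volume.restrict (Set.Icc (0:ℝ) 1)),
      ∃ C : ℝ, 0 < C ∧ ∀ᶠ N : ℕ in atTop,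
        |(S ψ N α : ℝ) - Psi ψ N| ≤ C * Psi ψ N / (Real.log (Psi ψ N)) ^ A := by
  have hP := QDS.Psi_tendsto hψ hdiv
  set a := ⌈A⌉₊ with ha
  have hAa : A ≤ a := Nat.le_ceil A
  clear_value a
  filter_upwards [QDS.main_ae hψ hP a, ae_restrict_mem measurableSet_Icc] with α hα hmem
  refine ⟨7 * 2 ^ a + 2, by positivity, ?_⟩
  have hlim : ∀ᶠ x : ℝ in atTop, x ^ a ≤ Real.exp x := by
    have := (Real.isLittleO_pow_exp_atTop (n := a)).bound (by norm_num : (0:ℝ) < 1)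
    filter_upwards [this, eventually_ge_atTop 0] with x hx h1
    rw [Real.norm_of_nonneg (by positivity), Real.norm_of_nonneg (by positivity), one_mul] at hx
    exact hx
  have hlogx := Real.tendsto_log_atTop.comp hP
  filter_upwards [hα, hlogx.eventually hlim, hlogx.eventually_ge_atTop 1,
    hP.eventually_gt_atTop 0] with N h1 h2 h3 h4
  have hPsi : Psi ψ N = ∑ n ∈ Finset.Icc 1 N, QDS.lam ψ n := rfl
  have hS := QDS.S_close hψ N α hmem
  simp only [Function.comp] at h2 h3
  rw [← hPsi] at h1 h2 h3 h4
  rw [Real.exp_log h4] at h2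
  have hp : (Real.log (Psi ψ N)) ^ A ≤ (Real.log (Psi ψ N)) ^ a := by
    rw [← Real.rpow_natCast]
    exact Real.rpow_le_rpow_of_exponent_le h3 hAa
  have hl0 : 0 < (Real.log (Psi ψ N)) ^ A := Real.rpow_pos_of_pos (by linarith) _
  have hla : 0 < (Real.log (Psi ψ N)) ^ a := pow_pos (by linarith) _
  have h5 : Psi ψ N / (Real.log (Psi ψ N)) ^ a ≤ Psi ψ N / (Real.log (Psi ψ N)) ^ A := by gcongr
  have h6 : 1 ≤ Psi ψ N / (Real.log (Psi ψ N)) ^ a := by rw [le_div_iff₀ hla]; linarith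
  have h7 := abs_sub_le (S ψ N α : ℝ) (∑ n ∈ Finset.Icc 1 N, QDS.FF ψ n α) (Psi ψ N)
  rw [mul_div_assoc]
  calc _ ≤ (7 * 2 ^ a + 2) * (Psi ψ N / (Real.log (Psi ψ N)) ^ a) := by linarith
    _ ≤ _ := by gcongr
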